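/- (Uniqueness of the asymptotic cone at infinity.) Let n ≥ 2 and let (u,v) be a solution of Δu = u v², Δv = v u², u > 0, v > 0 on ℝⁿ which is a local minimizer and satisfies the linear growth condition u(x) + v(x) ≤ C₀(1 + |x|) for some constant C₀ > 0. Then there exist a constant vector e₀ ∈ ℝⁿ and a constant C > 0 such that for every x₀ ∈ ℝⁿ and every R ≥ 1, ∫_{B_R(x₀)} |∇(u − v) − e₀|² ≤ C R^{n − 1/2}. -/

import Mathlib

open MeasureTheory Metric
open scoped RealInnerProductSpace

noncomputable section

/-- The Laplacian of a function on Euclidean space, as the trace of the second derivative. -/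
def lap {n : ℕ} (u : EuclideanSpace ℝ (Fin n) → ℝ) (x : EuclideanSpace ℝ (Fin n)) : ℝ :=
  ∑ i : Fin n, iteratedFDeriv ℝ 2 u x (fun _ => EuclideanSpace.single i 1)

/-- A (positive classical) solution of the system Δu = u v², Δv = v u², u,v > 0 on ℝⁿ. -/
def IsSolution {n : ℕ} (u v : EuclideanSpace ℝ (Fin n) → ℝ) : Prop :=
  ContDiff ℝ (⊤ : ℕ∞) u ∧ ContDiff ℝ (⊤ : ℕ∞) v ∧ (∀ x, 0 < u x) ∧ (∀ x, 0 < v x) ∧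
    (∀ x, lap u x = u x * v x ^ 2) ∧ (∀ x, lap v x = v x * u x ^ 2)

/-- The energy of a pair of functions on the ball B_R(0). -/
def energy {n : ℕ} (u v : EuclideanSpace ℝ (Fin n) → ℝ) (R : ℝ) : ℝ :=
  ∫ y in ball (0 : EuclideanSpace ℝ (Fin n)) R,
    (‖gradient u y‖ ^ 2 + ‖gradient v y‖ ^ 2 + (u y) ^ 2 * (v y) ^ 2)

/-- A local minimizer: any smooth competitor coinciding with (u,v) outside a ball has no
smaller energy on that ball. -/
def IsLocalMinimizer {n : ℕ} (u v : EuclideanSpace ℝ (Fin n) → ℝ) : Prop :=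
  ∀ R > (0 : ℝ), ∀ ub vb : EuclideanSpace ℝ (Fin n) → ℝ,
    ContDiff ℝ (⊤ : ℕ∞) ub → ContDiff ℝ (⊤ : ℕ∞) vb →
    (∀ x ∉ ball (0 : EuclideanSpace ℝ (Fin n)) R, ub x = u x ∧ vb x = v x) →
    energy u v R ≤ energy ub vb R

open scoped ContDiff Topology

section Parametric

variable {P E : Type} [NormedAddCommGroup P] [NormedSpace ℝ P] [FiniteDimensional ℝ P]
  [NormedAddCommGroup E] [NormedSpace ℝ E] [FiniteDimensional ℝ E] [MeasureSpace E] [BorelSpace E]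
  [IsFiniteMeasureOnCompacts (volume : Measure E)]

theorem integrable_smul_of_hasCompactSupport {W : Type} [NormedAddCommGroup W] [NormedSpace ℝ W]
    {k : E → ℝ} (hk : Continuous k) (hc : HasCompactSupport k) {g : E → W} (hg : Continuous g) :
    Integrable (fun z => k z • g z) :=
  (hk.smul hg).integrable_of_hasCompactSupport hc.smul_right

theorem hasFDerivAt_integral_smul {W : Type} [NormedAddCommGroup W] [NormedSpace ℝ W]
    [CompleteSpace W] {k : E → ℝ} (hk : Continuous k) (hc : HasCompactSupport k) {F : P × E → W}
    (hF : ContDiff ℝ 1 F) (p : P) :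
    HasFDerivAt (fun p => ∫ z, k z • F (p, z))
      (∫ z, k z • (fderiv ℝ F (p, z)).comp (ContinuousLinearMap.inl ℝ P E)) p := by
  have hF' : Continuous fun q : P × E =>
      k q.2 • (fderiv ℝ F q).comp (ContinuousLinearMap.inl ℝ P E) :=
    (hk.comp continuous_snd).smul ((hF.continuous_fderiv (by simp)).clm_comp continuous_const)
  have hK : IsCompact (closedBall p 1 ×ˢ tsupport k) := (isCompact_closedBall p 1).prod hc
  obtain ⟨M, hM⟩ := hK.exists_bound_of_continuousOn hF'.continuousOn
  refine hasFDerivAt_integral_of_dominated_of_fderiv_le (𝕜 := ℝ)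
    (F := fun p z => k z • F (p, z))
    (F' := fun p z => k z • (fderiv ℝ F (p, z)).comp (ContinuousLinearMap.inl ℝ P E))
    (bound := (tsupport k).indicator fun _ => M) (ball_mem_nhds p one_pos) ?_ ?_ ?_ ?_ ?_ ?_
  · refine Filter.Eventually.of_forall fun q => Continuous.aestronglyMeasurable ?_
    exact hk.smul (hF.continuous.comp (by fun_prop))
  · exact integrable_smul_of_hasCompactSupport hk hc (hF.continuous.comp (by fun_prop))
  · exact (hF'.comp (by fun_prop : Continuous fun z : E => (p, z))).aestronglyMeasurable
  · refine Filter.Eventually.of_forall fun z q hq => ?_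
    by_cases hz : z ∈ tsupport k
    · rw [Set.indicator_of_mem hz]
      exact hM (q, z) ⟨ball_subset_closedBall hq, hz⟩
    · rw [Set.indicator_of_notMem hz, image_eq_zero_of_notMem_tsupport hz, zero_smul, norm_zero]
  · exact (integrable_indicator_iff (isClosed_tsupport k).measurableSet).2
      (integrableOn_const hc.measure_lt_top.ne)
  · refine Filter.Eventually.of_forall fun z q _ => ?_
    have h1 : HasFDerivAt F (fderiv ℝ F (q, z)) (q, z) :=
      (hF.differentiable (by simp) _).hasFDerivAt
    have h2 : HasFDerivAt (fun q : P => (q, z)) (ContinuousLinearMap.inl ℝ P E) q := by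
      exact hasFDerivAt_prodMk_left q z
    exact (h1.comp q h2).const_smul (k z)

theorem contDiff_integral_smul_aux {k : E → ℝ} (hk : Continuous k) (hc : HasCompactSupport k)
    (m : ℕ) : ∀ {W : Type} [NormedAddCommGroup W] [NormedSpace ℝ W] [CompleteSpace W]
    {F : P × E → W}, ContDiff ℝ ∞ F → ContDiff ℝ m (fun p => ∫ z, k z • F (p, z)) := by
  induction m with
  | zero =>
    intro W _ _ _ F hF
    have h1 : ContDiff ℝ 1 F := hF.of_le (by exact_mod_cast le_top)
    exact contDiff_zero.2 (continuous_iff_continuousAt.2 fun p =>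
      (hasFDerivAt_integral_smul hk hc h1 p).continuousAt)
  | succ m ih =>
    intro W _ _ _ F hF
    have h1 : ContDiff ℝ 1 F := hF.of_le (by exact_mod_cast le_top)
    have hd := fun p => hasFDerivAt_integral_smul hk hc h1 p
    have : ((m + 1 : ℕ) : WithTop ℕ∞) = (m : WithTop ℕ∞) + 1 := by norm_cast
    rw [this, contDiff_succ_iff_fderiv]
    refine ⟨fun p => (hd p).differentiableAt, fun h => absurd h (by simp), ?_⟩
    rw [show fderiv ℝ (fun p => ∫ z, k z • F (p, z)) = fun p =>
      ∫ z, k z • (fderiv ℝ F (p, z)).comp (ContinuousLinearMap.inl ℝ P E) from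
        funext fun p => (hd p).fderiv]
    exact ih (F := fun q => (fderiv ℝ F q).comp (ContinuousLinearMap.inl ℝ P E))
      ((hF.fderiv_right (by simp)).clm_comp contDiff_const)

theorem contDiff_integral_smul {k : E → ℝ} (hk : Continuous k) (hc : HasCompactSupport k)
    {W : Type} [NormedAddCommGroup W] [NormedSpace ℝ W] [CompleteSpace W]
    {F : P × E → W} (hF : ContDiff ℝ ∞ F) : ContDiff ℝ ∞ (fun p => ∫ z, k z • F (p, z)) :=
  contDiff_infty.2 fun m => contDiff_integral_smul_aux hk hc m hF

end Parametric

/-- The `i`-th partial derivative. -/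
def pd {n : ℕ} (i : Fin n) (f : EuclideanSpace ℝ (Fin n) → ℝ) (x : EuclideanSpace ℝ (Fin n)) : ℝ :=
  fderiv ℝ f x (EuclideanSpace.single i 1)

/-- The average of `f` with the kernel `k`, centred at `x`, at scale `r`. -/
def Av {n : ℕ} (k f : EuclideanSpace ℝ (Fin n) → ℝ) (x : EuclideanSpace ℝ (Fin n)) (r : ℝ) : ℝ :=
  ∫ z, k z * f (x + r • z)

/-- Continuous kernels supported in the closed unit ball. -/
structure IsKer {n : ℕ} (k : EuclideanSpace ℝ (Fin n) → ℝ) : Prop where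
  cont : Continuous k
  supp : ∀ z, 1 ≤ ‖z‖ → k z = 0

section Calculus

variable {n : ℕ}

local notation "𝔼" => EuclideanSpace ℝ (Fin n)

theorem IsKer.compact {k : 𝔼 → ℝ} (hk : IsKer k) : HasCompactSupport k :=
  HasCompactSupport.of_support_subset_isCompact (isCompact_closedBall 0 1) fun z hz => by
    by_contra h
    exact hz (hk.supp z (by simpa using (not_le.1 fun h' => h (by simpa using h')).le))

theorem IsKer.bdd {k : 𝔼 → ℝ} (hk : IsKer k) : ∃ M > 0, ∀ z, |k z| ≤ M := by
  obtain ⟨M, hM⟩ := hk.compact.exists_bound_of_continuous hk.cont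
  exact ⟨max M 1, by positivity, fun z => (hM z).trans (le_max_left _ _)⟩

theorem IsKer.mul {k g : 𝔼 → ℝ} (hk : IsKer k) (hg : Continuous g) :
    IsKer (fun z => g z * k z) :=
  ⟨hg.mul hk.cont, fun z hz => by rw [hk.supp z hz, mul_zero]⟩

theorem integrable_av {k f : 𝔼 → ℝ} (hk : IsKer k) (hf : Continuous f) (x : 𝔼) (r : ℝ) :
    Integrable (fun z => k z * f (x + r • z)) :=
  integrable_smul_of_hasCompactSupport hk.cont hk.compact (hf.comp (by fun_prop))

theorem contDiff_pd {f : 𝔼 → ℝ} (hf : ContDiff ℝ ∞ f) (i : Fin n) : ContDiff ℝ ∞ (pd i f) :=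
  (hf.fderiv_right (m := ∞) (by simp)).clm_apply contDiff_const

theorem fderiv_eq_sum_pd (f : 𝔼 → ℝ) (x z : 𝔼) : fderiv ℝ f x z = ∑ i, z i * pd i f x := by
  conv_lhs => rw [← (EuclideanSpace.basisFun (Fin n) ℝ).sum_repr z]
  rw [map_sum]
  simp [pd]

theorem lap_eq {f : 𝔼 → ℝ} (hf : ContDiff ℝ ∞ f) (x : 𝔼) : lap f x = ∑ i, pd i (pd i f) x := by
  unfold lap
  refine Finset.sum_congr rfl fun i _ => ?_
  rw [iteratedFDeriv_two_apply]
  unfold pd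
  rw [fderiv_clm_apply ((hf.fderiv_right (m := ∞) (by simp)).differentiable (by simp) x)
    (differentiableAt_const _)]
  simp

theorem contDiff_lap {f : 𝔼 → ℝ} (hf : ContDiff ℝ ∞ f) : ContDiff ℝ ∞ (lap f) := by
  rw [funext (lap_eq hf)]
  exact ContDiff.sum fun i _ => contDiff_pd (contDiff_pd hf i) i

theorem pd_add {f g : 𝔼 → ℝ} (hf : ContDiff ℝ ∞ f) (hg : ContDiff ℝ ∞ g) (i : Fin n) (x : 𝔼) :
    pd i (fun y => f y + g y) x = pd i f x + pd i g x := by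
  unfold pd
  rw [fderiv_fun_add (hf.differentiable (by simp) x) (hg.differentiable (by simp) x)]
  rfl

theorem pd_sub {f g : 𝔼 → ℝ} (hf : ContDiff ℝ ∞ f) (hg : ContDiff ℝ ∞ g) (i : Fin n) (x : 𝔼) :
    pd i (fun y => f y - g y) x = pd i f x - pd i g x := by
  unfold pd
  rw [fderiv_fun_sub (hf.differentiable (by simp) x) (hg.differentiable (by simp) x)]
  rfl

theorem pd_mul {f g : 𝔼 → ℝ} (hf : ContDiff ℝ ∞ f) (hg : ContDiff ℝ ∞ g) (i : Fin n) (x : 𝔼) :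
    pd i (fun y => f y * g y) x = f x * pd i g x + g x * pd i f x := by
  unfold pd
  rw [fderiv_fun_mul (hf.differentiable (by simp) x) (hg.differentiable (by simp) x)]
  rfl

theorem lap_add {f g : 𝔼 → ℝ} (hf : ContDiff ℝ ∞ f) (hg : ContDiff ℝ ∞ g) (x : 𝔼) :
    lap (fun y => f y + g y) x = lap f x + lap g x := by
  rw [lap_eq (hf.add hg), lap_eq hf, lap_eq hg, ← Finset.sum_add_distrib]
  refine Finset.sum_congr rfl fun i _ => ?_
  rw [funext (pd_add hf hg i), pd_add (contDiff_pd hf i) (contDiff_pd hg i)]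

theorem lap_sub {f g : 𝔼 → ℝ} (hf : ContDiff ℝ ∞ f) (hg : ContDiff ℝ ∞ g) (x : 𝔼) :
    lap (fun y => f y - g y) x = lap f x - lap g x := by
  rw [lap_eq (hf.sub hg), lap_eq hf, lap_eq hg, ← Finset.sum_sub_distrib]
  refine Finset.sum_congr rfl fun i _ => ?_
  rw [funext (pd_sub hf hg i), pd_sub (contDiff_pd hf i) (contDiff_pd hg i)]

theorem pd_comm {f : 𝔼 → ℝ} (hf : ContDiff ℝ ∞ f) (i j : Fin n) (x : 𝔼) :
    pd i (pd j f) x = pd j (pd i f) x := by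
  have hd := (hf.fderiv_right (m := ∞) (by simp)).differentiable (by simp) x
  have hs : IsSymmSndFDerivAt ℝ f x := hf.contDiffAt.isSymmSndFDerivAt (by
    simpa using (WithTop.coe_le_coe.2 (le_top : (2 : ℕ∞) ≤ ⊤)))
  have key : ∀ i j : Fin n, pd i (pd j f) x =
      fderiv ℝ (fderiv ℝ f) x (EuclideanSpace.single i 1) (EuclideanSpace.single j 1) := by
    intro i j
    unfold pd
    rw [fderiv_clm_apply hd (differentiableAt_const _)]
    simp
  rw [key, key]
  exact hs _ _

theorem lap_pd {f : 𝔼 → ℝ} (hf : ContDiff ℝ ∞ f) (i : Fin n) (x : 𝔼) :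
    lap (pd i f) x = pd i (lap f) x := by
  rw [lap_eq (contDiff_pd hf i), funext (lap_eq hf)]
  have : pd i (fun y => ∑ j, pd j (pd j f) y) x = ∑ j, pd i (pd j (pd j f)) x := by
    have h := fderiv_fun_sum (u := Finset.univ) (A := fun j => pd j (pd j f)) (x := x) (𝕜 := ℝ)
      fun j _ => ((contDiff_pd (contDiff_pd hf j) j).differentiable (by simp) x)
    change fderiv ℝ _ x _ = _
    rw [h, FunLike.coe_sum, Finset.sum_apply]
    rfl
  rw [this]
  refine Finset.sum_congr rfl fun j _ => ?_
  rw [funext (pd_comm hf j i), pd_comm (contDiff_pd hf j)]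

theorem av_joint {k f : 𝔼 → ℝ} (hk : IsKer k) (hf : ContDiff ℝ ∞ f) :
    ContDiff ℝ ∞ (fun p : 𝔼 × ℝ => Av k f p.1 p.2) := by
  have := contDiff_integral_smul (P := 𝔼 × ℝ) hk.cont hk.compact
    (F := fun q : (𝔼 × ℝ) × 𝔼 => f (q.1.1 + q.1.2 • q.2)) (hf.comp (by fun_prop))
  exact this

theorem contDiff_av {k f : 𝔼 → ℝ} (hk : IsKer k) (hf : ContDiff ℝ ∞ f) (r : ℝ) :
    ContDiff ℝ ∞ (fun y => Av k f y r) :=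
  (av_joint hk hf).comp (contDiff_id.prodMk contDiff_const)

theorem pd_av {k f : 𝔼 → ℝ} (hk : IsKer k) (hf : ContDiff ℝ ∞ f) (r : ℝ) (i : Fin n) (x : 𝔼) :
    pd i (fun y => Av k f y r) x = Av k (pd i f) x r := by
  have h1 : ContDiff ℝ 1 f := hf.of_le (by exact_mod_cast le_top)
  have hF : ContDiff ℝ 1 (fun q : 𝔼 × 𝔼 => f (q.1 + r • q.2)) := h1.comp (by fun_prop)
  have h := hasFDerivAt_integral_smul (P := 𝔼) hk.cont hk.compact hF x
  have hc : Continuous fun z => (fderiv ℝ (fun q : 𝔼 × 𝔼 => f (q.1 + r • q.2)) (x, z)).comp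
      (ContinuousLinearMap.inl ℝ 𝔼 𝔼) :=
    ((hF.continuous_fderiv (by simp)).comp (by fun_prop)).clm_comp continuous_const
  have h2 : pd i (fun y => Av k f y r) x = (∫ z, k z •
      (fderiv ℝ (fun q : 𝔼 × 𝔼 => f (q.1 + r • q.2)) (x, z)).comp
      (ContinuousLinearMap.inl ℝ 𝔼 𝔼)) (EuclideanSpace.single i 1) := by
    unfold pd
    rw [← h.fderiv]
    rfl
  rw [h2, ContinuousLinearMap.integral_apply
    (integrable_smul_of_hasCompactSupport hk.cont hk.compact hc)]
  unfold Av
  refine integral_congr_ae (Filter.Eventually.of_forall fun z => ?_)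
  have hg : HasFDerivAt (fun q : 𝔼 × 𝔼 => f (q.1 + r • q.2))
      ((fderiv ℝ f (x + r • z)).comp (ContinuousLinearMap.fst ℝ 𝔼 𝔼 +
        r • ContinuousLinearMap.snd ℝ 𝔼 𝔼)) (x, z) := by
    have a : HasFDerivAt f (fderiv ℝ f (x + r • z)) (x + r • z) :=
      (hf.differentiable (by simp) _).hasFDerivAt
    have b : HasFDerivAt (fun q : 𝔼 × 𝔼 => q.1 + r • q.2) (ContinuousLinearMap.fst ℝ 𝔼 𝔼 +
        r • ContinuousLinearMap.snd ℝ 𝔼 𝔼) (x, z) :=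
      hasFDerivAt_fst.add (hasFDerivAt_snd.const_smul r)
    exact HasFDerivAt.comp (x, z) (f := fun q : 𝔼 × 𝔼 => q.1 + r • q.2) a b
  simp [hg.fderiv, pd]

theorem hasDerivAt_av {k f : 𝔼 → ℝ} (hk : IsKer k) (hf : ContDiff ℝ ∞ f) (x : 𝔼) (r : ℝ) :
    HasDerivAt (fun t => Av k f x t) (∑ i, Av (fun z => z i * k z) (pd i f) x r) r := by
  have h1 : ContDiff ℝ 1 f := hf.of_le (by exact_mod_cast le_top)
  have hF : ContDiff ℝ 1 (fun q : ℝ × 𝔼 => f (x + q.1 • q.2)) := h1.comp (by fun_prop)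
  have h := (hasFDerivAt_integral_smul (P := ℝ) hk.cont hk.compact hF r).hasDerivAt
  have hc : Continuous fun z => (fderiv ℝ (fun q : ℝ × 𝔼 => f (x + q.1 • q.2)) (r, z)).comp
      (ContinuousLinearMap.inl ℝ ℝ 𝔼) :=
    ((hF.continuous_fderiv (by simp)).comp (by fun_prop)).clm_comp continuous_const
  refine h.congr_deriv ?_
  rw [ContinuousLinearMap.integral_apply
    (integrable_smul_of_hasCompactSupport hk.cont hk.compact hc)]
  unfold Av
  rw [← integral_finsetSum _ fun i _ => integrable_av (hk.mul (g := fun z => z i) (by fun_prop))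
    (contDiff_pd hf i).continuous x r]
  refine integral_congr_ae (Filter.Eventually.of_forall fun z => ?_)
  have hg : HasFDerivAt (fun q : ℝ × 𝔼 => f (x + q.1 • q.2))
      ((fderiv ℝ f (x + r • z)).comp (r • ContinuousLinearMap.snd ℝ ℝ 𝔼 +
        (ContinuousLinearMap.fst ℝ ℝ 𝔼).smulRight z)) (r, z) := by
    have a : HasFDerivAt f (fderiv ℝ f (x + r • z)) (x + r • z) :=
      (hf.differentiable (by simp) _).hasFDerivAt
    have b : HasFDerivAt (fun q : ℝ × 𝔼 => x + q.1 • q.2) (r • ContinuousLinearMap.snd ℝ ℝ 𝔼 +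
        (ContinuousLinearMap.fst ℝ ℝ 𝔼).smulRight z) (r, z) :=
      ((hasFDerivAt_fst (𝕜 := ℝ) (p := (r, z))).smul
        (hasFDerivAt_snd (𝕜 := ℝ) (p := (r, z)))).const_add x
    exact HasFDerivAt.comp (r, z) (f := fun q : ℝ × 𝔼 => x + q.1 • q.2) a b
  simp [hg.fderiv, fderiv_eq_sum_pd, Finset.mul_sum]
  exact Finset.sum_congr rfl fun i _ => by ring

theorem av_pd {k f : 𝔼 → ℝ} (hk : IsKer k) (hk1 : ContDiff ℝ ∞ k) (hf : ContDiff ℝ ∞ f)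
    (i : Fin n) (x : 𝔼) (r : ℝ) : r * Av k (pd i f) x r = - Av (pd i k) f x r := by
  have hg : ∀ z, pd i (fun z => f (x + r • z)) z = r * pd i f (x + r • z) := by
    intro z
    have a : HasFDerivAt f (fderiv ℝ f (x + r • z)) (x + r • z) :=
      (hf.differentiable (by simp) _).hasFDerivAt
    have b : HasFDerivAt (fun q : 𝔼 => x + r • q) (r • ContinuousLinearMap.id ℝ 𝔼) z :=
      ((hasFDerivAt_id z).const_smul r).const_add x
    have c := HasFDerivAt.comp z (f := fun q : 𝔼 => x + r • q) a b
    unfold pd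
    rw [show (fun z => f (x + r • z)) = f ∘ fun q : 𝔼 => x + r • q from rfl, c.fderiv]
    simp
  have hgs : ContDiff ℝ ∞ (fun z => f (x + r • z)) := hf.comp (by fun_prop)
  have hpk : HasCompactSupport (pd i k) := hk.compact.fderiv_apply (𝕜 := ℝ) _
  have := integral_mul_fderiv_eq_neg_fderiv_mul_of_integrable (μ := (volume : Measure 𝔼))
    (f := k) (g := fun z => f (x + r • z)) (v := EuclideanSpace.single i 1)
    (integrable_smul_of_hasCompactSupport (contDiff_pd hk1 i).continuous hpk hgs.continuous)
    (integrable_smul_of_hasCompactSupport hk.cont hk.compact (contDiff_pd hgs i).continuous)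
    (integrable_smul_of_hasCompactSupport hk.cont hk.compact hgs.continuous)
    (fun z _ => hk1.differentiable (by simp) z)
    (fun z _ => hgs.differentiable (by simp) z)
  unfold Av
  rw [← integral_const_mul, ← integral_neg]
  rw [← integral_neg] at this
  calc _ = ∫ z, k z * pd i (fun z => f (x + r • z)) z := by
        refine integral_congr_ae (Filter.Eventually.of_forall fun z => ?_)
        simp only [hg]; ring
    _ = _ := this

theorem IsKer.pd {k : 𝔼 → ℝ} (hk : IsKer k) (hk1 : ContDiff ℝ ∞ k) (i : Fin n) :
    IsKer (pd i k) := by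
  refine ⟨(contDiff_pd hk1 i).continuous, ?_⟩
  have h : ∀ z ∈ (closedBall (0 : 𝔼) 1)ᶜ, _root_.pd i k z = 0 := by
    intro z hz
    have : k =ᶠ[𝓝 z] fun _ => 0 := by
      filter_upwards [isClosed_closedBall.isOpen_compl.mem_nhds hz] with w hw
      exact hk.supp w (by
        simp only [Set.mem_compl_iff, mem_closedBall, dist_zero_right, not_le] at hw
        exact hw.le)
    unfold _root_.pd
    rw [this.fderiv_eq]
    simp
  intro z hz
  have hcl : IsClosed {z | _root_.pd i k z = 0} :=
    isClosed_eq (contDiff_pd hk1 i).continuous continuous_const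
  have ht : Filter.Tendsto (fun m : ℕ => (1 + 1 / ((m : ℝ) + 1)) • z) Filter.atTop (𝓝 z) := by
    have := (tendsto_one_div_add_atTop_nhds_zero_nat (𝕜 := ℝ)).const_add 1
    simpa using this.smul_const z
  refine hcl.mem_of_tendsto ht (Filter.Eventually.of_forall fun m => h _ ?_)
  have hm : (0 : ℝ) < 1 / ((m : ℝ) + 1) := by positivity
  simp only [Set.mem_compl_iff, mem_closedBall, dist_zero_right, norm_smul, not_le, Real.norm_eq_abs]
  rw [abs_of_pos (by linarith)]
  nlinarith

theorem IsKer.lap {k : 𝔼 → ℝ} (hk : IsKer k) (hk1 : ContDiff ℝ ∞ k) : IsKer (lap k) := by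
  refine ⟨(contDiff_lap hk1).continuous, fun z hz => ?_⟩
  rw [lap_eq hk1]
  exact Finset.sum_eq_zero fun i _ => ((hk.pd hk1 i).pd (contDiff_pd hk1 i) i).supp z hz

theorem av_sum {ι : Type} (s : Finset ι) {k : 𝔼 → ℝ} {f : ι → 𝔼 → ℝ} (hk : IsKer k)
    (hf : ∀ i, Continuous (f i)) (x : 𝔼) (r : ℝ) :
    Av k (fun y => ∑ i ∈ s, f i y) x r = ∑ i ∈ s, Av k (f i) x r := by
  unfold Av
  rw [← integral_finsetSum _ fun i _ => integrable_av hk (hf i) x r]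
  simp [Finset.mul_sum]

theorem av_sum_left {ι : Type} (s : Finset ι) {k : ι → 𝔼 → ℝ} {f : 𝔼 → ℝ} (hk : ∀ i, IsKer (k i))
    (hf : Continuous f) (x : 𝔼) (r : ℝ) :
    Av (fun z => ∑ i ∈ s, k i z) f x r = ∑ i ∈ s, Av (k i) f x r := by
  unfold Av
  rw [← integral_finsetSum _ fun i _ => integrable_av (hk i) hf x r]
  simp [Finset.sum_mul]

theorem av_add {k f g : 𝔼 → ℝ} (hk : IsKer k) (hf : Continuous f) (hg : Continuous g) (x : 𝔼)
    (r : ℝ) : Av k (fun y => f y + g y) x r = Av k f x r + Av k g x r := by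
  unfold Av
  rw [← integral_add (integrable_av hk hf x r) (integrable_av hk hg x r)]
  simp [mul_add]

theorem av_sub {k f g : 𝔼 → ℝ} (hk : IsKer k) (hf : Continuous f) (hg : Continuous g) (x : 𝔼)
    (r : ℝ) : Av k (fun y => f y - g y) x r = Av k f x r - Av k g x r := by
  unfold Av
  rw [← integral_sub (integrable_av hk hf x r) (integrable_av hk hg x r)]
  simp [mul_sub]

theorem av_const_mul (k f : 𝔼 → ℝ) (c : ℝ) (x : 𝔼) (r : ℝ) :
    Av k (fun y => c * f y) x r = c * Av k f x r := by
  unfold Av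
  rw [← integral_const_mul]
  exact integral_congr_ae (Filter.Eventually.of_forall fun z => by ring)

theorem av_lap {k f : 𝔼 → ℝ} (hk : IsKer k) (hk1 : ContDiff ℝ ∞ k) (hf : ContDiff ℝ ∞ f)
    (x : 𝔼) (r : ℝ) : r ^ 2 * Av k (lap f) x r = Av (lap k) f x r := by
  rw [funext (lap_eq hf), funext (lap_eq hk1),
    av_sum _ hk (fun i => (contDiff_pd (contDiff_pd hf i) i).continuous),
    av_sum_left _ (fun i => (hk.pd hk1 i).pd (contDiff_pd hk1 i) i) hf.continuous, Finset.mul_sum]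
  refine Finset.sum_congr rfl fun i _ => ?_
  have h1 := av_pd hk hk1 (contDiff_pd hf i) i x r
  have h2 := av_pd (hk.pd hk1 i) (contDiff_pd hk1 i) hf i x r
  linear_combination r * h1 - h2

theorem lap_av {k f : 𝔼 → ℝ} (hk : IsKer k) (hf : ContDiff ℝ ∞ f) (r : ℝ) (x : 𝔼) :
    lap (fun y => Av k f y r) x = Av k (lap f) x r := by
  rw [lap_eq (contDiff_av hk hf r), funext (lap_eq hf),
    av_sum _ hk (fun i => (contDiff_pd (contDiff_pd hf i) i).continuous)]
  refine Finset.sum_congr rfl fun i _ => ?_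
  rw [funext (pd_av hk hf r i), pd_av hk (contDiff_pd hf i)]

theorem av_swap {k k' f : 𝔼 → ℝ} (hk : IsKer k) (hk' : IsKer k') (hf : Continuous f) (x : 𝔼)
    (r r' : ℝ) : Av k (fun y => Av k' f y r') x r = Av k' (fun y => Av k f y r) x r' := by
  unfold Av
  simp_rw [← integral_const_mul]
  rw [integral_integral_swap_of_hasCompactSupport]
  · refine integral_congr_ae (Filter.Eventually.of_forall fun z => ?_)
    refine integral_congr_ae (Filter.Eventually.of_forall fun w => ?_)
    simp only
    rw [add_right_comm]; ring
  · have h1 := hk.cont; have h2 := hk'.cont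
    simp only [Function.uncurry_def]
    fun_prop
  · refine HasCompactSupport.of_support_subset_isCompact
      (((isCompact_closedBall (0 : 𝔼) 1)).prod (isCompact_closedBall (0 : 𝔼) 1)) ?_
    rintro ⟨z, w⟩ h
    simp only [Function.uncurry_def, Function.mem_support, ne_eq, mul_eq_zero, not_or] at h
    constructor
    · have : ¬ 1 ≤ ‖z‖ := fun h' => h.1 (hk.supp _ h')
      simpa using (not_le.1 this).le
    · have : ¬ 1 ≤ ‖w‖ := fun h' => h.2.1 (hk'.supp _ h')
      simpa using (not_le.1 this).le

end Calculus

theorem sub_le_sub_of_hasDerivAt_le {f g f' g' : ℝ → ℝ} {a b : ℝ} (hab : a ≤ b)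
    (hf : ∀ t ∈ Set.Icc a b, HasDerivAt f (f' t) t)
    (hg : ∀ t ∈ Set.Icc a b, HasDerivAt g (g' t) t)
    (h : ∀ t ∈ Set.Ioo a b, f' t ≤ g' t) : f b - f a ≤ g b - g a := by
  have hd : ∀ t ∈ Set.Icc a b, HasDerivAt (fun t => g t - f t) (g' t - f' t) t :=
    fun t ht => (hg t ht).sub (hf t ht)
  have := monotoneOn_of_deriv_nonneg (convex_Icc a b)
    (fun t ht => (hd t ht).continuousAt.continuousWithinAt)
    (fun t ht => (hd t (interior_subset ht)).differentiableAt.differentiableWithinAt)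
    (fun t ht => by
      rw [(hd t (interior_subset ht)).deriv]
      rw [interior_Icc] at ht
      exact sub_nonneg.2 (h t ht)) (Set.left_mem_Icc.2 hab) (Set.right_mem_Icc.2 hab) hab
  simp only at this
  linarith

section Kernels

/-- The unnormalized smooth bump. -/
def rawPsi (n : ℕ) (z : EuclideanSpace ℝ (Fin n)) : ℝ := expNegInvGlue (1 - ‖z‖ ^ 2)

/-- The radial derivative of the unnormalized bump. -/
def rawEta (n : ℕ) (z : EuclideanSpace ℝ (Fin n)) : ℝ :=
  2 * ((1 - ‖z‖ ^ 2)⁻¹ ^ 2 * expNegInvGlue (1 - ‖z‖ ^ 2))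

/-- The averaging kernel, of integral one. -/
def eta (n : ℕ) (z : EuclideanSpace ℝ (Fin n)) : ℝ := (∫ y, rawEta n y)⁻¹ * rawEta n z

/-- The potential of the averaging kernel, `∇ψ(z) = - η(z) z`. -/
def psi (n : ℕ) (z : EuclideanSpace ℝ (Fin n)) : ℝ := (∫ y, rawEta n y)⁻¹ * rawPsi n z

variable {n : ℕ}

local notation "𝔼" => EuclideanSpace ℝ (Fin n)
local notation "η" => eta n
local notation "ψ" => psi n

theorem contDiff_rawPsi : ContDiff ℝ ∞ (rawPsi n) :=
  expNegInvGlue.contDiff.comp (contDiff_const.sub (contDiff_norm_sq ℝ))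

theorem contDiff_rawEta : ContDiff ℝ ∞ (rawEta n) := by
  have h := expNegInvGlue.contDiff_polynomial_eval_inv_mul (n := ⊤) (Polynomial.X ^ 2)
  have h2 : ContDiff ℝ ∞ fun z : 𝔼 => 1 - ‖z‖ ^ 2 := contDiff_const.sub (contDiff_norm_sq ℝ)
  have he : rawEta n = fun z : 𝔼 => 2 * (((fun x => Polynomial.eval x⁻¹ (Polynomial.X ^ 2) *
      expNegInvGlue x) ∘ fun z : 𝔼 => 1 - ‖z‖ ^ 2) z) := funext fun z => by simp [rawEta]
  rw [he]
  exact contDiff_const.mul (h.comp h2)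

theorem rawEta_nonneg (z : 𝔼) : 0 ≤ rawEta n z := by
  have := expNegInvGlue.nonneg (1 - ‖z‖ ^ 2)
  unfold rawEta; positivity

theorem rawEta_pos {z : 𝔼} (hz : ‖z‖ < 1) : 0 < rawEta n z := by
  have h : 0 < 1 - ‖z‖ ^ 2 := by nlinarith [norm_nonneg z]
  have := expNegInvGlue.pos_of_pos h
  unfold rawEta; positivity

theorem rawPsi_pos {z : 𝔼} (hz : ‖z‖ < 1) : 0 < rawPsi n z :=
  expNegInvGlue.pos_of_pos (by nlinarith [norm_nonneg z])

theorem isKer_rawEta : IsKer (rawEta n) :=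
  ⟨contDiff_rawEta.continuous, fun z hz => by
    unfold rawEta
    rw [expNegInvGlue.zero_of_nonpos (by nlinarith)]; simp⟩

theorem isKer_rawPsi : IsKer (rawPsi n) :=
  ⟨contDiff_rawPsi.continuous, fun z hz => by
    unfold rawPsi
    rw [expNegInvGlue.zero_of_nonpos (by nlinarith)]⟩

theorem integral_rawEta_pos : 0 < ∫ z, rawEta n z :=
  isKer_rawEta.cont.integral_pos_of_hasCompactSupport_nonneg_nonzero isKer_rawEta.compact
    (x := 0) rawEta_nonneg (rawEta_pos (by simp)).ne'

theorem isKer_eta : IsKer η := isKer_rawEta.mul continuous_const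

theorem isKer_psi : IsKer ψ := isKer_rawPsi.mul continuous_const

theorem contDiff_eta : ContDiff ℝ ∞ η := contDiff_const.mul contDiff_rawEta

theorem contDiff_psi : ContDiff ℝ ∞ ψ := contDiff_const.mul contDiff_rawPsi

theorem eta_nonneg (z : 𝔼) : 0 ≤ η z :=
  mul_nonneg (inv_nonneg.2 integral_rawEta_pos.le) (rawEta_nonneg z)

theorem psi_nonneg (z : 𝔼) : 0 ≤ ψ z :=
  mul_nonneg (inv_nonneg.2 integral_rawEta_pos.le) (expNegInvGlue.nonneg _)

theorem integral_eta : ∫ z, η z = 1 := by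
  unfold eta
  rw [integral_const_mul, inv_mul_cancel₀ integral_rawEta_pos.ne']

theorem exists_lower_bound : ∃ c > 0, ∀ z : 𝔼, ‖z‖ ≤ 1 / 2 → c ≤ η z ∧ c ≤ ψ z := by
  have hK : IsCompact (closedBall (0 : 𝔼) (1 / 2)) := isCompact_closedBall _ _
  have hn : (closedBall (0 : 𝔼) (1 / 2)).Nonempty := ⟨0, by simp⟩
  obtain ⟨z₁, hz₁, h₁⟩ := hK.exists_isMinOn hn isKer_eta.cont.continuousOn
  obtain ⟨z₂, hz₂, h₂⟩ := hK.exists_isMinOn hn isKer_psi.cont.continuousOn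
  have e₁ : 0 < η z₁ := mul_pos (inv_pos.2 integral_rawEta_pos)
    (rawEta_pos (by simp at hz₁; linarith))
  have e₂ : 0 < ψ z₂ := mul_pos (inv_pos.2 integral_rawEta_pos)
    (rawPsi_pos (by simp at hz₂; linarith))
  refine ⟨min (η z₁) (ψ z₂), lt_min e₁ e₂, fun z hz => ?_⟩
  have hz' : z ∈ closedBall (0 : 𝔼) (1 / 2) := by simpa using hz
  exact ⟨(min_le_left _ _).trans (h₁ hz'), (min_le_right _ _).trans (h₂ hz')⟩

theorem pd_psi (i : Fin n) (z : 𝔼) : pd i ψ z = - (z i * η z) := by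
  have h1 := expNegInvGlue.hasDerivAt_polynomial_eval_inv_mul 1 (1 - ‖z‖ ^ 2)
  have h2 : HasFDerivAt (fun z : 𝔼 => 1 - ‖z‖ ^ 2) (-(2 • innerSL ℝ z)) z :=
    (hasStrictFDerivAt_norm_sq z).hasFDerivAt.const_sub 1
  have h1' : HasDerivAt expNegInvGlue ((1 - ‖z‖ ^ 2)⁻¹ ^ 2 * expNegInvGlue (1 - ‖z‖ ^ 2))
    (1 - ‖z‖ ^ 2) := by simpa using h1
  have h3 := (h1'.comp_hasFDerivAt z h2).const_mul (∫ y, rawEta n y)⁻¹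
  have h4 : fderiv ℝ ψ z = _ := h3.fderiv
  unfold pd
  rw [h4]
  have h5 : inner ℝ z (EuclideanSpace.single i (1 : ℝ)) = z i := by
    rw [EuclideanSpace.inner_single_right]; simp
  simp only [eta, rawEta, smul_apply, neg_apply, innerSL_apply_apply, h5, smul_eq_mul, nsmul_eq_mul]
  push_cast
  ring

variable {k k' f g : EuclideanSpace ℝ (Fin n) → ℝ}

theorem av_eta_zero (f : 𝔼 → ℝ) (x : 𝔼) : Av η f x 0 = f x := by
  unfold Av
  simp [integral_mul_const, integral_eta]

theorem av_eta_const (a : ℝ) (x : 𝔼) (r : ℝ) : Av η (fun _ => a) x r = a := by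
  unfold Av
  simp [integral_mul_const, integral_eta]

theorem av_mono_of (hk : IsKer k) (hk0 : ∀ z, 0 ≤ k z) (hf : Continuous f) (hg : Continuous g)
    {x : 𝔼} {r : ℝ} (h : ∀ z, ‖z‖ < 1 → f (x + r • z) ≤ g (x + r • z)) :
    Av k f x r ≤ Av k g x r := by
  refine integral_mono (integrable_av hk hf x r) (integrable_av hk hg x r) fun z => ?_
  by_cases hz : ‖z‖ < 1
  · exact mul_le_mul_of_nonneg_left (h z hz) (hk0 z)
  · simp [hk.supp z (not_lt.1 hz)]

theorem dist_add_smul_le {x z : 𝔼} {r : ℝ} (hr : 0 ≤ r) (hz : ‖z‖ ≤ 1) : dist (x + r • z) x ≤ r := by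
  rw [dist_eq_norm, add_sub_cancel_left, norm_smul, Real.norm_of_nonneg hr]
  nlinarith

theorem av_mono (hk : IsKer k) (hk0 : ∀ z, 0 ≤ k z) (hf : Continuous f) (hg : Continuous g)
    {x : 𝔼} {r : ℝ} (hr : 0 ≤ r) (h : ∀ y, dist y x ≤ r → f y ≤ g y) :
    Av k f x r ≤ Av k g x r :=
  av_mono_of hk hk0 hf hg fun _ hz => h _ (dist_add_smul_le hr hz.le)

theorem av_nonneg (hk0 : ∀ z, 0 ≤ k z) (hf : ∀ y, 0 ≤ f y) (x : 𝔼) (r : ℝ) : 0 ≤ Av k f x r :=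
  integral_nonneg fun z => mul_nonneg (hk0 z) (hf _)

theorem av_pos (hk : IsKer k) (hk0 : ∀ z, 0 ≤ k z) (hk1 : k 0 ≠ 0) (hf : Continuous f)
    (hf0 : ∀ y, 0 < f y) (x : 𝔼) (r : ℝ) : 0 < Av k f x r := by
  have hc : Continuous fun z => k z * f (x + r • z) := hk.cont.mul (hf.comp (by fun_prop))
  exact hc.integral_pos_of_hasCompactSupport_nonneg_nonzero hk.compact.mul_right (x := 0)
    (fun z => mul_nonneg (hk0 z) (hf0 _).le) (mul_ne_zero hk1 (hf0 _).ne')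

theorem av_eta_pos (hf : Continuous f) (hf0 : ∀ y, 0 < f y) (x : 𝔼) (r : ℝ) : 0 < Av η f x r := by
  obtain ⟨c, hc, h⟩ := exists_lower_bound (n := n)
  exact av_pos isKer_eta eta_nonneg (hc.trans_le (h 0 (by simp)).1).ne' hf hf0 x r

theorem av_eta_le (hf : Continuous f) {x : 𝔼} {r B : ℝ} (hr : 0 ≤ r)
    (h : ∀ y, dist y x ≤ r → f y ≤ B) : Av η f x r ≤ B := by
  rw [← av_eta_const B x r]
  exact av_mono isKer_eta eta_nonneg hf continuous_const hr h

theorem exists_av_bound (hk : IsKer k) : ∃ C > 0, ∀ (f : 𝔼 → ℝ) (x : 𝔼) (r B : ℝ), 0 ≤ r →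
    (∀ y, dist y x ≤ r → |f y| ≤ B) → |Av k f x r| ≤ C * B := by
  refine ⟨(∫ z, |k z|) + 1, by positivity, fun f x r B hr h => ?_⟩
  have hB : 0 ≤ B := (abs_nonneg _).trans (h x (by simpa using hr))
  have hi : Integrable fun z => |k z| :=
    hk.cont.abs.integrable_of_hasCompactSupport hk.compact.abs
  calc |Av k f x r| ≤ ∫ z, |k z * f (x + r • z)| := abs_integral_le_integral_abs
    _ ≤ ∫ z, |k z| * B := by
        refine integral_mono_of_nonneg (Filter.Eventually.of_forall fun z => abs_nonneg _)
          (hi.mul_const B) (Filter.Eventually.of_forall fun z => ?_)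
        simp only [abs_mul]
        by_cases hz : ‖z‖ < 1
        · exact mul_le_mul_of_nonneg_left (h _ (dist_add_smul_le hr hz.le)) (abs_nonneg _)
        · simp [hk.supp z (not_lt.1 hz)]
    _ = (∫ z, |k z|) * B := integral_mul_const _ _
    _ ≤ _ := by nlinarith

theorem abs_av_le_av (hk : IsKer k) (hk' : IsKer k') (hk'0 : ∀ z, 0 ≤ k' z) {M c : ℝ} (hc : 0 < c)
    (hM : ∀ z, |k z| ≤ M) (hk'1 : ∀ z, ‖z‖ ≤ 1 / 2 → c ≤ k' z) (hf : Continuous f)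
    (hf0 : ∀ y, 0 ≤ f y) {x y : 𝔼} {r t : ℝ} (ht : 0 < t) (htr : dist y x + t ≤ r / 2)
    (hgf : ∀ w, dist w y ≤ t → |g w| ≤ f w) :
    |Av k g y t| ≤ M / c * (r / t) ^ n * Av k' f x r := by
  have hr : 0 < r := by linarith [dist_nonneg (x := y) (y := x)]
  have hM0 : 0 ≤ M := (abs_nonneg _).trans (hM 0)
  set F : 𝔼 → ℝ := fun z => k' z * f (x + r • z) with hF
  have hchange : (r / t) ^ n * Av k' f x r = ∫ w, F ((t / r) • w + r⁻¹ • (y - x)) := by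
    have h1 := Measure.integral_comp_smul (volume : Measure 𝔼)
      (fun w => F (w + r⁻¹ • (y - x))) (t / r)
    rw [h1, integral_add_right_eq_self (μ := volume) F, finrank_euclideanSpace, Fintype.card_fin,
      smul_eq_mul, abs_of_pos (by positivity), ← inv_pow, inv_div]
    rfl
  have hFi : Integrable fun w => F ((t / r) • w + r⁻¹ • (y - x)) := by
    have := ((integrable_av hk' hf x r).comp_add_right (r⁻¹ • (y - x))).comp_smul
      (R := t / r) (by positivity)
    exact this
  rw [mul_assoc, hchange, ← integral_const_mul]
  refine abs_integral_le_integral_abs.trans (integral_mono_of_nonneg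
    (Filter.Eventually.of_forall fun z => abs_nonneg _) (hFi.const_mul _)
    (Filter.Eventually.of_forall fun z => ?_))
  simp only [abs_mul, hF]
  have hpt : x + r • ((t / r) • z + r⁻¹ • (y - x)) = y + t • z := by
    rw [smul_add, smul_smul, smul_smul, mul_div_cancel₀ _ hr.ne', mul_inv_cancel₀ hr.ne', one_smul]
    abel
  rw [hpt]
  by_cases hz : ‖z‖ < 1
  · have h1 := hgf _ (dist_add_smul_le (x := y) ht.le hz.le)
    have hnorm : ‖(t / r) • z + r⁻¹ • (y - x)‖ ≤ 1 / 2 := by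
      refine (norm_add_le _ _).trans ?_
      rw [norm_smul, norm_smul, Real.norm_of_nonneg (by positivity),
        Real.norm_of_nonneg (by positivity), ← dist_eq_norm]
      calc t / r * ‖z‖ + r⁻¹ * dist y x ≤ t / r * 1 + r⁻¹ * dist y x := by gcongr
        _ = (dist y x + t) / r := by ring
        _ ≤ (r / 2) / r := by gcongr
        _ = 1 / 2 := by field_simp
    calc |k z| * |g (y + t • z)| ≤ M * f (y + t • z) :=
          mul_le_mul (hM z) h1 (abs_nonneg _) hM0
      _ = M / c * (c * f (y + t • z)) := by field_simp
      _ ≤ _ := by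
          gcongr
          · exact hf0 _
          · exact hk'1 _ hnorm
  · rw [hk.supp z (not_lt.1 hz), abs_zero, zero_mul]
    have := hk'0 ((t / r) • z + r⁻¹ • (y - x))
    have := hf0 (y + t • z)
    positivity

theorem exists_av_comparison (hk : IsKer k) : ∃ C > 0, ∀ (f g : 𝔼 → ℝ) (x y : 𝔼) (r t : ℝ),
    Continuous f → (∀ y, 0 ≤ f y) → 0 < t → dist y x + t ≤ r / 2 →
    (∀ w, dist w y ≤ t → |g w| ≤ f w) →
    |Av k g y t| ≤ C * (r / t) ^ n * Av η f x r ∧ |Av k g y t| ≤ C * (r / t) ^ n * Av ψ f x r := by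
  obtain ⟨c, hc, h⟩ := exists_lower_bound (n := n)
  obtain ⟨M, hM0, hM⟩ := hk.bdd
  exact ⟨M / c, by positivity, fun f g x y r t hf hf0 ht htr hgf =>
    ⟨abs_av_le_av hk isKer_eta eta_nonneg hc hM (fun z hz => (h z hz).1) hf hf0 ht htr hgf,
    abs_av_le_av hk isKer_psi psi_nonneg hc hM (fun z hz => (h z hz).2) hf hf0 ht htr hgf⟩⟩

theorem hasDerivAt_av_eta (hf : ContDiff ℝ ∞ f) (x : 𝔼) (r : ℝ) :
    HasDerivAt (fun t => Av η f x t) (r * Av ψ (lap f) x r) r := by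
  refine (hasDerivAt_av isKer_eta hf x r).congr_deriv ?_
  rw [funext (lap_eq hf),
    av_sum _ isKer_psi (fun i => (contDiff_pd (contDiff_pd hf i) i).continuous), Finset.mul_sum]
  refine Finset.sum_congr rfl fun i _ => ?_
  rw [av_pd isKer_psi contDiff_psi (contDiff_pd hf i), funext (pd_psi i)]
  unfold Av
  rw [← integral_neg]
  simp

theorem av_eta_monotone (hf : ContDiff ℝ ∞ f) (hl : ∀ y, 0 ≤ lap f y) (x : 𝔼) {r t : ℝ}
    (hr : 0 ≤ r) (hrt : r ≤ t) : Av η f x r ≤ Av η f x t := by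
  have := sub_le_sub_of_hasDerivAt_le (f := fun _ => 0) (f' := fun _ => 0) hrt
    (fun s _ => hasDerivAt_const s (0 : ℝ)) (fun s _ => hasDerivAt_av_eta hf x s)
    (fun s hs => mul_nonneg (hr.trans hs.1.le) (av_nonneg psi_nonneg hl x s))
  linarith

theorem le_av_eta_of_lap_nonneg (hf : ContDiff ℝ ∞ f) (hl : ∀ y, 0 ≤ lap f y) (x : 𝔼) {r : ℝ}
    (hr : 0 ≤ r) : f x ≤ Av η f x r := by
  rw [← av_eta_zero f x]
  exact av_eta_monotone hf hl x le_rfl hr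

variable (n) in
/-- The oscillation of a subharmonic function below its averages is controlled by its Laplacian. -/
theorem exists_av_sub_le : ∃ C > 0, ∀ (f : 𝔼 → ℝ) (x : 𝔼) (r ρ : ℝ), ContDiff ℝ ∞ f →
    (∀ y, 0 ≤ lap f y) → 0 < r → 0 ≤ ρ → ρ ≤ 9 * r →
    Av η (fun y => Av η f y ρ - f y) x r ≤ C * ρ ^ 2 * Av ψ (lap f) x (20 * r) := by
  obtain ⟨C₁, hC₁, h₁⟩ := exists_av_comparison (isKer_eta (n := n))
  obtain ⟨C₂, hC₂, h₂⟩ := exists_av_bound (isKer_psi (n := n))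
  refine ⟨C₂ * (C₁ * 20 ^ n) / 2, by positivity, fun f x r ρ hf hl hr hρ hρr => ?_⟩
  set B := C₁ * 20 ^ n * Av ψ (lap f) x (20 * r) with hB
  have hh := contDiff_av isKer_eta hf r
  have hlap : ∀ y, dist y x ≤ 9 * r → |lap (fun y => Av η f y r) y| ≤ B := by
    intro y hy
    rw [lap_av isKer_eta hf]
    have := (h₁ (lap f) (lap f) x y (20 * r) r (contDiff_lap hf).continuous hl hr (by linarith)
      fun w _ => (abs_of_nonneg (hl w)).le).2
    rwa [mul_div_cancel_right₀ _ hr.ne'] at this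
  rw [av_sub isKer_eta (contDiff_av isKer_eta hf ρ).continuous hf.continuous,
    av_swap isKer_eta isKer_eta hf.continuous, ← av_eta_zero (fun y => Av η f y r) x]
  have := sub_le_sub_of_hasDerivAt_le hρ (fun s _ => hasDerivAt_av_eta hh x s)
    (g := fun s => C₂ * B * s ^ 2 / 2) (g' := fun s => C₂ * B * s)
    (fun s _ => by
      refine (((hasDerivAt_pow 2 s).const_mul (C₂ * B)).div_const 2).congr_deriv ?_
      simp; ring)
    (fun s hs => by
      have := (le_abs_self _).trans (h₂ (lap fun y => Av η f y r) x s B hs.1.le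
        fun y hy => hlap y (by linarith [hs.2]))
      nlinarith [hs.1])
  refine this.trans (le_of_eq ?_)
  rw [hB]; ring

end Kernels

section Decay

variable {n : ℕ}

local notation "𝔼" => EuclideanSpace ℝ (Fin n)
local notation "η" => eta n
local notation "ψ" => psi n

variable (n) in
theorem exists_av_lap_le : ∃ C > 0, ∀ (f : 𝔼 → ℝ) (x : 𝔼) (r : ℝ), ContDiff ℝ ∞ f →
    (∀ y, 0 ≤ f y) → 0 < r → r ^ 2 * Av ψ (lap f) x r ≤ C * Av η f x (2 * r) := by
  obtain ⟨C, hC, h⟩ := exists_av_comparison (isKer_psi.lap (contDiff_psi (n := n)))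
  refine ⟨C * 2 ^ n, by positivity, fun f x r hf hf0 hr => ?_⟩
  rw [av_lap isKer_psi contDiff_psi hf]
  have := (h f f x x (2 * r) r hf.continuous hf0 hr (by simp)
    fun w _ => (abs_of_nonneg (hf0 w)).le).1
  rw [mul_div_cancel_right₀ _ hr.ne'] at this
  exact (le_abs_self _).trans this

variable (n) in
theorem exists_le_av_eta : ∃ C > 0, ∀ (f : 𝔼 → ℝ) (x y : 𝔼) (r t : ℝ), ContDiff ℝ ∞ f →
    (∀ y, 0 ≤ f y) → 0 < t → dist y x + t ≤ r / 2 →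
    Av η f y t ≤ C * (r / t) ^ n * Av η f x r ∧ Av η f y t ≤ C * (r / t) ^ n * Av ψ f x r ∧
    Av ψ f y t ≤ C * (r / t) ^ n * Av η f x r ∧ Av ψ f y t ≤ C * (r / t) ^ n * Av ψ f x r := by
  obtain ⟨C₁, hC₁, h₁⟩ := exists_av_comparison (isKer_eta (n := n))
  obtain ⟨C₂, hC₂, h₂⟩ := exists_av_comparison (isKer_psi (n := n))
  refine ⟨max C₁ C₂, by positivity, fun f x y r t hf hf0 ht htr => ?_⟩
  have hr : 0 < r := by linarith [dist_nonneg (x := y) (y := x)]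
  have a := h₁ f f x y r t hf.continuous hf0 ht htr fun w _ => (abs_of_nonneg (hf0 w)).le
  have b := h₂ f f x y r t hf.continuous hf0 ht htr fun w _ => (abs_of_nonneg (hf0 w)).le
  have e := av_nonneg eta_nonneg hf0 x r
  have p := av_nonneg psi_nonneg hf0 x r
  have l₁ := le_max_left C₁ C₂
  have l₂ := le_max_right C₁ C₂
  refine ⟨(le_abs_self _).trans (a.1.trans ?_), (le_abs_self _).trans (a.2.trans ?_),
    (le_abs_self _).trans (b.1.trans ?_), (le_abs_self _).trans (b.2.trans ?_)⟩ <;> gcongr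

variable (n) in
/-- Where the average of `u` is at least `a`, the other component is small. -/
theorem exists_decay_raw : ∃ C > 0, ∀ (u v : 𝔼 → ℝ) (x : 𝔼) (ρ : ℝ), ContDiff ℝ ∞ u →
    ContDiff ℝ ∞ v → (∀ y, 0 < u y) → (∀ y, 0 < v y) → (∀ y, 0 ≤ lap u y) →
    (∀ y, lap v y = v y * u y ^ 2) → 0 < ρ →
    Av η v x (ρ / 4) ≤ C * (Av ψ (lap v) x ρ / (Av η u x ρ) ^ 2 +
      ρ ^ 2 * Av ψ (lap u) x (20 * ρ) / Av η u x ρ * Av η v x ρ) := by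
  obtain ⟨C₁, hC₁, h₁⟩ := exists_le_av_eta n
  obtain ⟨C₂, hC₂, h₂⟩ := exists_av_sub_le n
  set c := (C₁ * 8 ^ n)⁻¹ / 2 with hc
  have hc0 : 0 < c := by positivity
  refine ⟨C₁ * 4 ^ n / c ^ 2 + C₁ * 4 ^ n / c * (C₁ * 4 ^ n) * (C₂ * 64), by positivity,
    fun u v x ρ hu hv hu0 hv0 hlu hlv hρ => ?_⟩
  have hlv0 : ∀ y, 0 ≤ lap v y := fun y => by rw [hlv]; have := hv0 y; positivity
  set a := Av η u x ρ with ha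
  have ha0 : 0 < a := av_eta_pos hu.continuous hu0 x ρ
  set V := C₁ * 4 ^ n * Av η v x ρ with hV
  have hvρ := av_eta_pos hv.continuous hv0 x ρ
  have hV0 : 0 < V := by positivity
  have hu8 : ∀ y, dist y x ≤ ρ → 2 * (c * a) ≤ Av η u y (8 * ρ) := by
    intro y hy
    have := (h₁ u y x (8 * ρ) ρ hu (fun y => (hu0 y).le) hρ (by rw [dist_comm]; linarith)).1
    rw [mul_div_cancel_right₀ _ hρ.ne'] at this
    calc 2 * (c * a) = (C₁ * 8 ^ n)⁻¹ * a := by rw [hc]; ring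
      _ ≤ (C₁ * 8 ^ n)⁻¹ * (C₁ * 8 ^ n * Av η u y (8 * ρ)) := by gcongr
      _ = _ := by field_simp
  have hvV : ∀ y, dist y x ≤ ρ / 4 → v y ≤ V := by
    intro y hy
    have := (h₁ v x y ρ (ρ / 4) hv (fun y => (hv0 y).le) (by linarith) (by linarith)).1
    rw [show ρ / (ρ / 4) = 4 by field_simp] at this
    exact (le_av_eta_of_lap_nonneg hv hlv0 y (by linarith)).trans this
  have hu8c := contDiff_av (isKer_eta (n := n)) hu (8 * ρ)
  set g : 𝔼 → ℝ := fun y => Av η u y (8 * ρ) - u y with hg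
  have hgs : ContDiff ℝ ∞ g := hu8c.sub hu
  have hg0 : ∀ y, 0 ≤ g y := fun y =>
    sub_nonneg.2 (le_av_eta_of_lap_nonneg hu hlu y (by linarith))
  have key : Av η v x (ρ / 4) ≤ Av η (fun y => 1 / (c * a) ^ 2 * lap v y + V / (c * a) * g y) x
      (ρ / 4) := by
    refine av_mono isKer_eta eta_nonneg hv.continuous ?_ (by linarith) fun y hy => ?_
    · exact ((contDiff_const.mul (contDiff_lap hv)).add (contDiff_const.mul hgs)).continuous
    · have hca : 0 < c * a := by positivity
      rcases le_or_gt (c * a) (u y) with h | h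
      · have : v y ≤ 1 / (c * a) ^ 2 * lap v y := by
          rw [hlv, one_div, ← div_eq_inv_mul, le_div_iff₀ (by positivity)]
          have := hv0 y
          gcongr
        have := mul_nonneg (by positivity : 0 ≤ V / (c * a)) (hg0 y)
        linarith
      · have h3 : c * a ≤ g y := by
          have := hu8 y (by linarith)
          simp only [hg]; linarith
        have : v y ≤ V / (c * a) * g y := by
          rw [div_mul_eq_mul_div, le_div_iff₀ hca]
          exact mul_le_mul (hvV y hy) h3 hca.le hV0.le
        have := mul_nonneg (by positivity : 0 ≤ 1 / (c * a) ^ 2) (hlv0 y)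
        linarith
  rw [av_add (f := fun y => 1 / (c * a) ^ 2 * lap v y) (g := fun y => V / (c * a) * g y) isKer_eta
    (continuous_const.mul (contDiff_lap hv).continuous)
    (continuous_const.mul hgs.continuous), av_const_mul, av_const_mul] at key
  have k1 := (h₁ (lap v) x x ρ (ρ / 4) (contDiff_lap hv) hlv0 (by linarith)
    (by rw [dist_self]; linarith)).2.1
  have k2 := (h₁ g x x ρ (ρ / 4) hgs hg0 (by linarith) (by rw [dist_self]; linarith)).1
  rw [show ρ / (ρ / 4) = 4 by field_simp] at k1 k2
  have k3 := h₂ u x ρ (8 * ρ) hu hlu hρ (by linarith) (by linarith)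
  have p1 := av_nonneg psi_nonneg hlv0 x ρ
  have p2 := av_nonneg psi_nonneg hlu x (20 * ρ)
  calc Av η v x (ρ / 4) ≤ 1 / (c * a) ^ 2 * (C₁ * 4 ^ n * Av ψ (lap v) x ρ) +
        V / (c * a) * (C₁ * 4 ^ n * (C₂ * (8 * ρ) ^ 2 * Av ψ (lap u) x (20 * ρ))) := by
        refine key.trans ?_
        gcongr
        exact k2.trans (by gcongr)
    _ = C₁ * 4 ^ n / c ^ 2 * (Av ψ (lap v) x ρ / a ^ 2) +
        (C₁ * 4 ^ n / c * (C₁ * 4 ^ n) * (C₂ * 64)) *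
          (ρ ^ 2 * Av ψ (lap u) x (20 * ρ) / a * Av η v x ρ) := by
        rw [hV]; field_simp; ring
    _ ≤ _ := by
        rw [mul_add]
        gcongr
        · have : 0 ≤ C₁ * 4 ^ n / c * (C₁ * 4 ^ n) * (C₂ * 64) := by positivity
          linarith
        · have : 0 ≤ C₁ * 4 ^ n / c ^ 2 := by positivity
          linarith

/-- The Laplacian of `u + v` for a solution `(u, v)`. -/
def den (u v : 𝔼 → ℝ) (y : 𝔼) : ℝ := u y * v y * (u y + v y)

variable {u v : EuclideanSpace ℝ (Fin n) → ℝ}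

theorem den_comm (u v : 𝔼 → ℝ) : den u v = den v u := by
  funext y; unfold den; ring

namespace IsSolution

theorem symm (h : IsSolution u v) : IsSolution v u :=
  ⟨h.2.1, h.1, h.2.2.2.1, h.2.2.1, h.2.2.2.2.2, h.2.2.2.2.1⟩

theorem smooth (h : IsSolution u v) : ContDiff ℝ ∞ u := h.1

theorem pos (h : IsSolution u v) (y : 𝔼) : 0 < u y := h.2.2.1 y

theorem lap_left (h : IsSolution u v) (y : 𝔼) : lap u y = u y * v y ^ 2 := h.2.2.2.2.1 y

theorem lap_nonneg (h : IsSolution u v) (y : 𝔼) : 0 ≤ lap u y := by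
  rw [h.lap_left]
  have := h.pos y
  positivity

theorem smooth_den (h : IsSolution u v) : ContDiff ℝ ∞ (den u v) :=
  (h.smooth.mul h.symm.smooth).mul (h.smooth.add h.symm.smooth)

theorem den_nonneg (h : IsSolution u v) (y : 𝔼) : 0 ≤ den u v y := by
  have := h.pos y
  have := h.symm.pos y
  unfold den; positivity

theorem smooth_sum (h : IsSolution u v) : ContDiff ℝ ∞ (fun y => u y + v y) :=
  h.smooth.add h.symm.smooth

theorem lap_sum (h : IsSolution u v) (y : 𝔼) : lap (fun y => u y + v y) y = den u v y := by
  rw [lap_add h.smooth h.symm.smooth, h.lap_left, h.symm.lap_left]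
  unfold den; ring

theorem lap_le_den (h : IsSolution u v) (y : 𝔼) : lap u y ≤ den u v y := by
  rw [← h.lap_sum, lap_add h.smooth h.symm.smooth]
  linarith [h.symm.lap_nonneg y]

theorem av_psi_lap_le (h : IsSolution u v) (x : 𝔼) {r : ℝ} (hr : 0 ≤ r) :
    Av ψ (lap u) x r ≤ Av ψ (den u v) x r :=
  av_mono isKer_psi psi_nonneg (contDiff_lap h.smooth).continuous h.smooth_den.continuous hr
    fun y _ => h.lap_le_den y

theorem av_sum_eq (h : IsSolution u v) (x : 𝔼) (r : ℝ) :
    Av η (fun y => u y + v y) x r = Av η u x r + Av η v x r :=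
  av_add isKer_eta h.smooth.continuous h.symm.smooth.continuous x r

theorem av_sum_monotone (h : IsSolution u v) (x : 𝔼) {r t : ℝ} (hr : 0 ≤ r) (hrt : r ≤ t) :
    Av η (fun y => u y + v y) x r ≤ Av η (fun y => u y + v y) x t :=
  av_eta_monotone h.smooth_sum (fun y => by rw [h.lap_sum]; exact h.den_nonneg y) x hr hrt

theorem av_monotone (h : IsSolution u v) (x : 𝔼) {r t : ℝ} (hr : 0 ≤ r) (hrt : r ≤ t) :
    Av η u x r ≤ Av η u x t :=
  av_eta_monotone h.smooth h.lap_nonneg x hr hrt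

theorem av_pos (h : IsSolution u v) (x : 𝔼) (r : ℝ) : 0 < Av η u x r :=
  av_eta_pos h.smooth.continuous h.pos x r

theorem av_sum_pos (h : IsSolution u v) (x : 𝔼) (r : ℝ) : 0 < Av η (fun y => u y + v y) x r := by
  rw [h.av_sum_eq]
  exact add_pos (h.av_pos x r) (h.symm.av_pos x r)

theorem av_den_nonneg (h : IsSolution u v) (x : 𝔼) (r : ℝ) : 0 ≤ Av ψ (den u v) x r :=
  av_nonneg psi_nonneg h.den_nonneg x r

theorem hasDerivAt_sum (h : IsSolution u v) (x : 𝔼) (r : ℝ) :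
    HasDerivAt (fun t => Av η (fun y => u y + v y) x t) (r * Av ψ (den u v) x r) r := by
  have := hasDerivAt_av_eta h.smooth_sum x r
  rwa [funext h.lap_sum] at this

end IsSolution

theorem fun_add_comm (u v : 𝔼 → ℝ) : (fun y => v y + u y) = fun y => u y + v y :=
  funext fun _ => add_comm _ _

variable (n) in
theorem exists_growth_of_den : ∃ c > 0, ∀ (u v : 𝔼 → ℝ) (x : 𝔼) (ρ : ℝ), IsSolution u v → 0 < ρ →
    Av η (fun y => u y + v y) x (40 * ρ) + c * (ρ ^ 2 * Av ψ (den u v) x (20 * ρ)) ≤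
      Av η (fun y => u y + v y) x (80 * ρ) := by
  obtain ⟨C₁, hC₁, h₁⟩ := exists_le_av_eta n
  refine ⟨40 * 40 * (C₁ * 4 ^ n)⁻¹, by positivity, fun u v x ρ h hρ => ?_⟩
  set D := Av ψ (den u v) x (20 * ρ) with hD
  have := sub_le_sub_of_hasDerivAt_le (f := fun s => 40 * ρ * (C₁ * 4 ^ n)⁻¹ * D * s)
    (f' := fun _ => 40 * ρ * (C₁ * 4 ^ n)⁻¹ * D) (by linarith : 40 * ρ ≤ 80 * ρ)
    (fun s _ => by simpa using (hasDerivAt_id s).const_mul (40 * ρ * (C₁ * 4 ^ n)⁻¹ * D))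
    (fun s _ => h.hasDerivAt_sum x s)
    (fun s hs => by
      have hs0 : 0 < s := by linarith [hs.1]
      have := (h₁ (den u v) x x s (20 * ρ) h.smooth_den h.den_nonneg (by linarith)
        (by rw [dist_self]; linarith [hs.1])).2.2.2
      have h4 : s / (20 * ρ) ≤ 4 := by rw [div_le_iff₀ (by linarith)]; linarith [hs.2]
      have hA := h.av_den_nonneg x s
      have h5 : (C₁ * 4 ^ n)⁻¹ * D ≤ Av ψ (den u v) x s := by
        rw [inv_mul_le_iff₀ (by positivity)]
        refine this.trans ?_
        gcongr
      have h6 : 0 ≤ (C₁ * 4 ^ n)⁻¹ * D := mul_nonneg (by positivity) (h.av_den_nonneg x _)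
      calc 40 * ρ * (C₁ * 4 ^ n)⁻¹ * D = 40 * ρ * ((C₁ * 4 ^ n)⁻¹ * D) := by ring
        _ ≤ s * Av ψ (den u v) x s := mul_le_mul hs.1.le h5 h6 hs0.le)
  linarith

variable (n) in
theorem exists_dichotomy_aux {δ : ℝ} (hδ : 0 < δ) : ∃ c > 0, ∃ C ≥ 1, ∀ (u v : 𝔼 → ℝ) (x : 𝔼)
    (t : ℝ), IsSolution u v → 0 < t → C ≤ t * Av η (fun y => u y + v y) x t →
    Av η v x (4 * t) ≤ Av η u x (4 * t) →
    (1 + c) * Av η (fun y => u y + v y) x t ≤ Av η (fun y => u y + v y) x (320 * t) ∨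
    Av η u x t * Av η v x t ≤ δ * (Av η u x (320 * t) * Av η v x (320 * t)) := by
  obtain ⟨C₁, hC₁, h₁⟩ := exists_decay_raw n
  obtain ⟨C₂, hC₂, h₂⟩ := exists_av_lap_le n
  obtain ⟨c₃, hc₃, h₃⟩ := exists_growth_of_den n
  set κ := δ / (4 * C₁) with hκ
  have hκ0 : 0 < κ := by positivity
  set C := 1 + 8 * C₁ * C₂ / δ with hC
  have hC1 : 1 ≤ C := by
    have : 0 ≤ 8 * C₁ * C₂ / δ := by positivity
    linarith
  refine ⟨c₃ * κ, by positivity, C, hC1, fun u v x t h ht hbig huv => ?_⟩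
  set s : ℝ → ℝ := fun t => Av η (fun y => u y + v y) x t with hs
  have hs4 : s (4 * t) ≤ 2 * Av η u x (4 * t) := by
    simp only [hs, h.av_sum_eq]; linarith
  have hst : s t ≤ s (4 * t) := h.av_sum_monotone x ht.le (by linarith)
  have hs0 : 0 < s t := h.av_sum_pos x t
  set a := Av η u x (4 * t) with ha
  have ha0 : 0 < a := h.av_pos x _
  set D := Av ψ (den u v) x (20 * (4 * t)) with hD
  have hD0 : 0 ≤ D := h.av_den_nonneg x _
  rcases le_or_gt ((4 * t) ^ 2 * D) (κ * s t) with hsmall | hlarge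
  · right
    have r1 := h₁ u v x (4 * t) h.smooth h.symm.smooth h.pos h.symm.pos h.lap_nonneg
      h.symm.lap_left (by linarith)
    rw [show 4 * t / 4 = t by ring] at r1
    have r2 := h₂ v x (4 * t) h.symm.smooth (fun y => (h.symm.pos y).le) (by linarith)
    have r3 := h.av_psi_lap_le x (r := 20 * (4 * t)) (by linarith)
    have m1 := h.symm.av_monotone x (r := 4 * t) (t := 320 * t) (by linarith) (by linarith)
    have m2 := h.symm.av_monotone x (r := 2 * (4 * t)) (t := 320 * t) (by linarith) (by linarith)
    have m3 := h.av_monotone x (r := t) (t := 320 * t) (by linarith) (by linarith)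
    set W := Av η v x (320 * t) with hW
    have hW0 : 0 < W := h.symm.av_pos x _
    have e1 : Av ψ (lap v) x (4 * t) / a ^ 2 ≤ δ / (2 * C₁) * W := by
      rw [div_le_iff₀ (by positivity)]
      have t1 : (4 * t) ^ 2 * Av ψ (lap v) x (4 * t) ≤ C₂ * W := r2.trans (by gcongr)
      have t2 : C ≤ t * (2 * a) := hbig.trans (by gcongr; linarith)
      have t3 : C ≤ (2 * t * a) ^ 2 := by nlinarith
      have t4 : C₂ ≤ δ / (8 * C₁) * (2 * t * a) ^ 2 := by
        calc C₂ = δ / (8 * C₁) * (8 * C₁ * C₂ / δ) := by field_simp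
          _ ≤ _ := by gcongr; linarith
      have t5 : (4 * t) ^ 2 * Av ψ (lap v) x (4 * t) ≤ (4 * t) ^ 2 * (δ / (2 * C₁) * W * a ^ 2) :=
        calc _ ≤ C₂ * W := t1
          _ ≤ δ / (8 * C₁) * (2 * t * a) ^ 2 * W := by gcongr
          _ = δ / (32 * C₁) * W * a ^ 2 * (4 * t) ^ 2 := by field_simp; ring
          _ ≤ δ / (2 * C₁) * W * a ^ 2 * (4 * t) ^ 2 := by gcongr; norm_num
          _ = _ := by ring
      exact le_of_mul_le_mul_left t5 (by positivity)
    have e2 : (4 * t) ^ 2 * Av ψ (lap u) x (20 * (4 * t)) / a * Av η v x (4 * t) ≤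
        δ / (2 * C₁) * W := by
      have t1 : (4 * t) ^ 2 * Av ψ (lap u) x (20 * (4 * t)) / a ≤ δ / (2 * C₁) := by
        rw [div_le_iff₀ ha0]
        calc (4 * t) ^ 2 * Av ψ (lap u) x (20 * (4 * t)) ≤ (4 * t) ^ 2 * D := by gcongr
          _ ≤ κ * s t := hsmall
          _ ≤ κ * (2 * a) := by gcongr; linarith
          _ = _ := by rw [hκ]; field_simp; ring
      exact mul_le_mul t1 m1 (h.symm.av_pos x _).le (by positivity)
    have e3 : Av η v x t ≤ δ * W := by
      refine r1.trans ?_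
      calc _ ≤ C₁ * (δ / (2 * C₁) * W + δ / (2 * C₁) * W) := by gcongr
        _ = _ := by field_simp; ring
    calc Av η u x t * Av η v x t ≤ Av η u x (320 * t) * (δ * W) :=
          mul_le_mul m3 e3 (h.symm.av_pos x _).le (h.av_pos x _).le
      _ = _ := by ring
  · left
    have r := h₃ u v x (4 * t) h (by linarith)
    have m : s t ≤ s (40 * (4 * t)) := h.av_sum_monotone x ht.le (by linarith)
    rw [show 80 * (4 * t) = 320 * t by ring] at r
    have : c₃ * (κ * s t) ≤ c₃ * ((4 * t) ^ 2 * D) := by gcongr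
    calc (1 + c₃ * κ) * s t = s t + c₃ * (κ * s t) := by ring
      _ ≤ s (40 * (4 * t)) + c₃ * ((4 * t) ^ 2 * D) := by linarith
      _ ≤ _ := r

variable (n) in
theorem exists_dichotomy {δ : ℝ} (hδ : 0 < δ) : ∃ c > 0, ∃ C ≥ 1, ∀ (u v : 𝔼 → ℝ) (x : 𝔼)
    (t : ℝ), IsSolution u v → 0 < t → C ≤ t * Av η (fun y => u y + v y) x t →
    (1 + c) * Av η (fun y => u y + v y) x t ≤ Av η (fun y => u y + v y) x (320 * t) ∨
    Av η u x t * Av η v x t ≤ δ * (Av η u x (320 * t) * Av η v x (320 * t)) := by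
  obtain ⟨c, hc, C, hC, h⟩ := exists_dichotomy_aux n hδ
  refine ⟨c, hc, C, hC, fun u v x t hs ht hb => ?_⟩
  rcases le_total (Av η v x (4 * t)) (Av η u x (4 * t)) with h1 | h1
  · exact h u v x t hs ht hb h1
  · have := h v u x t hs.symm ht (by rwa [fun_add_comm]) h1
    rw [fun_add_comm] at this
    rwa [mul_comm (Av η u x t), mul_comm (Av η u x (320 * t))]

variable (n) in
/-- Polynomial decay in scale of the product of the averages of `u` and `v`, of any order. -/
theorem exists_product_decay (B : ℕ) : ∃ A ≥ 2, ∃ C ≥ 1, ∀ (u v : 𝔼 → ℝ) (x : 𝔼) (t R : ℝ),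
    IsSolution u v → 0 < t → t ≤ R → C ≤ t * Av η (fun y => u y + v y) x t →
    Av η u x t * Av η v x t * Av η (fun y => u y + v y) x t ^ A ≤
      C * (t / R) ^ B * (Av η u x R * Av η v x R * Av η (fun y => u y + v y) x R ^ A) := by
  have hq : (0 : ℝ) < 320 ^ B := by positivity
  obtain ⟨c, hc, C, hC, h⟩ := exists_dichotomy n (inv_pos.2 hq)
  obtain ⟨A, hA⟩ := pow_unbounded_of_one_lt ((320 : ℝ) ^ B) (by linarith : 1 < 1 + c)
  refine ⟨A + 2, by omega, max C (320 ^ B), le_max_of_le_left hC, fun u v x t R hs ht htR hb => ?_⟩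
  have hA' : (320 : ℝ) ^ B ≤ (1 + c) ^ (A + 2) :=
    hA.le.trans (pow_le_pow_right₀ (by linarith) (by omega))
  set F : ℝ → ℝ := fun t =>
    Av η u x t * Av η v x t * Av η (fun y => u y + v y) x t ^ (A + 2) with hF
  have hF0 : ∀ t, 0 < F t := fun t =>
    mul_pos (mul_pos (hs.av_pos x t) (hs.symm.av_pos x t)) (pow_pos (hs.av_sum_pos x t) _)
  have hmono : ∀ {r t : ℝ}, 0 ≤ r → r ≤ t → F r ≤ F t := fun {r t} hr hrt => by
    have := hs.av_monotone x hr hrt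
    have := hs.symm.av_monotone x hr hrt
    have := hs.av_sum_monotone x hr hrt
    have := (hs.av_pos x r).le
    have := (hs.symm.av_pos x r).le
    have := (hs.av_pos x t).le
    have := (hs.symm.av_pos x t).le
    have := (hs.av_sum_pos x r).le
    simp only [hF]
    gcongr
  have step : ∀ t, 0 < t → C ≤ t * Av η (fun y => u y + v y) x t →
      F t ≤ (320 ^ B)⁻¹ * F (320 * t) := by
    intro t ht hb
    have p1 := hs.av_pos x t
    have p2 := hs.symm.av_pos x t
    have p3 := hs.av_sum_pos x t
    have p4 := hs.av_pos x (320 * t)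
    have p5 := hs.symm.av_pos x (320 * t)
    have p6 := hs.av_sum_pos x (320 * t)
    have m1 := hs.av_monotone x ht.le (by linarith : t ≤ 320 * t)
    have m2 := hs.symm.av_monotone x ht.le (by linarith : t ≤ 320 * t)
    have m3 := hs.av_sum_monotone x ht.le (by linarith : t ≤ 320 * t)
    rcases h u v x t hs ht hb with h1 | h1
    · have e := pow_le_pow_left₀ (by positivity) h1 (A + 2)
      rw [mul_pow] at e
      have e2 : 320 ^ B * Av η (fun y => u y + v y) x t ^ (A + 2) ≤
          Av η (fun y => u y + v y) x (320 * t) ^ (A + 2) := le_trans (by gcongr) e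
      rw [le_inv_mul_iff₀ hq]
      simp only [hF]
      calc _ = Av η u x t * Av η v x t *
            (320 ^ B * Av η (fun y => u y + v y) x t ^ (A + 2)) := by ring
        _ ≤ _ := by gcongr
    · simp only [hF]
      rw [← mul_assoc]
      gcongr
  have iter : ∀ k : ℕ, ∀ t, 0 < t → t ≤ R → R < 320 ^ k * t →
      C ≤ t * Av η (fun y => u y + v y) x t → F t ≤ 320 ^ B * (t / R) ^ B * F R := by
    intro k
    induction k with
    | zero => intro t _ h1 h2; simp at h2; linarith
    | succ k ih =>
      intro t ht htR hk hb
      have hR : 0 < R := ht.trans_le htR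
      rcases le_or_gt (320 * t) R with h1 | h1
      · have := ih (320 * t) (by linarith) h1 (by rw [pow_succ] at hk; linarith) (hb.trans (by
          have := hs.av_sum_monotone x ht.le (by linarith : t ≤ 320 * t)
          have := hs.av_sum_pos x t
          gcongr
          linarith))
        refine (step t ht hb).trans ?_
        rw [inv_mul_le_iff₀ hq]
        refine this.trans (le_of_eq ?_)
        rw [mul_div_assoc, mul_pow]; ring
      · have h2 : 1 ≤ (320 * (t / R)) ^ B := by
          refine one_le_pow₀ ?_
          rw [← mul_div_assoc, le_div_iff₀ hR]; linarith
        rw [← mul_pow]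
        have := hmono ht.le htR
        nlinarith [hF0 R]
  obtain ⟨k, hk⟩ := pow_unbounded_of_one_lt (R / t) (by norm_num : (1 : ℝ) < 320)
  refine (iter k t ht htR ((div_lt_iff₀ ht).1 hk) ((le_max_left _ _).trans hb)).trans ?_
  have := hF0 R
  have hR : 0 < R := ht.trans_le htR
  gcongr
  exact le_max_right _ _

end Decay

section Minimality

variable {n : ℕ}

local notation "𝔼" => EuclideanSpace ℝ (Fin n)
local notation "η" => eta n
local notation "ψ" => psi n

theorem gradient_apply (f : 𝔼 → ℝ) (x : 𝔼) (i : Fin n) : gradient f x i = pd i f x := by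
  have h : inner ℝ (gradient f x) (EuclideanSpace.single i (1 : ℝ)) = pd i f x := by
    unfold gradient pd
    rw [InnerProductSpace.toDual_symm_apply]
  rw [← h, EuclideanSpace.inner_single_right]
  simp

theorem norm_gradient_sq (f : 𝔼 → ℝ) (x : 𝔼) : ‖gradient f x‖ ^ 2 = ∑ i, pd i f x ^ 2 := by
  rw [EuclideanSpace.norm_sq_eq]
  simp [gradient_apply]

/-- A smooth approximation of the positive part. -/
theorem exists_smooth_posPart {ε : ℝ} (hε : 0 < ε) : ∃ P p : ℝ → ℝ, ContDiff ℝ ∞ P ∧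
    (∀ s, HasDerivAt P (p s) s) ∧ (∀ s, 0 ≤ p s) ∧ (∀ s, p s ≤ 1) ∧ (∀ s ≤ 0, P s = 0) ∧
    (∀ s ≥ 0, 0 ≤ P s) ∧ (∀ s ≥ 0, P s ≤ s) ∧ (∀ s ≥ 0, s - ε ≤ P s) := by
  set p : ℝ → ℝ := fun s => Real.smoothTransition (s / ε) with hp
  have hpc : ContDiff ℝ ∞ p := Real.smoothTransition.contDiff.comp (contDiff_id.div_const ε)
  set P : ℝ → ℝ := fun s => ∫ x in (0 : ℝ)..s, p x with hP
  have hd : ∀ s, HasDerivAt P (p s) s := fun s =>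
    intervalIntegral.integral_hasDerivAt_right (hpc.continuous.intervalIntegrable _ _)
      hpc.continuous.aestronglyMeasurable.stronglyMeasurableAtFilter hpc.continuous.continuousAt
  have hp0 : ∀ s, 0 ≤ p s := fun s => Real.smoothTransition.nonneg _
  have hp1 : ∀ s, p s ≤ 1 := fun s => Real.smoothTransition.le_one _
  have hP0 : P 0 = 0 := by simp [hP]
  have hnn : ∀ s ≥ 0, 0 ≤ P s := fun s hs => by
    have := sub_le_sub_of_hasDerivAt_le (f := fun _ => 0) (f' := fun _ => 0) (g := P) hs
      (fun t _ => hasDerivAt_const t (0 : ℝ)) (fun t _ => hd t) fun t _ => hp0 t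
    linarith
  refine ⟨P, p, ?_, hd, hp0, hp1, fun s hs => ?_, hnn, fun s hs => ?_, fun s hs => ?_⟩
  · rw [contDiff_infty_iff_deriv]
    exact ⟨fun s => (hd s).differentiableAt, by rwa [funext fun s => (hd s).deriv]⟩
  · have h1 := sub_le_sub_of_hasDerivAt_le (f := P) (g := fun _ => 0) (g' := fun _ => 0) hs
      (fun t _ => hd t) (fun t _ => hasDerivAt_const t (0 : ℝ)) fun t ht =>
        (Real.smoothTransition.zero_of_nonpos (div_nonpos_of_nonpos_of_nonneg ht.2.le hε.le)).le
    have h2 := sub_le_sub_of_hasDerivAt_le (g := P) (f := fun _ => 0) (f' := fun _ => 0) hs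
      (fun t _ => hasDerivAt_const t (0 : ℝ)) (fun t _ => hd t) fun t _ => hp0 t
    linarith
  · have := sub_le_sub_of_hasDerivAt_le (f := P) (g := fun t => t) (g' := fun _ => 1) hs
      (fun t _ => hd t) (fun t _ => hasDerivAt_id t) fun t _ => hp1 t
    linarith
  · rcases le_total s ε with h | h
    · linarith [hnn s hs]
    · have := sub_le_sub_of_hasDerivAt_le (g := P) (f := fun t => t) (f' := fun _ => 1) h
        (fun t _ => hasDerivAt_id t) (fun t _ => hd t) fun t ht =>
          (Real.smoothTransition.one_of_one_le ((one_le_div hε).2 ht.1.le)).ge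
      linarith [hnn ε hε.le]

theorem integral_pd_mul_pd {u m : 𝔼 → ℝ} (hu : ContDiff ℝ ∞ u) (hm : ContDiff ℝ ∞ m)
    (hc : HasCompactSupport m) :
    Integrable (fun x => ∑ i, pd i u x * pd i m x) ∧
    ∫ x, ∑ i, pd i u x * pd i m x = - ∫ x, m x * lap u x := by
  have hmi : ∀ i, HasCompactSupport (pd i m) := fun i => hc.fderiv_apply (𝕜 := ℝ) _
  have hint : ∀ i, Integrable fun x => pd i u x * pd i m x := fun i =>
    ((contDiff_pd hu i).continuous.mul (contDiff_pd hm i).continuous).integrable_of_hasCompactSupport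
      (hmi i).mul_left
  have hint2 : ∀ i, Integrable fun x => pd i (pd i u) x * m x := fun i =>
    ((contDiff_pd (contDiff_pd hu i) i).continuous.mul hm.continuous).integrable_of_hasCompactSupport
      hc.mul_left
  refine ⟨integrable_finsetSum _ fun i _ => hint i, ?_⟩
  rw [integral_finsetSum _ fun i _ => hint i]
  have : ∀ i, ∫ x, pd i u x * pd i m x = - ∫ x, pd i (pd i u) x * m x := fun i =>
    integral_mul_fderiv_eq_neg_fderiv_mul_of_integrable (f := pd i u) (g := m)
      (v := EuclideanSpace.single i 1) (hint2 i) (hint i)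
      (((contDiff_pd hu i).continuous.mul hm.continuous).integrable_of_hasCompactSupport
        hc.mul_left)
      (fun z _ => (contDiff_pd hu i).differentiable (by simp) z)
      (fun z _ => hm.differentiable (by simp) z)
  simp_rw [this]
  rw [Finset.sum_neg_distrib, ← integral_finsetSum _ fun i _ => hint2 i]
  congr 2
  funext x
  rw [lap_eq hu, Finset.mul_sum]
  exact Finset.sum_congr rfl fun i _ => mul_comm _ _

theorem continuous_energy_density {u v : 𝔼 → ℝ} (hu : ContDiff ℝ ∞ u) (hv : ContDiff ℝ ∞ v) :
    Continuous fun y => ‖gradient u y‖ ^ 2 + ‖gradient v y‖ ^ 2 + (u y) ^ 2 * (v y) ^ 2 := by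
  simp_rw [norm_gradient_sq]
  have h1 := fun i => (contDiff_pd hu i).continuous
  have h2 := fun i => (contDiff_pd hv i).continuous
  have h3 := hu.continuous
  have h4 := hv.continuous
  fun_prop

theorem energy_comm (u v : 𝔼 → ℝ) (R : ℝ) : energy u v R = energy v u R := by
  unfold energy
  congr 1
  funext y
  ring

variable {u v : EuclideanSpace ℝ (Fin n) → ℝ}

theorem IsLocalMinimizer.symm (h : IsLocalMinimizer u v) : IsLocalMinimizer v u := by
  intro R hR ub vb hub hvb heq
  rw [energy_comm v u, energy_comm ub vb]
  exact h R hR vb ub hvb hub fun x hx => (heq x hx).symm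

theorem IsLocalMinimizer.integral_energy_diff_nonneg (h : IsLocalMinimizer u v)
    (hu : ContDiff ℝ ∞ u) (hv : ContDiff ℝ ∞ v) {ub vb : 𝔼 → ℝ} (hub : ContDiff ℝ ∞ ub)
    (hvb : ContDiff ℝ ∞ vb) {K : Set 𝔼} (hK : IsCompact K)
    (heq : ∀ x ∉ K, ub x = u x ∧ vb x = v x) :
    Integrable (fun y => ((‖gradient ub y‖ ^ 2 + ‖gradient vb y‖ ^ 2 + (ub y) ^ 2 * (vb y) ^ 2) -
      (‖gradient u y‖ ^ 2 + ‖gradient v y‖ ^ 2 + (u y) ^ 2 * (v y) ^ 2))) ∧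
    0 ≤ ∫ y, ((‖gradient ub y‖ ^ 2 + ‖gradient vb y‖ ^ 2 + (ub y) ^ 2 * (vb y) ^ 2) -
      (‖gradient u y‖ ^ 2 + ‖gradient v y‖ ^ 2 + (u y) ^ 2 * (v y) ^ 2)) := by
  obtain ⟨R, hR⟩ := hK.isBounded.subset_ball (0 : 𝔼)
  have hR' : K ⊆ ball 0 (max R 1) := hR.trans (ball_subset_ball (le_max_left _ _))
  have hmin := h (max R 1) (by positivity) ub vb hub hvb fun x hx => heq x fun hx' => hx (hR' hx')
  have hint : ∀ {u v : 𝔼 → ℝ}, ContDiff ℝ ∞ u → ContDiff ℝ ∞ v → IntegrableOn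
      (fun y => ‖gradient u y‖ ^ 2 + ‖gradient v y‖ ^ 2 + (u y) ^ 2 * (v y) ^ 2)
      (ball 0 (max R 1)) := fun hu hv =>
    ((continuous_energy_density hu hv).continuousOn.integrableOn_compact
      (isCompact_closedBall 0 (max R 1))).mono_set ball_subset_closedBall
  have hz : ∀ x ∉ ball (0 : 𝔼) (max R 1),
      ((‖gradient ub x‖ ^ 2 + ‖gradient vb x‖ ^ 2 + (ub x) ^ 2 * (vb x) ^ 2) -
      (‖gradient u x‖ ^ 2 + ‖gradient v x‖ ^ 2 + (u x) ^ 2 * (v x) ^ 2)) = 0 := by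
    intro x hx
    have hxK : x ∉ K := fun hx' => hx (hR' hx')
    have hev : ∀ᶠ y in 𝓝 x, y ∉ K := hK.isClosed.isOpen_compl.mem_nhds hxK
    have e1 : ub =ᶠ[𝓝 x] u := hev.mono fun y hy => (heq y hy).1
    have e2 : vb =ᶠ[𝓝 x] v := hev.mono fun y hy => (heq y hy).2
    rw [e1.gradient_eq, e2.gradient_eq, (heq x hxK).1, (heq x hxK).2]
    ring
  refine ⟨(integrableOn_iff_integrable_of_support_subset
    (Function.support_subset_iff'.2 hz)).1 ((hint hub hvb).sub (hint hu hv)), ?_⟩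
  rw [← setIntegral_eq_integral_of_forall_compl_eq_zero hz, integral_sub (hint hub hvb) (hint hu hv)]
  unfold energy at hmin
  linarith

theorem sum_sq_identity (a b c : Fin n → ℝ) {p : ℝ} (hp0 : 0 ≤ p) (hp1 : p ≤ 1) :
    (∑ i, (c i + p * (a i - b i)) ^ 2 + ∑ i, (b i - (a i - p * (a i - b i))) ^ 2) -
      (∑ i, c i ^ 2 + ∑ i, b i ^ 2) ≤
    2 * ∑ i, (c i - b i) * a i - 2 * ∑ i, c i * (a i - p * (a i - b i)) + ∑ i, a i ^ 2 := by
  simp only [Finset.mul_sum, ← Finset.sum_add_distrib, ← Finset.sum_sub_distrib]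
  refine Finset.sum_le_sum fun i _ => ?_
  nlinarith [mul_nonneg (mul_nonneg hp0 (sub_nonneg.2 hp1)) (sq_nonneg (a i - b i))]

theorem IsSolution.comparison_eps (h : IsSolution u v) (hmin : IsLocalMinimizer u v)
    {φ χ : 𝔼 → ℝ} (hφ : ContDiff ℝ ∞ φ) (hφc : HasCompactSupport φ) (hφ0 : ∀ x, 0 ≤ φ x)
    (hχ : Continuous χ) (hχc : HasCompactSupport χ) (hχ0 : ∀ x, 0 ≤ χ x)
    (hχ1 : ∀ x, φ x ≠ 0 → 1 ≤ χ x) {ε : ℝ} (hε : 0 < ε) (hε1 : ε ≤ 1) :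
    2 * ∫ x, φ x * lap (fun y => u y - v y) x ≤ (∫ x, ∑ i, pd i φ x ^ 2) +
      2 * (∫ x, χ x * (u x * v x ^ 3)) +
      ε * ∫ x, χ x * (2 * (u x * v x ^ 2) + (u x + φ x) ^ 2) := by
  obtain ⟨P, p, hP, hPd, hp0, hp1, hPneg, hPnn, hPle, hPge⟩ := exists_smooth_posPart hε
  have hu := h.smooth
  have hv := h.symm.smooth
  set q : 𝔼 → ℝ := fun x => P (φ x - v x) with hq
  have hqs : ContDiff ℝ ∞ q := hP.comp (hφ.sub hv)
  set m : 𝔼 → ℝ := fun x => φ x - q x with hm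
  have hms : ContDiff ℝ ∞ m := hφ.sub hqs
  have hq0 : ∀ x, φ x = 0 → q x = 0 := fun x hx =>
    hPneg _ (by rw [hx]; linarith [h.symm.pos x])
  have hm0 : ∀ x, φ x = 0 → m x = 0 := fun x hx => by simp only [hm]; rw [hq0 x hx, hx, sub_zero]
  have hmc : HasCompactSupport m := HasCompactSupport.of_support_subset_isCompact hφc
    fun x hx => subset_tsupport φ fun h' => hx (hm0 x h')
  have hqpd : ∀ i x, pd i q x = p (φ x - v x) * (pd i φ x - pd i v x) := by
    intro i x
    have h1 := (hPd (φ x - v x)).comp_hasFDerivAt x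
      ((hφ.differentiable (by simp) x).hasFDerivAt.sub (hv.differentiable (by simp) x).hasFDerivAt)
    have h2 : fderiv ℝ q x = _ := h1.fderiv
    unfold pd
    rw [h2]
    simp
  have hmpd : ∀ i x, pd i m x = pd i φ x - p (φ x - v x) * (pd i φ x - pd i v x) := by
    intro i x
    rw [← hqpd]
    exact pd_sub hφ hqs i x
  obtain ⟨i0, hE⟩ := hmin.integral_energy_diff_nonneg hu hv (ub := fun x => u x + q x)
    (vb := fun x => v x - m x) (hu.add hqs) (hv.sub hms) hφc fun x hx => by
      have hx' := image_eq_zero_of_notMem_tsupport hx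
      simp [hq0 x hx', hm0 x hx']
  obtain ⟨i1, e1⟩ := integral_pd_mul_pd (hu.sub hv) hφ hφc
  obtain ⟨i2, e2⟩ := integral_pd_mul_pd hu hms hmc
  have hχv : Continuous fun x => χ x * (u x * v x ^ 3) := by
    have := hu.continuous; have := hv.continuous; fun_prop
  have hχe : Continuous fun x => χ x * (2 * (u x * v x ^ 2) + (u x + φ x) ^ 2) := by
    have := hu.continuous; have := hv.continuous; have := hφ.continuous; fun_prop
  have i3 : Integrable fun x => ∑ i, pd i φ x ^ 2 := by
    refine integrable_finsetSum _ fun i _ => ?_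
    refine ((contDiff_pd hφ i).continuous.pow 2).integrable_of_hasCompactSupport ?_
    have := (hφc.fderiv_apply (𝕜 := ℝ) (EuclideanSpace.single i (1 : ℝ)))
    simp_rw [pow_two]
    exact this.mul_left
  have i4 : Integrable fun x => χ x * (u x * v x ^ 3) :=
    hχv.integrable_of_hasCompactSupport hχc.mul_right
  have i5 : Integrable fun x => χ x * (2 * (u x * v x ^ 2) + (u x + φ x) ^ 2) :=
    hχe.integrable_of_hasCompactSupport hχc.mul_right
  have i6 : Integrable fun x => m x * lap u x :=
    (hms.continuous.mul (contDiff_lap hu).continuous).integrable_of_hasCompactSupport hmc.mul_right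
  have hpt : ∀ x, 0 ≤ m x ∧ m x ≤ v x + ε ∧
      (u x + q x) ^ 2 * (v x - m x) ^ 2 ≤ u x ^ 2 * v x ^ 2 + ε ^ 2 * (u x + φ x) ^ 2 := by
    intro x
    have hu0 := h.pos x
    have hv0 := h.symm.pos x
    have hf0 := hφ0 x
    rcases le_total (φ x - v x) 0 with hs | hs
    · have hqx : q x = 0 := hPneg _ hs
      have hmx : m x = φ x := by simp [hm, hqx]
      rw [hqx, hmx, add_zero]
      refine ⟨hf0, by linarith, ?_⟩
      have : (v x - φ x) ^ 2 ≤ v x ^ 2 := by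
        apply pow_le_pow_left₀ <;> linarith
      have := mul_le_mul_of_nonneg_left this (sq_nonneg (u x))
      nlinarith [mul_nonneg (sq_nonneg ε) (sq_nonneg (u x + φ x))]
    · have a1 : 0 ≤ q x := hPnn _ hs
      have a2 : q x ≤ φ x - v x := hPle _ hs
      have a3 : φ x - v x - ε ≤ q x := hPge _ hs
      have hmx : m x = φ x - q x := rfl
      rw [hmx]
      refine ⟨by linarith, by linarith, ?_⟩
      have b1 : (v x - (φ x - q x)) ^ 2 ≤ ε ^ 2 := by
        rw [sq_le_sq, abs_of_pos hε, abs_le]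
        constructor <;> linarith
      have b2 : (u x + q x) ^ 2 ≤ (u x + φ x) ^ 2 := by
        apply pow_le_pow_left₀ <;> linarith
      have := mul_le_mul b2 b1 (sq_nonneg _) (sq_nonneg _)
      nlinarith [mul_nonneg (sq_nonneg (u x)) (sq_nonneg (v x))]
  have hmul : ∫ x, m x * lap u x ≤ ∫ x, (χ x * (u x * v x ^ 3) + ε * (χ x * (u x * v x ^ 2))) := by
    have i7 : Integrable fun x => χ x * (u x * v x ^ 2) := by
      refine Continuous.integrable_of_hasCompactSupport ?_ hχc.mul_right
      have := hu.continuous; have := hv.continuous; fun_prop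
    refine integral_mono i6 (i4.add (i7.const_mul ε)) fun x => ?_
    have hu0 := h.pos x
    have hv0 := h.symm.pos x
    simp only
    rw [h.lap_left]
    by_cases hx : φ x = 0
    · rw [hm0 x hx, zero_mul]
      have := hχ0 x
      positivity
    · have := hχ1 x hx
      calc m x * (u x * v x ^ 2) ≤ (v x + ε) * (u x * v x ^ 2) := by
            gcongr; exact (hpt x).2.1
        _ ≤ χ x * ((v x + ε) * (u x * v x ^ 2)) := le_mul_of_one_le_left (by positivity) this
        _ = _ := by ring
  have i8 : Integrable fun x => χ x * (u x + φ x) ^ 2 := by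
    refine Continuous.integrable_of_hasCompactSupport ?_ hχc.mul_right
    have := hu.continuous; have := hφ.continuous; fun_prop
  have i9 : Integrable fun x => χ x * (u x * v x ^ 2) := by
    refine Continuous.integrable_of_hasCompactSupport ?_ hχc.mul_right
    have := hu.continuous; have := hv.continuous; fun_prop
  have hD := integral_mono (g := fun y => 2 * (∑ i, pd i (fun x => u x - v x) y * pd i φ y) -
      2 * (∑ i, pd i u y * pd i m y) + (∑ i, pd i φ y ^ 2) + ε * (χ y * (u y + φ y) ^ 2))
    i0 ((((i1.const_mul 2).sub (i2.const_mul 2)).add i3).add (i8.const_mul ε)) fun y => by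
      simp only [norm_gradient_sq]
      have hid := sum_sq_identity (fun i => pd i φ y) (fun i => pd i v y) (fun i => pd i u y)
        (hp0 (φ y - v y)) (hp1 (φ y - v y))
      have g1 : ∀ i, pd i (fun x => u x + q x) y = pd i u y + p (φ y - v y) *
          (pd i φ y - pd i v y) := fun i => by rw [pd_add hu hqs, hqpd]
      have g2 : ∀ i, pd i (fun x => v x - m x) y = pd i v y - (pd i φ y - p (φ y - v y) *
          (pd i φ y - pd i v y)) := fun i => by rw [pd_sub hv hms, hmpd]
      have g3 : ∀ i, pd i (fun x => u x - v x) y = pd i u y - pd i v y := fun i => pd_sub hu hv i y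
      simp only [g1, g2, g3, hmpd]
      have hpot : (u y + q y) ^ 2 * (v y - m y) ^ 2 ≤
          u y ^ 2 * v y ^ 2 + ε * (χ y * (u y + φ y) ^ 2) := by
        by_cases hy : φ y = 0
        · rw [hq0 y hy, hm0 y hy, add_zero, sub_zero]
          have := hχ0 y
          have : 0 ≤ ε * (χ y * (u y + φ y) ^ 2) := by positivity
          linarith
        · have := (hpt y).2.2
          have h1 : ε ^ 2 ≤ ε * χ y := by nlinarith [hχ1 y hy]
          nlinarith [mul_le_mul_of_nonneg_right h1 (sq_nonneg (u y + φ y))]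
      linarith
  have j1 : Integrable fun y => 2 * (∑ i, pd i (fun x => u x - v x) y * pd i φ y) -
      2 * (∑ i, pd i u y * pd i m y) := (i1.const_mul 2).sub (i2.const_mul 2)
  have j2 : Integrable fun y => 2 * (∑ i, pd i (fun x => u x - v x) y * pd i φ y) -
      2 * (∑ i, pd i u y * pd i m y) + (∑ i, pd i φ y ^ 2) := j1.add i3
  rw [integral_add j2 (i8.const_mul ε), integral_add j1 i3,
    integral_sub (i1.const_mul 2) (i2.const_mul 2), integral_const_mul, integral_const_mul,
    integral_const_mul, e1, e2] at hD
  rw [integral_add i4 (i9.const_mul ε), integral_const_mul] at hmul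
  have e5 : ∫ x, χ x * (2 * (u x * v x ^ 2) + (u x + φ x) ^ 2) =
      2 * (∫ x, χ x * (u x * v x ^ 2)) + ∫ x, χ x * (u x + φ x) ^ 2 := by
    rw [← integral_const_mul, ← integral_add (i9.const_mul 2) i8]
    congr 1
    funext x
    ring
  rw [e5]
  linarith

theorem IsSolution.comparison (h : IsSolution u v) (hmin : IsLocalMinimizer u v)
    {φ χ : 𝔼 → ℝ} (hφ : ContDiff ℝ ∞ φ) (hφc : HasCompactSupport φ) (hφ0 : ∀ x, 0 ≤ φ x)
    (hχ : Continuous χ) (hχc : HasCompactSupport χ) (hχ0 : ∀ x, 0 ≤ χ x)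
    (hχ1 : ∀ x, φ x ≠ 0 → 1 ≤ χ x) :
    2 * ∫ x, φ x * lap (fun y => u y - v y) x ≤ (∫ x, ∑ i, pd i φ x ^ 2) +
      2 * (∫ x, χ x * (u x * v x ^ 3)) := by
  set M := ∫ x, χ x * (2 * (u x * v x ^ 2) + (u x + φ x) ^ 2) with hM
  have hM0 : 0 ≤ M := integral_nonneg fun x => by
    have := hχ0 x
    have := (h.pos x).le
    have := (h.symm.pos x).le
    positivity
  refine le_of_forall_pos_le_add fun δ hδ => ?_
  have hε : 0 < min 1 (δ / (M + 1)) := by positivity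
  have := h.comparison_eps hmin hφ hφc hφ0 hχ hχc hχ0 hχ1 hε (min_le_left _ _)
  rw [← hM] at this
  have h2 : min 1 (δ / (M + 1)) * M ≤ δ := by
    calc _ ≤ δ / (M + 1) * M := by gcongr; exact min_le_right _ _
      _ = δ * (M / (M + 1)) := by ring
      _ ≤ δ * 1 := by
        gcongr
        rw [div_le_one (by positivity)]
        linarith
      _ = δ := mul_one δ
  linarith

/-- Change of variables between weighted averages and integrals. -/
theorem integral_rescale (k f : 𝔼 → ℝ) (y : 𝔼) {r : ℝ} (hr : 0 < r) :
    ∫ x, k (r⁻¹ • (x - y)) * f x = r ^ n * Av k f y r := by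
  have h1 := Measure.integral_comp_smul (volume : Measure 𝔼)
    (fun z => k (r⁻¹ • z) * f (y + z)) r
  have h2 := integral_add_right_eq_self (μ := (volume : Measure 𝔼))
    (fun x => k (r⁻¹ • (x - y)) * f x) y
  simp only [add_sub_cancel_right, finrank_euclideanSpace, Fintype.card_fin] at h1 h2
  rw [← h2]
  unfold Av
  rw [abs_of_pos (by positivity), smul_eq_mul] at h1
  have h3 : (fun z : 𝔼 => k z * f (y + r • z)) = fun z => k (r⁻¹ • r • z) * f (y + r • z) := by
    funext z
    rw [smul_smul, inv_mul_cancel₀ hr.ne', one_smul]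
  rw [h3, h1, ← mul_assoc, mul_inv_cancel₀ (by positivity), one_mul]
  congr 1
  funext z
  rw [add_comm]

end Minimality

/-- The density `u v (u² + v²)` controlling the minimality comparison. -/
def jden {n : ℕ} (u v : EuclideanSpace ℝ (Fin n) → ℝ) (y : EuclideanSpace ℝ (Fin n)) : ℝ :=
  u y * v y * (u y ^ 2 + v y ^ 2)

section Comparison

variable {n : ℕ} {u v : EuclideanSpace ℝ (Fin n) → ℝ}

local notation "𝔼" => EuclideanSpace ℝ (Fin n)
local notation "η" => eta n
local notation "ψ" => psi n

theorem jden_comm (u v : 𝔼 → ℝ) : jden u v = jden v u := by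
  funext y; unfold jden; ring

theorem pd_rescale {k : 𝔼 → ℝ} (hk : ContDiff ℝ ∞ k) (τ s : ℝ) (y : 𝔼) (i : Fin n) (x : 𝔼) :
    pd i (fun x => τ * k (s • (x - y))) x = τ * s * pd i k (s • (x - y)) := by
  have h1 : HasFDerivAt (fun x : 𝔼 => s • (x - y)) (s • ContinuousLinearMap.id ℝ 𝔼) x :=
    ((hasFDerivAt_id x).sub_const y).const_smul s
  have h2 := ((hk.differentiable (by simp) (s • (x - y))).hasFDerivAt.comp x h1).const_mul τ
  unfold pd
  rw [HasFDerivAt.fderiv (f := fun x => τ * k (s • (x - y))) h2]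
  simp [mul_assoc]

theorem exists_av_lap_diff_le {k : 𝔼 → ℝ} (hk : IsKer k) (hks : ContDiff ℝ ∞ k)
    (hk0 : ∀ z, 0 ≤ k z) : ∃ C > 0, ∀ (u v : 𝔼 → ℝ) (y : 𝔼) (r l : ℝ), IsSolution u v →
      IsLocalMinimizer u v → 0 < r → 0 < l → Av η (jden u v) y (2 * r) ≤ l ^ 2 →
      Av k (lap fun x => u x - v x) y r ≤ C * l / r := by
  obtain ⟨c, hc, hcz⟩ := exists_lower_bound (n := n)
  set D := ∫ z, ∑ i, pd i k z ^ 2 with hD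
  have hD0 : 0 ≤ D := integral_nonneg fun z => Finset.sum_nonneg fun i _ => sq_nonneg _
  refine ⟨D / 2 + 2 ^ n / c, by positivity, fun u v y r l h hmin hr hl hj => ?_⟩
  have hcs : ∀ (k : 𝔼 → ℝ) (_ : IsKer k) (t : ℝ), 0 < t →
      HasCompactSupport fun x => k (t⁻¹ • (x - y)) := fun k hk t ht =>
    HasCompactSupport.of_support_subset_isCompact (isCompact_closedBall y t) fun x hx => by
      by_contra hx'
      refine hx (hk.supp _ ?_)
      rw [mem_closedBall, dist_eq_norm, not_le] at hx'
      rw [norm_smul, norm_inv, Real.norm_of_nonneg ht.le, ← div_eq_inv_mul, le_div_iff₀ ht]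
      linarith
  have hcomp := h.comparison hmin (φ := fun x => (r * l) * k (r⁻¹ • (x - y)))
    (χ := fun x => c⁻¹ * η ((2 * r)⁻¹ • (x - y)))
    (contDiff_const.mul (hks.comp ((contDiff_id.sub contDiff_const).const_smul _)))
    ((hcs k hk r hr).mul_left) (fun x => by have := hk0 (r⁻¹ • (x - y)); positivity)
    (continuous_const.mul ((isKer_eta (n := n)).cont.comp (by fun_prop)))
    ((hcs η isKer_eta (2 * r) (by positivity)).mul_left)
    (fun x => by have := eta_nonneg (n := n) ((2 * r)⁻¹ • (x - y)); positivity)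
    (fun x hx => by
      have h1 : ‖r⁻¹ • (x - y)‖ < 1 := by
        by_contra hx'
        exact hx (by rw [hk.supp _ (not_lt.1 hx'), mul_zero])
      have h2 : ‖(2 * r)⁻¹ • (x - y)‖ ≤ 1 / 2 := by
        rw [mul_inv, mul_smul, norm_smul, Real.norm_of_nonneg (by positivity)]
        linarith
      rw [← div_eq_inv_mul, one_le_div hc]
      exact (hcz _ h2).1)
  have e1 : ∫ x, r * l * k (r⁻¹ • (x - y)) * lap (fun y => u y - v y) x =
      r * l * (r ^ n * Av k (lap fun x => u x - v x) y r) := by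
    rw [← integral_rescale k _ y hr, ← integral_const_mul]
    simp only [mul_assoc]
  have e2 : ∫ x, ∑ i, pd i (fun x => (r * l) * k (r⁻¹ • (x - y))) x ^ 2 = l ^ 2 * (r ^ n * D) := by
    have := integral_rescale (fun z => ∑ i, pd i k z ^ 2) (fun _ => 1) y hr
    simp only [Av, mul_one] at this
    rw [hD, ← this, ← integral_const_mul]
    congr 1
    funext x
    rw [Finset.mul_sum]
    refine Finset.sum_congr rfl fun i _ => ?_
    rw [pd_rescale hks, mul_right_comm r l, mul_inv_cancel₀ hr.ne', one_mul, mul_pow]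
  have e3 : ∫ x, c⁻¹ * η ((2 * r)⁻¹ • (x - y)) * (u x * v x ^ 3) =
      c⁻¹ * ((2 * r) ^ n * Av η (fun x => u x * v x ^ 3) y (2 * r)) := by
    rw [← integral_rescale η _ y (by positivity), ← integral_const_mul]
    simp only [mul_assoc]
  have hu := h.smooth.continuous
  have hv := h.symm.smooth.continuous
  have hle : Av η (fun x => u x * v x ^ 3) y (2 * r) ≤ l ^ 2 := by
    refine le_trans (av_mono isKer_eta eta_nonneg (by fun_prop) (by unfold jden; fun_prop)
      (by positivity) fun x _ => ?_) hj
    have := h.pos x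
    have := h.symm.pos x
    unfold jden
    have : 0 ≤ u x ^ 3 * v x := by positivity
    nlinarith
  rw [e1, e2, e3] at hcomp
  have h4 : c⁻¹ * ((2 * r) ^ n * Av η (fun x => u x * v x ^ 3) y (2 * r)) ≤
      c⁻¹ * ((2 * r) ^ n * l ^ 2) := by gcongr
  rw [le_div_iff₀ hr]
  have h5 : 2 * (r ^ n * l) * (Av k (lap fun x => u x - v x) y r * r) ≤
      2 * (r ^ n * l) * ((D / 2 + 2 ^ n / c) * l) := by
    calc _ = 2 * (r * l * (r ^ n * Av k (lap fun x => u x - v x) y r)) := by ring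
      _ ≤ _ := hcomp
      _ ≤ l ^ 2 * (r ^ n * D) + 2 * (c⁻¹ * ((2 * r) ^ n * l ^ 2)) := by linarith
      _ = _ := by rw [mul_pow]; ring
  exact le_of_mul_le_mul_left h5 (by positivity)

theorem exists_abs_av_lap_diff_le {k : 𝔼 → ℝ} (hk : IsKer k) (hks : ContDiff ℝ ∞ k)
    (hk0 : ∀ z, 0 ≤ k z) : ∃ C > 0, ∀ (u v : 𝔼 → ℝ) (y : 𝔼) (r l : ℝ), IsSolution u v →
      IsLocalMinimizer u v → 0 < r → 0 < l → Av η (jden u v) y (2 * r) ≤ l ^ 2 →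
      |Av k (lap fun x => u x - v x) y r| ≤ C * l / r := by
  obtain ⟨C, hC, H⟩ := exists_av_lap_diff_le hk hks hk0
  refine ⟨C, hC, fun u v y r l h hmin hr hl hj => abs_le.2 ⟨?_, H u v y r l h hmin hr hl hj⟩⟩
  have := H v u y r l h.symm hmin.symm hr hl (by rwa [jden_comm])
  have e : (lap fun x => v x - u x) = fun x => (-1) * lap (fun x => u x - v x) x := by
    funext x
    rw [lap_sub h.smooth h.symm.smooth, lap_sub h.symm.smooth h.smooth]
    ring
  rw [e, av_const_mul] at this
  linarith

theorem hasDerivAt_av_pd {f : 𝔼 → ℝ} (hf : ContDiff ℝ ∞ f) (i : Fin n) (x : 𝔼) (r : ℝ) :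
    HasDerivAt (Av η (pd i f) x) (Av (fun z => z i * η z) (lap f) x r) r := by
  have h := hasDerivAt_av_eta (contDiff_pd hf i) x r
  have e : lap (pd i f) = pd i (lap f) := funext fun y => lap_pd hf i y
  rw [e, av_pd isKer_psi (contDiff_psi.of_le (by simp)) (contDiff_lap hf) i x r] at h
  have e2 : pd i ψ = fun z => (-1) * (z i * η z) := by
    funext z
    rw [pd_psi]
    ring
  rw [e2] at h
  convert h using 1
  unfold Av
  rw [← integral_neg]
  congr 1
  funext z
  ring

theorem exists_derivative_bound (n : ℕ) : ∃ C > 0, ∀ (u v : EuclideanSpace ℝ (Fin n) → ℝ)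
    (y : EuclideanSpace ℝ (Fin n)) (r l : ℝ), IsSolution u v →
      IsLocalMinimizer u v → 0 < r → 0 < l → Av (eta n) (jden u v) y (2 * r) ≤ l ^ 2 →
      |r * Av (psi n) (lap fun x => u x - v x) y r| ≤ C * l ∧
      ∀ i, |Av (fun z => z i * eta n z) (lap fun x => u x - v x) y r| ≤ C * l / r := by
  obtain ⟨C₁, hC₁, H₁⟩ := exists_abs_av_lap_diff_le (isKer_psi (n := n)) contDiff_psi psi_nonneg
  obtain ⟨C₂, hC₂, H₂⟩ := exists_abs_av_lap_diff_le (isKer_eta (n := n)) contDiff_eta eta_nonneg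
  have hz : ∀ i : Fin n, Continuous fun z : EuclideanSpace ℝ (Fin n) => 1 + z i := fun i => by
    fun_prop
  have hzs : ∀ i : Fin n, ContDiff ℝ ∞ fun z : EuclideanSpace ℝ (Fin n) => 1 + z i := fun i =>
    contDiff_const.add (EuclideanSpace.proj (𝕜 := ℝ) i).contDiff
  have hk := fun i : Fin n => exists_abs_av_lap_diff_le
    ((isKer_eta (n := n)).mul (hz i)) ((hzs i).mul contDiff_eta) fun z => by
      rcases le_total 1 ‖z‖ with h | h
      · simp [isKer_eta.supp z h]
      · have := (abs_le.1 ((PiLp.norm_apply_le z i).trans h)).1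
        exact mul_nonneg (by linarith) (eta_nonneg z)
  choose C₃ hC₃ H₃ using hk
  have hS : 0 ≤ ∑ i, C₃ i := Finset.sum_nonneg fun i _ => (hC₃ i).le
  refine ⟨C₁ + C₂ + ∑ i, C₃ i, by positivity, fun u v y r l h hmin hr hl hj => ⟨?_, fun i => ?_⟩⟩
  · have := H₁ u v y r l h hmin hr hl hj
    rw [abs_mul, abs_of_pos hr]
    rw [le_div_iff₀ hr] at this
    nlinarith
  · have a2 := H₂ u v y r l h hmin hr hl hj
    have a3 := H₃ i u v y r l h hmin hr hl hj
    have hw : Continuous (lap fun x => u x - v x) :=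
      (contDiff_lap (h.smooth.sub h.symm.smooth)).continuous
    have e : Av (fun z => z i * eta n z) (lap fun x => u x - v x) y r =
        Av (fun z => (1 + z i) * eta n z) (lap fun x => u x - v x) y r -
        Av (eta n) (lap fun x => u x - v x) y r := by
      unfold Av
      rw [← integral_sub (integrable_av (isKer_eta.mul (hz i)) hw y r)
        (integrable_av isKer_eta hw y r)]
      congr 1
      funext z
      ring
    rw [e]
    have hle : C₃ i ≤ ∑ i, C₃ i := Finset.single_le_sum (fun i _ => (hC₃ i).le) (Finset.mem_univ i)
    have hlr : 0 ≤ l / r := by positivity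
    have h5 : (C₃ i + C₂) * (l / r) ≤ (C₁ + C₂ + ∑ i, C₃ i) * (l / r) :=
      mul_le_mul_of_nonneg_right (by linarith) hlr
    simp only [mul_div_assoc] at a2 a3 ⊢
    rw [abs_le] at a2 a3 ⊢
    constructor <;> linarith [a2.1, a2.2, a3.1, a3.2]

end Comparison

section Interaction

variable {n : ℕ} {u v : EuclideanSpace ℝ (Fin n) → ℝ}

local notation "𝔼" => EuclideanSpace ℝ (Fin n)
local notation "η" => eta n
local notation "ψ" => psi n

namespace IsSolution

theorem smooth_jden (h : IsSolution u v) : ContDiff ℝ ∞ (jden u v) :=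
  (h.smooth.mul h.symm.smooth).mul ((h.smooth.pow 2).add (h.symm.smooth.pow 2))

theorem jden_le (h : IsSolution u v) (x : 𝔼) : jden u v x ≤ (u x + v x) * den u v x := by
  have := h.pos x
  have := h.symm.pos x
  have : 0 ≤ (u x * v x) * (u x * v x) := by positivity
  unfold jden den
  nlinarith

theorem av_le_sum (h : IsSolution u v) (x : 𝔼) (r : ℝ) :
    Av η u x r ≤ Av η (fun y => u y + v y) x r := by
  rw [h.av_sum_eq]
  linarith [(h.symm.av_pos x r)]

theorem av_mul_le_sq (h : IsSolution u v) (x : 𝔼) (r : ℝ) :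
    Av η u x r * Av η v x r ≤ Av η (fun y => u y + v y) x r ^ 2 := by
  have h1 := h.av_le_sum x r
  have h2 := h.symm.av_le_sum x r
  rw [fun_add_comm] at h2
  rw [pow_two]
  exact mul_le_mul h1 h2 (h.symm.av_pos x r).le (h.av_sum_pos x r).le

theorem sum_le_av (h : IsSolution u v) (x : 𝔼) {r : ℝ} (hr : 0 ≤ r) :
    u x + v x ≤ Av η (fun y => u y + v y) x r :=
  le_av_eta_of_lap_nonneg (f := fun y => u y + v y) h.smooth_sum
    (fun y => by rw [h.lap_sum]; exact h.den_nonneg y) x hr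

theorem le_av (h : IsSolution u v) (x : 𝔼) {r : ℝ} (hr : 0 ≤ r) : u x ≤ Av η u x r :=
  le_av_eta_of_lap_nonneg h.smooth h.lap_nonneg x hr

theorem av_sum_le_of_den (h : IsSolution u v) {y : 𝔼} {r K : ℝ}
    (hT : ∀ t ≥ r, t * Av ψ (den u v) y t ≤ K) {t : ℝ} (ht : r ≤ t) :
    Av η (fun y => u y + v y) y t ≤ Av η (fun y => u y + v y) y r + K * (t - r) := by
  have := sub_le_sub_of_hasDerivAt_le (g := fun s => K * s) (g' := fun _ => K) ht
    (fun s _ => h.hasDerivAt_sum y s)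
    (fun s _ => by simpa using (hasDerivAt_id s).const_mul K) fun s hs => hT s hs.1.le
  linarith

end IsSolution

variable (n) in
/-- Where the solution is at least of size `R / L`, the product of the components is tiny. -/
theorem exists_jden_le : ∃ A : ℕ, 2 ≤ A ∧ ∀ M ≥ (1 : ℝ), ∃ C ≥ (1 : ℝ), ∀ (u v : 𝔼 → ℝ) (x : 𝔼)
    (R L : ℝ), IsSolution u v → 1 ≤ R → 1 ≤ L → L ^ A = R →
    Av η (fun y => u y + v y) x R ≤ M * R →
    jden u v x ≤ (C + R / L) * den u v x + C / R := by
  obtain ⟨A, hA, C, hC, H⟩ := exists_product_decay n 6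
  obtain ⟨a, rfl⟩ := Nat.exists_eq_add_of_le' hA
  refine ⟨a + 2, hA, fun M hM => ⟨C * M ^ (a + 4), ?_, fun u v x R L h hR hL hLR hs => ?_⟩⟩
  · exact one_le_mul_of_one_le_of_one_le hC (one_le_pow₀ hM)
  have hu := h.pos x
  have hv := h.symm.pos x
  have hd := h.den_nonneg x
  have hC' : C ≤ C * M ^ (a + 4) := le_mul_of_one_le_right (by linarith) (one_le_pow₀ hM)
  have hRL : 0 ≤ R / L := by positivity
  have hCR : 0 ≤ C * M ^ (a + 4) / R := by positivity
  refine (h.jden_le x).trans ?_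
  have s1 := h.sum_le_av x zero_le_one
  by_cases h1 : 1 * Av η (fun y => u y + v y) x 1 < C
  · have : (u x + v x) * den u v x ≤ (C * M ^ (a + 4) + R / L) * den u v x :=
      mul_le_mul_of_nonneg_right (by linarith) hd
    linarith
  by_cases h2 : u x + v x ≤ R / L
  · have : (u x + v x) * den u v x ≤ (C * M ^ (a + 4) + R / L) * den u v x :=
      mul_le_mul_of_nonneg_right (by linarith) hd
    linarith
  push Not at h1 h2
  have hF := H u v x 1 R h zero_lt_one hR h1
  have hsR := h.av_sum_pos x R
  have e1 : Av η u x R * Av η v x R * Av η (fun y => u y + v y) x R ^ (a + 2) ≤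
      (M * R) ^ (a + 4) := by
    calc _ ≤ Av η (fun y => u y + v y) x R ^ 2 * Av η (fun y => u y + v y) x R ^ (a + 2) := by
          gcongr; exact h.av_mul_le_sq x R
      _ = Av η (fun y => u y + v y) x R ^ (a + 4) := by ring
      _ ≤ _ := by gcongr
  have e2 : u x * v x * (u x + v x) ^ (a + 2) ≤
      Av η u x 1 * Av η v x 1 * Av η (fun y => u y + v y) x 1 ^ (a + 2) := by
    have := h.le_av x zero_le_one
    have := h.symm.le_av x zero_le_one
    have := (h.av_pos x 1).le
    have := (h.symm.av_pos x 1).le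
    gcongr
  have hR0 : 0 < R := by linarith
  have hL0 : 0 < L := by linarith
  have e3 : u x * v x * (u x + v x) ^ (a + 2) ≤ C * (1 / R) ^ 6 * (M * R) ^ (a + 4) := by
    refine (e2.trans hF).trans ?_
    gcongr
  have e4 : (u x + v x) * den u v x * (R / L) ^ a ≤ u x * v x * (u x + v x) ^ (a + 2) := by
    calc _ ≤ (u x + v x) * den u v x * (u x + v x) ^ a := by gcongr
      _ = _ := by unfold den; ring
  have e5 : C * (1 / R) ^ 6 * (M * R) ^ (a + 4) ≤ C * M ^ (a + 4) / R * (R / L) ^ a := by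
    have : C * (1 / R) ^ 6 * (M * R) ^ (a + 4) = C * M ^ (a + 4) / R * (R / L) ^ a * (L ^ a / R) := by
      rw [mul_pow, div_pow]
      have := hL0.ne'
      field_simp
      ring_nf
      rw [mul_assoc (R ^ 4 * R ^ a), ← mul_pow, mul_inv_cancel₀ hL0.ne', one_pow, mul_one]
    rw [this]
    refine mul_le_of_le_one_right (by positivity) ?_
    rw [div_le_one hR0, ← hLR]
    exact pow_le_pow_right₀ hL (by omega)
  have e6 := le_of_mul_le_mul_right (e4.trans (e3.trans e5)) (by positivity)
  have : 0 ≤ (C * M ^ (a + 4) + R / L) * den u v x := by positivity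
  linarith

variable (n) in
/-- If the solution is much larger than the scale, then the interaction is tiny. -/
theorem exists_jden_le_of_large (A : ℕ) {M : ℝ} (hM : 1 ≤ M) : ∃ C ≥ (1 : ℝ), ∀ (u v : 𝔼 → ℝ)
    (y x : 𝔼) (r R : ℝ), IsSolution u v → C ≤ r → r ≤ R →
    R = Av η (fun y => u y + v y) y r → r ^ (2 * A + 1) ≤ R ^ (2 * A) →
    Av η (fun y => u y + v y) y R ≤ M * R → dist x y ≤ r / 4 → jden u v x ≤ C / r := by
  obtain ⟨a, ha, C, hC, H⟩ := exists_product_decay n (5 * (2 * A + 1))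
  obtain ⟨C₁, hC₁, h₁⟩ := exists_le_av_eta n
  set c := C₁ * 4 ^ n with hc
  refine ⟨max C (c ^ 4 * (C * M ^ (a + 2))), le_max_of_le_left hC,
    fun u v y x r R h hCr hrR hS hrA hs hx => ?_⟩
  have hCr' : C ≤ r := (le_max_left _ _).trans hCr
  have hr : 1 ≤ r := hC.le.trans hCr'
  have hr0 : 0 < r := by linarith
  have hR : 1 ≤ R := hr.trans hrR
  have hR0 : 0 < R := by linarith
  have hF := H u v y r R h hr0 hrR (by rw [← hS]; nlinarith)
  rw [← hS] at hF
  have hsR := h.av_sum_pos y R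
  have hM0 : 0 < M := by linarith
  have e1 : Av η u y R * Av η v y R * Av η (fun y => u y + v y) y R ^ a ≤ (M * R) ^ (a + 2) := by
    calc _ ≤ Av η (fun y => u y + v y) y R ^ 2 * Av η (fun y => u y + v y) y R ^ a := by
          gcongr; exact h.av_mul_le_sq y R
      _ = Av η (fun y => u y + v y) y R ^ (a + 2) := by ring
      _ ≤ _ := by gcongr
  have e2 : (r / R) ^ (5 * (2 * A + 1)) ≤ (1 / R) ^ 5 := by
    rw [mul_comm, pow_mul]
    refine pow_le_pow_left₀ (by positivity) ?_ 5
    rw [div_pow, div_le_div_iff₀ (by positivity) hR0, one_mul, pow_succ R]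
    gcongr
  have e3 : Av η u y r * Av η v y r ≤ C * M ^ (a + 2) / R ^ 3 := by
    have : Av η u y r * Av η v y r * R ^ a ≤ C * (1 / R) ^ 5 * (M * R) ^ (a + 2) := by
      refine hF.trans ?_
      have := (h.av_pos y R).le
      have := (h.symm.av_pos y R).le
      gcongr
    refine le_of_mul_le_mul_right (this.trans (le_of_eq ?_)) (by positivity : 0 < R ^ a)
    rw [mul_pow]; field_simp; ring
  have hcmp : ∀ f : 𝔼 → ℝ, ContDiff ℝ ∞ f → (∀ y, 0 ≤ f y) → Av η f x (r / 4) ≤ c * Av η f y r := by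
    intro f hf hf0
    have := (h₁ f y x r (r / 4) hf hf0 (by positivity) (by linarith)).1
    rwa [show r / (r / 4) = 4 by field_simp] at this
  have p1 : u x ≤ c * Av η u y r := (h.le_av x (by positivity)).trans
    (hcmp u h.smooth fun y => (h.pos y).le)
  have p2 : v x ≤ c * Av η v y r := (h.symm.le_av x (by positivity)).trans
    (hcmp v h.symm.smooth fun y => (h.symm.pos y).le)
  have p3 : u x + v x ≤ c * R := by
    rw [hS]
    exact (h.sum_le_av x (by positivity)).trans (hcmp (fun y => u y + v y) h.smooth_sum
      fun y => add_nonneg (h.pos y).le (h.symm.pos y).le)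
  have hu := h.pos x
  have hv := h.symm.pos x
  have hu' := (h.av_pos y r).le
  have hv' := (h.symm.av_pos y r).le
  have hc0 : 0 < c := by positivity
  calc jden u v x ≤ (u x + v x) * den u v x := h.jden_le x
    _ = u x * v x * (u x + v x) ^ 2 := by unfold den; ring
    _ ≤ (c * Av η u y r) * (c * Av η v y r) * (c * R) ^ 2 := by gcongr
    _ = c ^ 4 * R ^ 2 * (Av η u y r * Av η v y r) := by ring
    _ ≤ c ^ 4 * R ^ 2 * (C * M ^ (a + 2) / R ^ 3) := by gcongr
    _ = c ^ 4 * (C * M ^ (a + 2)) / R := by field_simp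
    _ ≤ c ^ 4 * (C * M ^ (a + 2)) / r := by gcongr
    _ ≤ _ := by gcongr; exact le_max_right _ _

variable (n) in
/-- At scales where the normalized interaction stays bounded, it in fact decays. -/
theorem exists_jden_decay (K : ℝ) : ∃ μ > (0 : ℝ), ∃ C ≥ (1 : ℝ), ∀ (u v : 𝔼 → ℝ) (y : 𝔼) (r : ℝ),
    IsSolution u v → C ≤ r → (∀ t ≥ r, t * Av ψ (den u v) y t ≤ K) →
    Av η (jden u v) y (r / 4) ≤ (C * r ^ (-μ)) ^ 2 := by
  obtain ⟨A, hA, H₁⟩ := exists_jden_le n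
  obtain ⟨c₁, hc₁, h₁⟩ := exists_le_av_eta n
  set c := c₁ * 4 ^ n with hc
  have hc0 : 0 < c := by positivity
  set M := 1 + |K| + c * (1 + 4 * |K|) with hM
  have hM1 : 1 ≤ M := by
    have : 0 ≤ |K| + c * (1 + 4 * |K|) := by positivity
    linarith
  obtain ⟨C₁, hC₁, H₁⟩ := H₁ M hM1
  obtain ⟨C₂, hC₂, H₂⟩ := exists_jden_le_of_large n A hM1
  have hA0 : (0 : ℝ) < A := by exact_mod_cast (by omega : 0 < A)
  set C := 2 + C₂ + C₁ + (C₁ + 1) * (c * |K|) with hC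
  have hCK : 0 ≤ (C₁ + 1) * (c * |K|) := by positivity
  refine ⟨1 / (4 * A), by positivity, C, by linarith, fun u v y r h hCr hT => ?_⟩
  have hr2 : 2 ≤ r := by linarith
  have hr0 : 0 < r := by linarith
  set m := r ^ (1 / (2 * A) : ℝ) with hm
  have hm0 : 0 < m := Real.rpow_pos_of_pos hr0 _
  have hm1 : 1 ≤ m := Real.one_le_rpow (by linarith) (by positivity)
  have hmA : m ^ (2 * A) = r := by
    rw [hm, ← Real.rpow_natCast, ← Real.rpow_mul hr0.le]
    push_cast
    rw [one_div_mul_cancel (by positivity), Real.rpow_one]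
  have hmr : m ≤ r := by
    calc m = m ^ 1 := (pow_one m).symm
      _ ≤ m ^ (2 * A) := pow_le_pow_right₀ hm1 (by omega)
      _ = r := hmA
  have hgoal : (C * r ^ (-(1 / (4 * A)) : ℝ)) ^ 2 = C ^ 2 / m := by
    rw [mul_pow, ← Real.rpow_natCast (r ^ _), ← Real.rpow_mul hr0.le, hm, div_eq_mul_inv (C ^ 2),
      ← Real.rpow_neg hr0.le]
    congr 2
    push_cast
    field_simp
    norm_num
  have hC2 : C ≤ C ^ 2 := by nlinarith
  have hK0 : 0 ≤ K := le_trans (mul_nonneg hr0.le (h.av_den_nonneg y r)) (hT r le_rfl)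
  rw [abs_of_nonneg hK0] at hM hC hCK
  rw [hgoal]
  suffices hs : Av η (jden u v) y (r / 4) ≤ C / m by
    refine hs.trans ?_
    gcongr
  set S := Av η (fun y => u y + v y) y r with hS
  set R := max r S with hR
  have hrR : r ≤ R := le_max_left _ _
  have hSR : S ≤ R := le_max_right _ _
  have hR0 : 0 < R := by linarith
  have hsR : Av η (fun y => u y + v y) y R ≤ M * R := by
    have h1 := h.av_sum_le_of_den hT hrR
    have h2 : K * (R - r) ≤ K * R := by gcongr; linarith
    have h3 : 0 ≤ c * (1 + 4 * K) * R := by positivity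
    rw [hM]
    linarith
  have hsx : ∀ x, dist x y ≤ r / 4 → Av η (fun y => u y + v y) x R ≤ M * R := by
    intro x hx
    have h0 := (h₁ (fun y => u y + v y) y x (4 * R) R h.smooth_sum
      (fun y => add_nonneg (h.pos y).le (h.symm.pos y).le) hR0 (by linarith)).1
    rw [mul_div_cancel_right₀ _ hR0.ne', ← hc] at h0
    have h1 := h.av_sum_le_of_den hT (by linarith : r ≤ 4 * R)
    have h2 : K * (4 * R - r) ≤ K * (4 * R) := by gcongr; linarith
    have h3 : c * Av η (fun y => u y + v y) y (4 * R) ≤ c * (R + K * (4 * R)) := by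
      gcongr; linarith
    have h4 : 0 ≤ (1 + K) * R := by positivity
    rw [hM]
    linarith
  by_cases hcase : r ^ (2 * A + 1) ≤ R ^ (2 * A)
  · have hRS : R = S := by
      rcases max_choice r S with h' | h'
      · rw [← hR] at h'
        rw [h', pow_succ] at hcase
        have : 0 < r ^ (2 * A) := by positivity
        nlinarith
      · exact h'
    have : Av η (jden u v) y (r / 4) ≤ C₂ / r :=
      av_eta_le h.smooth_jden.continuous (by positivity) fun x hx =>
        H₂ u v y x r R h (by linarith) hrR hRS hcase hsR hx
    refine this.trans ?_
    gcongr
    linarith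
  · push Not at hcase
    set L := R ^ (1 / A : ℝ) with hL
    have hL0 : 0 < L := Real.rpow_pos_of_pos hR0 _
    have hL1 : 1 ≤ L := Real.one_le_rpow (by linarith) (by positivity)
    have hLA : L ^ A = R := by
      rw [hL, ← Real.rpow_natCast, ← Real.rpow_mul hR0.le, one_div_mul_cancel hA0.ne',
        Real.rpow_one]
    have hmL : m ^ 2 ≤ L := by
      refine le_of_pow_le_pow_left₀ (by omega : A ≠ 0) hL0.le ?_
      rwa [hLA, ← pow_mul, hmA]
    have hRm : R ≤ r * m := by
      refine le_of_pow_le_pow_left₀ (by omega : 2 * A ≠ 0) (by positivity) ?_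
      rw [mul_pow, hmA, ← pow_succ]
      exact hcase.le
    have hRL : R / L ≤ r / m := by
      calc R / L ≤ (r * m) / m ^ 2 := by gcongr
        _ = r / m := by field_simp
    have hd := h.smooth_den.continuous
    have h0 : Av η (den u v) y (r / 4) ≤ c * (K / r) := by
      have := (h₁ (den u v) y y r (r / 4) h.smooth_den h.den_nonneg (by positivity)
        (by rw [dist_self]; linarith)).2.1
      rw [show r / (r / 4) = 4 by field_simp, ← hc] at this
      refine this.trans ?_
      gcongr
      rw [le_div_iff₀ hr0, mul_comm]
      exact hT r le_rfl
    have h2 : Av η (jden u v) y (r / 4) ≤ (C₁ + r / m) * (c * (K / r)) + C₁ / r := by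
      calc _ ≤ Av η (fun x => (C₁ + R / L) * den u v x + C₁ / R) y (r / 4) :=
            av_mono isKer_eta eta_nonneg h.smooth_jden.continuous (by fun_prop) (by positivity)
              fun x hx => H₁ u v x R L h (by linarith) hL1 hLA (hsx x hx)
        _ = (C₁ + R / L) * Av η (den u v) y (r / 4) + C₁ / R := by
            rw [av_add isKer_eta (f := fun x => (C₁ + R / L) * den u v x) (g := fun _ => C₁ / R)
              (by fun_prop) continuous_const, av_const_mul, av_eta_const]
        _ ≤ _ := by
            have := av_nonneg (k := η) eta_nonneg h.den_nonneg y (r / 4)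
            gcongr
    have h3 : 1 / r ≤ 1 / m := by gcongr
    have h4 : (C₁ + r / m) * (c * (K / r)) + C₁ / r =
        C₁ * (c * K) * (1 / r) + c * K * (1 / m) + C₁ * (1 / r) := by field_simp
    have h5 : C₁ * (c * K) * (1 / r) ≤ C₁ * (c * K) * (1 / m) := by gcongr
    have h6 : C₁ * (1 / r) ≤ C₁ * (1 / m) := by gcongr
    have h7 : C / m = (2 + C₂ + C₁ + (C₁ + 1) * (c * K)) * (1 / m) := by rw [hC]; ring
    have h8 : 0 ≤ (2 + C₂) * (1 / m) := by positivity
    rw [h7]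
    rw [h4] at h2
    linarith

end Interaction

section LinearGrowth

variable {n : ℕ} {u v : EuclideanSpace ℝ (Fin n) → ℝ}

local notation "𝔼" => EuclideanSpace ℝ (Fin n)
local notation "η" => eta n
local notation "ψ" => psi n

theorem abs_sub_le_of_pd_le {f : 𝔼 → ℝ} (hf : ContDiff ℝ ∞ f) {x₀ : 𝔼} {r L : ℝ} (hL : 0 ≤ L)
    (h : ∀ y, dist y x₀ ≤ r → ∀ i, |pd i f y| ≤ L) {x : 𝔼} (hx : dist x x₀ ≤ r) :
    |f x - f x₀| ≤ n * L * dist x x₀ := by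
  have hr : 0 ≤ r := dist_nonneg.trans hx
  have := (convex_closedBall x₀ r).norm_image_sub_le_of_norm_fderiv_le (𝕜 := ℝ) (f := f)
    (C := n * L) (fun y _ => hf.differentiable (by simp) y) (fun y hy => by
      refine ContinuousLinearMap.opNorm_le_bound _ (by positivity) fun z => ?_
      rw [fderiv_eq_sum_pd]
      calc ‖∑ i, z i * pd i f y‖ ≤ ∑ i : Fin n, ‖z‖ * L := norm_sum_le_of_le _ fun i _ => by
            rw [norm_mul]
            exact mul_le_mul (PiLp.norm_apply_le z i) (h y hy i) (norm_nonneg _) (norm_nonneg _)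
        _ = n * L * ‖z‖ := by simp; ring)
    (mem_closedBall_self hr) (mem_closedBall.2 hx)
  rwa [← dist_eq_norm, ← dist_eq_norm] at this

theorem av_lap_psi_const (c : ℝ) (x : 𝔼) {r : ℝ} : Av (lap ψ) (fun _ => c) x r = 0 := by
  have := av_lap isKer_psi contDiff_psi (contDiff_const (c := c) (E := 𝔼) (n := ∞)) x r
  rw [← this]
  have e : lap (fun _ : 𝔼 => c) = fun _ => 0 := by
    funext y
    rw [lap_eq contDiff_const]
    have e0 : ∀ i, pd i (fun _ : 𝔼 => c) = fun _ => 0 := fun i => by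
      funext y
      simp [pd]
    simp [e0, pd]
  rw [e]
  simp [Av]

namespace IsSolution

theorem abs_diff_le (h : IsSolution u v) (x : 𝔼) : |u x - v x| ≤ u x + v x := by
  have := h.pos x
  have := h.symm.pos x
  rw [abs_le]
  constructor <;> linarith

theorem smooth_diff (h : IsSolution u v) : ContDiff ℝ ∞ (fun x => u x - v x) :=
  h.smooth.sub h.symm.smooth

theorem abs_av_diff_sub_le (h : IsSolution u v) (x : 𝔼) {r t : ℝ} (hr : 0 ≤ r) (hrt : r ≤ t) :
    |Av η (fun x => u x - v x) x t - Av η (fun x => u x - v x) x r| ≤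
      Av η (fun x => u x + v x) x t - Av η (fun x => u x + v x) x r := by
  rw [h.av_sum_eq, h.av_sum_eq, av_sub isKer_eta h.smooth.continuous h.symm.smooth.continuous,
    av_sub isKer_eta h.smooth.continuous h.symm.smooth.continuous]
  have := h.av_monotone x hr hrt
  have := h.symm.av_monotone x hr hrt
  rw [abs_le]
  constructor <;> linarith

/-- Outside the interface the sum and the modulus of the difference agree up to the density. -/
theorem sum_sub_abs_diff_le (h : IsSolution u v) (x : 𝔼) :
    u x + v x - |u x - v x| ≤ 2 + den u v x := by
  have hu := h.pos x
  have hv := h.symm.pos x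
  have key : ∀ a b : ℝ, 0 < a → a ≤ b → 2 * a ≤ 2 + a * b * (a + b) := by
    intro a b ha hab
    have hb : 0 < b := by linarith
    have h1 : a * a * (a + a) ≤ a * b * (a + b) := by gcongr
    nlinarith [sq_nonneg (a - 1), mul_pos ha ha, sq_nonneg a]
  unfold den
  rcases le_total (u x) (v x) with hle | hle
  · rw [abs_of_nonpos (by linarith)]
    linarith [key _ _ hu hle]
  · rw [abs_of_nonneg (by linarith)]
    linarith [key _ _ hv hle]

end IsSolution

/-- Bounds at scales comparable to the distance from the origin, from linear growth. -/
theorem exists_top_bound (h : IsSolution u v) {C₀ : ℝ} (hC₀ : 0 < C₀)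
    (hg : ∀ x, u x + v x ≤ C₀ * (1 + ‖x‖)) : ∃ C > 0, ∀ (x : 𝔼) (r : ℝ), 1 + ‖x‖ ≤ r →
      r * Av ψ (den u v) x r ≤ C ∧ ∀ i, |Av η (pd i fun x => u x - v x) x r| ≤ C := by
  obtain ⟨C₁, hC₁, h₁⟩ := exists_av_bound ((isKer_psi (n := n)).lap contDiff_psi)
  choose C₂ hC₂ h₂ using fun i => exists_av_bound ((isKer_eta (n := n)).pd
    (contDiff_eta.of_le (by simp)) i)
  have hS : 0 ≤ ∑ i, C₂ i := Finset.sum_nonneg fun i _ => (hC₂ i).le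
  refine ⟨(C₁ + ∑ i, C₂ i) * (2 * C₀), by positivity, fun x r hr => ?_⟩
  have hr0 : 0 < r := by linarith [norm_nonneg x]
  have hb : ∀ y, dist y x ≤ r → u y + v y ≤ 2 * C₀ * r := fun y hy => by
    have : ‖y‖ ≤ ‖x‖ + r := by
      rw [dist_eq_norm] at hy
      linarith [norm_le_norm_add_norm_sub' y x]
    calc _ ≤ C₀ * (1 + ‖y‖) := hg y
      _ ≤ C₀ * (2 * r) := by gcongr; linarith
      _ = _ := by ring
  constructor
  · have e := av_lap isKer_psi contDiff_psi h.smooth_sum x r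
    rw [funext h.lap_sum] at e
    have := (le_abs_self _).trans (h₁ (fun y => u y + v y) x r _ hr0.le fun y hy => by
      rw [abs_of_pos (add_pos (h.pos y) (h.symm.pos y))]
      exact hb y hy)
    rw [← e] at this
    have h3 : r * (r * Av ψ (den u v) x r) ≤ r * (C₁ * (2 * C₀)) := by linarith
    have := le_of_mul_le_mul_left h3 hr0
    nlinarith
  · intro i
    have e := av_pd isKer_eta (contDiff_eta.of_le (by simp)) h.smooth_diff i x r
    have := h₂ i (fun y => u y - v y) x r _ hr0.le fun y hy =>
      (h.abs_diff_le y).trans (hb y hy)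
    rw [← abs_neg, ← e, abs_mul, abs_of_pos hr0] at this
    have h3 : r * |Av η (pd i fun x => u x - v x) x r| ≤ r * (C₂ i * (2 * C₀)) := by linarith
    have := le_of_mul_le_mul_left h3 hr0
    have hle : C₂ i ≤ ∑ i, C₂ i := Finset.single_le_sum (fun i _ => (hC₂ i).le) (Finset.mem_univ i)
    nlinarith

variable (n) in
theorem exists_grad_diff_le : ∃ C > 0, ∀ (u v : 𝔼 → ℝ) (y : 𝔼) (r R B μ : ℝ) (i : Fin n),
    IsSolution u v → IsLocalMinimizer u v → 0 < r → r ≤ R → 0 < B → 0 < μ →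
    (∀ t ≥ r, Av η (jden u v) y (2 * t) ≤ (B * t ^ (-μ)) ^ 2) →
    |Av η (pd i fun x => u x - v x) y R - Av η (pd i fun x => u x - v x) y r| ≤
      C * B / μ * r ^ (-μ) := by
  obtain ⟨C, hC, H⟩ := exists_derivative_bound n
  refine ⟨C, hC, fun u v y r R B μ i h hmin hr hrR hB hμ hj => ?_⟩
  have hb : ∀ t ≥ r, |Av (fun z => z i * η z) (lap fun x => u x - v x) y t| ≤
      C * B * t ^ (-μ - 1) := fun t ht => by
    have ht0 : 0 < t := by linarith
    have := (H u v y t (B * t ^ (-μ)) h hmin ht0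
      (mul_pos hB (Real.rpow_pos_of_pos ht0 _)) (hj t ht)).2 i
    rwa [Real.rpow_sub_one ht0.ne', ← mul_div_assoc, mul_assoc]
  have hd : ∀ c : ℝ, ∀ t ∈ Set.Icc r R, HasDerivAt (fun t => c * t ^ (-μ)) (c * (-μ * t ^ (-μ - 1))) t :=
    fun c t ht => (Real.hasDerivAt_rpow_const (Or.inl (by linarith [ht.1]))).const_mul c
  have hg : ∀ t ∈ Set.Icc r R, HasDerivAt (Av η (pd i fun x => u x - v x) y)
      (Av (fun z => z i * η z) (lap fun x => u x - v x) y t) t := fun t _ =>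
    hasDerivAt_av_pd h.smooth_diff i y t
  have h1 := sub_le_sub_of_hasDerivAt_le hrR hg (hd (-(C * B / μ))) fun t ht => by
    refine (le_abs_self _).trans ((hb t ht.1.le).trans (le_of_eq ?_))
    field_simp
  have h2 := sub_le_sub_of_hasDerivAt_le hrR (hd (C * B / μ)) hg fun t ht => by
    refine le_trans (le_of_eq ?_) (neg_le_of_abs_le (hb t ht.1.le))
    field_simp
  have hR : 0 < R := hr.trans_le hrR
  have h3 : 0 ≤ C * B / μ * R ^ (-μ) := by positivity
  rw [abs_le]
  constructor <;> linarith

variable (n) in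
/-- The normalized interaction at scale `r` is controlled by a gradient bound at scale `ρ` and by
the interaction at larger scales. -/
theorem exists_den_step : ∃ C > 0, ∀ (u v : 𝔼 → ℝ) (x₀ : 𝔼) (r ρ G : ℝ), IsSolution u v → 0 < r →
    0 < ρ → ρ ≤ r → 0 ≤ G →
    (∀ y, dist y x₀ ≤ r → ∀ i, |Av η (pd i fun x => u x - v x) y ρ| ≤ G) →
    r * Av ψ (den u v) x₀ r ≤ C * (G + 1 / r + Av ψ (den u v) x₀ (4 * r) / r +
      (ρ / r) ^ 2 * (r * Av ψ (den u v) x₀ (40 * r))) := by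
  obtain ⟨C₁, hC₁, h₁⟩ := exists_av_comparison ((isKer_psi (n := n)).lap contDiff_psi)
  obtain ⟨C₂, hC₂, h₂⟩ := exists_le_av_eta n
  obtain ⟨C₃, hC₃, h₃⟩ := exists_av_sub_le n
  refine ⟨C₁ * 2 ^ n * (n + 2 + C₂ * 2 ^ n + C₃), by positivity,
    fun u v x₀ r ρ G h hr hρ hρr hG hgrad => ?_⟩
  set s : 𝔼 → ℝ := fun y => u y + v y with hs
  set w : 𝔼 → ℝ := fun y => u y - v y with hw
  have hss : ContDiff ℝ ∞ s := h.smooth_sum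
  have hws : ContDiff ℝ ∞ w := h.smooth_diff
  have hls : lap s = den u v := funext h.lap_sum
  set c := |Av η w x₀ ρ| with hc
  have hsρ : ContDiff ℝ ∞ fun y => Av η s y ρ := contDiff_av isKer_eta hss ρ
  have hwρ : ContDiff ℝ ∞ fun y => Av η w y ρ := contDiff_av isKer_eta hws ρ
  have hlip : ∀ y, dist y x₀ ≤ r → |Av η w y ρ - Av η w x₀ ρ| ≤ n * G * r := fun y hy => by
    refine (abs_sub_le_of_pd_le hwρ hG (fun z hz i => ?_) hy).trans (by gcongr)
    rw [pd_av isKer_eta hws]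
    exact hgrad z hz i
  have hmono : ∀ y, s y ≤ Av η s y ρ := fun y => h.sum_le_av y hρ.le
  set F : 𝔼 → ℝ := fun y => den u v y + (Av η s y ρ - s y) + (2 + n * G * r) with hF
  have hFc : Continuous F := (h.smooth_den.continuous.add (hsρ.continuous.sub hss.continuous)).add
    continuous_const
  have hF0 : ∀ y, 0 ≤ F y := fun y => by
    have h1 := h.den_nonneg y
    have h2 := hmono y
    have h3 : 0 ≤ n * G * r := by positivity
    simp only [hF]
    linarith
  have hle : ∀ y, dist y x₀ ≤ r → |s y - c| ≤ F y := fun y hy => by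
    have a1 := h.sum_sub_abs_diff_le y
    have a2 := h.abs_av_diff_sub_le y le_rfl hρ.le
    rw [av_eta_zero, av_eta_zero] at a2
    have a3 := hlip y hy
    have a4 := h.abs_diff_le y
    have a5 := abs_abs_sub_abs_le (w y) (Av η w x₀ ρ)
    have a6 : |w y - Av η w x₀ ρ| ≤ |Av η w y ρ - w y| + |Av η w y ρ - Av η w x₀ ρ| := by
      rw [abs_sub_comm (Av η w y ρ) (w y)]
      exact abs_sub_le _ _ _
    have a7 := abs_le.1 (a5.trans a6)
    simp only [hF]
    change _ ≤ s y at a4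
    change s y - |w y| ≤ _ at a1
    rw [abs_le]
    constructor <;> linarith
  have e1 : r ^ 2 * Av ψ (den u v) x₀ r = Av (lap ψ) (fun y => s y - c) x₀ r := by
    rw [av_sub (isKer_psi.lap contDiff_psi) (f := s) (g := fun _ => c) hss.continuous
      continuous_const, av_lap_psi_const, sub_zero, ← hls, av_lap isKer_psi contDiff_psi hss]
  have e2 : r ^ 2 * Av ψ (den u v) x₀ r ≤ C₁ * 2 ^ n * Av η F x₀ (2 * r) := by
    have := (h₁ F (fun y => s y - c) x₀ x₀ (2 * r) r hFc hF0 hr (by simp) hle).1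
    rw [mul_div_cancel_right₀ _ hr.ne', ← e1] at this
    exact (le_abs_self _).trans this
  have e3 : Av η F x₀ (2 * r) = Av η (den u v) x₀ (2 * r) +
      Av η (fun y => Av η s y ρ - s y) x₀ (2 * r) + (2 + n * G * r) := by
    have hc1 : Continuous fun y => den u v y + (Av η s y ρ - s y) :=
      h.smooth_den.continuous.add (hsρ.continuous.sub hss.continuous)
    rw [hF, av_add isKer_eta (f := fun y => den u v y + (Av η s y ρ - s y))
      (g := fun _ => 2 + n * G * r) hc1 continuous_const, av_eta_const,
      av_add isKer_eta (f := den u v) (g := fun y => Av η s y ρ - s y) h.smooth_den.continuous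
        (hsρ.continuous.sub hss.continuous)]
  have e4 : Av η (den u v) x₀ (2 * r) ≤ C₂ * 2 ^ n * Av ψ (den u v) x₀ (4 * r) := by
    have := (h₂ (den u v) x₀ x₀ (4 * r) (2 * r) h.smooth_den h.den_nonneg (by positivity)
      (by rw [dist_self]; linarith)).2.1
    rwa [show 4 * r / (2 * r) = 2 by field_simp; norm_num] at this
  have e5 : Av η (fun y => Av η s y ρ - s y) x₀ (2 * r) ≤
      C₃ * ρ ^ 2 * Av ψ (den u v) x₀ (40 * r) := by
    have := h₃ s x₀ (2 * r) ρ hss (fun y => by rw [hls]; exact h.den_nonneg y) (by positivity)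
      hρ.le (by linarith)
    rwa [hls, show 20 * (2 * r) = 40 * r by ring] at this
  have p4 := h.av_den_nonneg x₀ (4 * r)
  have p40 := h.av_den_nonneg x₀ (40 * r)
  set D₄ := Av ψ (den u v) x₀ (4 * r)
  set D₄₀ := Av ψ (den u v) x₀ (40 * r)
  have e6 : r ^ 2 * Av ψ (den u v) x₀ r ≤ C₁ * 2 ^ n * (C₂ * 2 ^ n * D₄ +
      C₃ * ρ ^ 2 * D₄₀ + (2 + n * G * r)) := by
    rw [e3] at e2
    refine e2.trans ?_
    gcongr
  set q := G + 1 / r + D₄ / r + (ρ / r) ^ 2 * (r * D₄₀) with hq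
  have e7 : C₂ * 2 ^ n * D₄ + C₃ * ρ ^ 2 * D₄₀ + (2 + n * G * r) ≤
      (n + 2 + C₂ * 2 ^ n + C₃) * (r * q) := by
    have hrq : r * q = G * r + 1 + D₄ + ρ ^ 2 * D₄₀ := by
      rw [hq]; field_simp
    have b1 : 0 ≤ G * r := by positivity
    have b2 : 0 ≤ ρ ^ 2 * D₄₀ := by positivity
    have c1 : n * (G * r) ≤ n * (r * q) :=
      mul_le_mul_of_nonneg_left (by linarith) (by positivity)
    have c2 : 2 * 1 ≤ 2 * (r * q) := by gcongr; linarith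
    have c3 : C₂ * 2 ^ n * D₄ ≤ C₂ * 2 ^ n * (r * q) := by gcongr; linarith
    have c4 : C₃ * (ρ ^ 2 * D₄₀) ≤ C₃ * (r * q) :=
      mul_le_mul_of_nonneg_left (by linarith) (by positivity)
    linarith
  have e8 : r * (r * Av ψ (den u v) x₀ r) ≤
      r * (C₁ * 2 ^ n * (n + 2 + C₂ * 2 ^ n + C₃) * q) := by
    calc _ = r ^ 2 * Av ψ (den u v) x₀ r := by ring
      _ ≤ C₁ * 2 ^ n * ((n + 2 + C₂ * 2 ^ n + C₃) * (r * q)) := e6.trans (by gcongr)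
      _ = _ := by ring
  exact le_of_mul_le_mul_left e8 hr

end LinearGrowth

section DensityBound

variable {n : ℕ} {u v : EuclideanSpace ℝ (Fin n) → ℝ}

local notation "𝔼" => EuclideanSpace ℝ (Fin n)
local notation "η" => eta n
local notation "ψ" => psi n

variable (n) in
/-- A bound for the normalized interaction at large scales propagates to nearby centres and
comparable scales, where it gives a power decay. -/
theorem exists_jden_decay_of_center {ε : ℝ} (hε : 0 < ε) (K : ℝ) : ∃ μ > (0 : ℝ),
    ∃ C ≥ (1 : ℝ), ∀ (u v : 𝔼 → ℝ) (x₀ y : 𝔼) (r t : ℝ), IsSolution u v → 0 < r → dist y x₀ ≤ r →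
      (∀ t ≥ 4 * r, t * Av ψ (den u v) x₀ t ≤ K) → ε * r ≤ t → C ≤ t →
      Av η (jden u v) y (2 * t) ≤ (C * t ^ (-μ)) ^ 2 := by
  obtain ⟨c, hc, H⟩ := exists_le_av_eta n
  obtain ⟨μ, hμ, C, hC, D⟩ := exists_jden_decay n (c * (4 * (1 + 1 / ε)) ^ n * K)
  refine ⟨μ, hμ, C, hC, fun u v x₀ y r t h hr hy hT hrt hCt => ?_⟩
  have ht : 0 < t := by linarith
  have := D u v y (8 * t) h (by linarith) fun τ hτ => by
    have hτ0 : 0 < τ := by linarith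
    have h1 := (H (den u v) x₀ y (4 * (τ + r)) τ h.smooth_den h.den_nonneg hτ0 (by linarith)).2.2.2
    have h2 := hT (4 * (τ + r)) (by linarith)
    have h3 : 4 * (τ + r) / τ ≤ 4 * (1 + 1 / ε) := by
      have : r ≤ 1 / ε * τ := by
        rw [one_div, inv_mul_eq_div, le_div_iff₀ hε]
        linarith
      rw [div_le_iff₀ hτ0]
      linarith
    have h4 := h.av_den_nonneg x₀ (4 * (τ + r))
    calc τ * Av ψ (den u v) y τ
        ≤ τ * (c * (4 * (τ + r) / τ) ^ n * Av ψ (den u v) x₀ (4 * (τ + r))) := by gcongr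
      _ = c * (4 * (τ + r) / τ) ^ n * (τ * Av ψ (den u v) x₀ (4 * (τ + r))) := by ring
      _ ≤ c * (4 * (1 + 1 / ε)) ^ n * K := by
        gcongr
        refine le_trans ?_ h2
        gcongr
        linarith
  rw [show 8 * t / 4 = 2 * t by ring] at this
  refine this.trans ?_
  gcongr ?_ ^ 2
  gcongr C * ?_
  exact Real.rpow_le_rpow_of_nonpos ht (by linarith) (by linarith)

/-- The normalized interaction is bounded at all scales that are not too small. -/
theorem exists_den_bound (h : IsSolution u v) (hmin : IsLocalMinimizer u v) {C₀ : ℝ} (hC₀ : 0 < C₀)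
    (hg : ∀ x, u x + v x ≤ C₀ * (1 + ‖x‖)) : ∃ K > 0, ∃ R₀ ≥ (1 : ℝ), ∀ (x : 𝔼) (r : ℝ), R₀ ≤ r →
      r * Av ψ (den u v) x r ≤ K := by
  obtain ⟨C₁, hC₁, h₁⟩ := exists_top_bound h hC₀ hg
  obtain ⟨C₂, hC₂, h₂⟩ := exists_den_step n
  set ε := 1 / (1 + C₂) with hε
  have hε0 : 0 < ε := by positivity
  have hε1 : ε ≤ 1 := by rw [hε, div_le_one (by positivity)]; linarith
  set K := C₁ + 2 * C₂ * (C₁ + 2) with hK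
  have hK0 : 0 < K := by positivity
  obtain ⟨μ, hμ, C₃, hC₃, h₃⟩ := exists_jden_decay_of_center n hε0 K
  obtain ⟨C₄, hC₄, h₄⟩ := exists_grad_diff_le n
  have hlim : Filter.Tendsto (fun r : ℝ => C₄ * C₃ / μ * (ε * r) ^ (-μ)) Filter.atTop (𝓝 0) := by
    simpa using ((tendsto_rpow_neg_atTop hμ).comp
      (Filter.tendsto_id.const_mul_atTop hε0)).const_mul (C₄ * C₃ / μ)
  obtain ⟨R₁, hR₁⟩ := Filter.eventually_atTop.1 (hlim.eventually_le_const one_pos)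
  set R₀ := max (max R₁ (C₃ / ε)) (1 + C₂) with hR₀
  have hstep : ∀ (x₀ : 𝔼) r, R₀ ≤ r → (∀ t ≥ 4 * r, t * Av ψ (den u v) x₀ t ≤ K) →
      r * Av ψ (den u v) x₀ r ≤ K := fun x₀ r hr hT => by
    have hr1 : R₁ ≤ r := (le_max_left _ _).trans ((le_max_left _ _).trans hr)
    have hr2 : C₃ ≤ ε * r := by
      have : C₃ / ε ≤ r := (le_max_right _ _).trans ((le_max_left _ _).trans hr)
      rw [div_le_iff₀ hε0] at this
      linarith
    have hr3 : 1 + C₂ ≤ r := (le_max_right _ _).trans hr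
    have hr0 : 0 < r := by linarith
    have hgrad : ∀ y, dist y x₀ ≤ r → ∀ i,
        |Av η (pd i fun x => u x - v x) y (ε * r)| ≤ C₁ + 1 := fun y hy i => by
      have a := h₄ u v y (ε * r) (max (ε * r) (1 + ‖y‖)) C₃ μ i h hmin (by positivity)
        (le_max_left _ _) (by linarith) hμ fun t ht =>
          h₃ u v x₀ y r t h hr0 hy hT ht (hr2.trans ht)
      have b := (h₁ y (max (ε * r) (1 + ‖y‖)) (le_max_right _ _)).2 i
      have c := hR₁ r hr1
      rw [abs_sub_comm] at a
      have d := abs_sub_abs_le_abs_sub (Av η (pd i fun x => u x - v x) y (ε * r))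
        (Av η (pd i fun x => u x - v x) y (max (ε * r) (1 + ‖y‖)))
      linarith
    have key := h₂ u v x₀ r (ε * r) (C₁ + 1) h hr0 (by positivity)
      (mul_le_of_le_one_left hr0.le hε1) (by positivity) hgrad
    have t4 := hT (4 * r) le_rfl
    have t40 := hT (40 * r) (by linarith)
    have p4 := h.av_den_nonneg x₀ (4 * r)
    have p40 := h.av_den_nonneg x₀ (40 * r)
    set D₄ := Av ψ (den u v) x₀ (4 * r)
    set D₄₀ := Av ψ (den u v) x₀ (40 * r)
    have hεC : C₂ * ε ≤ 1 := by
      rw [hε, mul_one_div, div_le_one (by positivity)]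
      linarith
    have a1 : 1 / r ≤ 1 := by
      rw [div_le_one hr0]
      linarith
    have a2 : C₂ * (D₄ / r) ≤ K / 4 := by
      rw [← mul_div_assoc, div_le_iff₀ hr0]
      have : C₂ * D₄ ≤ r * D₄ := by gcongr; linarith
      nlinarith
    have a3 : C₂ * ((ε * r / r) ^ 2 * (r * D₄₀)) ≤ K / 40 := by
      rw [mul_div_cancel_right₀ _ hr0.ne']
      calc C₂ * (ε ^ 2 * (r * D₄₀)) = (C₂ * ε) * ε * (r * D₄₀) := by ring
        _ ≤ 1 * 1 * (r * D₄₀) := by gcongr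
        _ ≤ _ := by linarith
    have a4 : C₂ * (1 / r) ≤ C₂ * 1 := by gcongr
    have a5 : 0 < C₂ * (C₁ + 2) := by positivity
    linarith
  have hind : ∀ (x₀ : 𝔼) (k : ℕ) r, R₀ ≤ r → 1 + ‖x₀‖ ≤ 4 ^ k * r →
      r * Av ψ (den u v) x₀ r ≤ K := fun x₀ k => by
    induction k with
    | zero =>
      intro r hr hk
      have := (h₁ x₀ r (by simpa using hk)).1
      have : 0 < C₂ * (C₁ + 2) := by positivity
      linarith
    | succ k ih =>
      intro r hr hk
      have hR₀r : 0 < r := by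
        have : 1 + C₂ ≤ r := (le_max_right _ _).trans hr
        linarith
      refine hstep x₀ r hr fun t ht => ih t (by linarith) (hk.trans ?_)
      rw [pow_succ, mul_assoc]
      gcongr
  have h1R : 1 ≤ R₀ := le_trans (by linarith) (le_max_right _ _)
  refine ⟨K, hK0, R₀, h1R, fun x r hr => ?_⟩
  obtain ⟨k, hk⟩ := pow_unbounded_of_one_lt (1 + ‖x‖) (by norm_num : (1 : ℝ) < 4)
  exact hind x k r hr (hk.le.trans (le_mul_of_one_le_right (by positivity) (h1R.trans hr)))

end DensityBound

section UnitScale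

variable {n : ℕ} {u v : EuclideanSpace ℝ (Fin n) → ℝ}

local notation "𝔼" => EuclideanSpace ℝ (Fin n)
local notation "η" => eta n
local notation "ψ" => psi n

variable (n) in
/-- Where the sum is large, the smaller component is controlled by the density, with a gain. -/
theorem exists_minor_le {ρ K : ℝ} (hρ : 1 ≤ ρ) (hK : 0 < K) : ∃ M ≥ (1 : ℝ), ∃ C > 0,
    ∀ (u v : 𝔼 → ℝ) (x : 𝔼), IsSolution u v → (∀ t ≥ ρ, t * Av ψ (den u v) x t ≤ K) →
      M ≤ Av η (fun y => u y + v y) x ρ → Av η v x ρ ≤ Av η u x ρ →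
      v x * Av η (fun y => u y + v y) x ρ ^ 4 ≤ C * Av ψ (den u v) x (320 * ρ) := by
  have hρ0 : 0 < ρ := by linarith
  obtain ⟨A, hA, C₁, hC₁, h₁⟩ := exists_product_decay n 4
  obtain ⟨C₂, hC₂, h₂⟩ := exists_decay_raw n
  obtain ⟨C₃, hC₃, h₃⟩ := exists_le_av_eta n
  obtain ⟨C₄, hC₄, h₄⟩ := exists_av_lap_le n
  set c₁ := 2 * (C₁ * (8 * ρ) ^ 4 * (1 + K) ^ (A + 2)) with hc₁
  set c₂ := C₃ * 320 ^ n with hc₂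
  set c₃ := C₂ * (4 * c₂ + 2 * (8 * ρ) ^ 2 * c₂ * c₁) with hc₃
  refine ⟨max C₁ (8 * ρ), hC₁.trans (le_max_left _ _),
    C₂ * (4 * C₄ * c₃ + 2 * ρ ^ 2 * c₂ * c₁), by positivity, fun u v x h hT hM hvu => ?_⟩
  set S := Av η (fun y => u y + v y) x ρ with hS
  set Z := Av η (fun y => u y + v y) x (8 * ρ) with hZ
  set P := Av ψ (den u v) x (320 * ρ) with hP
  have hP0 : 0 ≤ P := h.av_den_nonneg _ _
  have hS1 : C₁ ≤ S := (le_max_left _ _).trans hM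
  have hS2 : 8 * ρ ≤ S := (le_max_right _ _).trans hM
  have hS0 : 1 ≤ S := by linarith
  have hSZ : S ≤ Z := h.av_sum_monotone x hρ0.le (by linarith)
  have hPs : ∀ t, ρ ≤ t → t ≤ 160 * ρ → Av ψ (den u v) x t ≤ c₂ * P := fun t ht1 ht2 => by
    have ht : 0 < t := by linarith
    refine (h₃ (den u v) x x (320 * ρ) t h.smooth_den h.den_nonneg ht
      (by rw [dist_self]; linarith)).2.2.2.trans ?_
    rw [hc₂]
    gcongr
    rw [div_le_iff₀ ht]
    linarith
  have hu : S / 2 ≤ Av η u x ρ := by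
    have := h.av_sum_eq x ρ
    linarith
  have hu8 : S / 2 ≤ Av η u x (8 * ρ) := hu.trans (h.av_monotone x hρ0.le (by linarith))
  have hv8 : Av η v x (8 * ρ) ≤ c₁ / S ^ 3 := by
    have a := h₁ u v x (8 * ρ) Z h (by positivity) (by linarith)
      (hS1.trans (hSZ.trans (le_mul_of_one_le_left (by linarith) (by linarith))))
    have b := h.av_sum_le_of_den (r := 8 * ρ) (fun t ht => hT t (by linarith))
      (hS2.trans hSZ)
    have b' : Av η (fun y => u y + v y) x Z ≤ (1 + K) * Z := by nlinarith
    have c := h.av_mul_le_sq x Z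
    have hsZ := h.av_sum_pos x Z
    have hZ0 : 0 < Z := by linarith
    have hv := h.symm.av_pos x (8 * ρ)
    have d : Av η u x (8 * ρ) * Av η v x (8 * ρ) * Z ^ A ≤
        (C₁ * (8 * ρ) ^ 4 * (1 + K) ^ (A + 2)) / Z ^ 2 * Z ^ A := by
      calc _ ≤ _ := a
        _ ≤ C₁ * (8 * ρ / Z) ^ 4 * (((1 + K) * Z) ^ 2 * ((1 + K) * Z) ^ A) := by
          gcongr
          exact c.trans (by gcongr)
        _ = _ := by
          field_simp
          rw [mul_pow Z, pow_add]
          ac_rfl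
    have e := le_of_mul_le_mul_right d (by positivity)
    have f : S / 2 * Av η v x (8 * ρ) ≤
        (C₁ * (8 * ρ) ^ 4 * (1 + K) ^ (A + 2)) / S ^ 2 := by
      calc _ ≤ Av η u x (8 * ρ) * Av η v x (8 * ρ) := by gcongr
        _ ≤ _ := e
        _ ≤ _ := by gcongr
    rw [le_div_iff₀ (by positivity)] at f ⊢
    rw [hc₁]
    linarith
  have hraw : ∀ τ W, ρ ≤ τ → τ ≤ 8 * ρ → Av ψ (lap v) x τ ≤ W → 0 ≤ W →
      Av η v x (τ / 4) ≤ C₂ * (4 * W / S ^ 2 + 2 * τ ^ 2 * c₂ * P / S * (c₁ / S ^ 3)) :=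
    fun τ W h1 h2 hW hW0 => by
      have hτ : 0 < τ := by linarith
      have huτ : S / 2 ≤ Av η u x τ := hu.trans (h.av_monotone x hρ0.le h1)
      refine (h₂ u v x τ h.smooth h.symm.smooth h.pos h.symm.pos h.lap_nonneg h.symm.lap_left
        hτ).trans ?_
      have q1 : Av ψ (lap u) x (20 * τ) ≤ c₂ * P :=
        (h.av_psi_lap_le x (by positivity)).trans (hPs _ (by linarith) (by linarith))
      have q2 : Av η v x τ ≤ c₁ / S ^ 3 := (h.symm.av_monotone x hτ.le h2).trans hv8
      have q3 := h.symm.av_pos x τ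
      calc C₂ * (Av ψ (lap v) x τ / Av η u x τ ^ 2 +
            τ ^ 2 * Av ψ (lap u) x (20 * τ) / Av η u x τ * Av η v x τ)
          ≤ C₂ * (W / (S / 2) ^ 2 + τ ^ 2 * (c₂ * P) / (S / 2) * (c₁ / S ^ 3)) := by
            gcongr
        _ = _ := by field_simp; ring
  have hv2 : Av η v x (2 * ρ) ≤ c₃ * P / S ^ 2 := by
    have a := hraw (8 * ρ) (c₂ * P) (by linarith) le_rfl (by
      have := h.symm.av_psi_lap_le x (r := 8 * ρ) (by positivity)
      rw [den_comm] at this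
      exact this.trans (hPs _ (by linarith) (by linarith))) (by positivity)
    rw [show 8 * ρ / 4 = 2 * ρ by ring] at a
    refine a.trans ?_
    have : c₁ / S ^ 3 ≤ c₁ / S := by
      gcongr
      exact le_self_pow₀ hS0 (by norm_num)
    calc _ ≤ C₂ * (4 * (c₂ * P) / S ^ 2 + 2 * (8 * ρ) ^ 2 * c₂ * P / S * (c₁ / S)) := by gcongr
      _ = _ := by rw [hc₃]; field_simp
  have hl : Av ψ (lap v) x ρ ≤ C₄ * (c₃ * P / S ^ 2) := by
    have a := h₄ v x ρ h.symm.smooth (fun y => (h.symm.pos y).le) hρ0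
    have b := h.symm.av_pos x (2 * ρ)
    have c : 0 ≤ Av ψ (lap v) x ρ := av_nonneg psi_nonneg h.symm.lap_nonneg x ρ
    calc _ ≤ ρ ^ 2 * Av ψ (lap v) x ρ := le_mul_of_one_le_left c (one_le_pow₀ hρ)
      _ ≤ _ := a
      _ ≤ _ := by gcongr
  have hfin := hraw ρ _ le_rfl (by linarith) hl (by positivity)
  have hvx := (h.symm.le_av x (by positivity : 0 ≤ ρ / 4)).trans hfin
  calc v x * S ^ 4 ≤ C₂ * (4 * (C₄ * (c₃ * P / S ^ 2)) / S ^ 2 +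
        2 * ρ ^ 2 * c₂ * P / S * (c₁ / S ^ 3)) * S ^ 4 := by gcongr
    _ = _ := by field_simp

variable (n) in
theorem exists_pointwise_le {ρ K : ℝ} (hρ : 1 ≤ ρ) (hK : 0 < K) : ∃ C > 0,
    ∀ (u v : 𝔼 → ℝ) (x : 𝔼), IsSolution u v → (∀ t ≥ ρ, t * Av ψ (den u v) x t ≤ K) →
      jden u v x ≤ C * (den u v x + Av ψ (den u v) x (320 * ρ)) ∧ den u v x ≤ C := by
  obtain ⟨M, hM, C, hC, H⟩ := exists_minor_le n hρ hK
  have main : ∀ (u v : 𝔼 → ℝ) (x : 𝔼), IsSolution u v →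
      (∀ t ≥ ρ, t * Av ψ (den u v) x t ≤ K) → Av η v x ρ ≤ Av η u x ρ →
      jden u v x ≤ (M ^ 3 + C + C * K) * (den u v x + Av ψ (den u v) x (320 * ρ)) ∧
        den u v x ≤ M ^ 3 + C + C * K := fun u v x h hT hvu => by
    have hu := h.pos x
    have hv := h.symm.pos x
    have hd := h.den_nonneg x
    have hS0 : ∀ S, u x + v x ≤ S → 0 < S := fun S hS => by linarith
    have hP := h.av_den_nonneg x (320 * ρ)
    have hs := h.sum_le_av x (r := ρ) (by linarith)
    have hj := h.jden_le x
    have hM1 : M ≤ M ^ 3 := le_self_pow₀ hM (by norm_num)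
    have hden : ∀ S, u x + v x ≤ S → den u v x ≤ v x * S ^ 2 := fun S hS => by
      unfold den
      have := hS0 S hS
      calc u x * v x * (u x + v x) ≤ S * v x * S := by gcongr; linarith
        _ = _ := by ring
    set S := Av η (fun y => u y + v y) x ρ
    set P := Av ψ (den u v) x (320 * ρ)
    rcases le_total M S with hMS | hMS
    · have h1 := H u v x h hT hMS hvu
      have hS1 : 1 ≤ S := hM.trans hMS
      have h2 : v x * S ^ 3 ≤ C * P := h1.trans' (by gcongr; norm_num)
      have h3 : v x * S ^ 2 ≤ C * P := h2.trans' (by gcongr; norm_num)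
      have hPK : P ≤ K := (hT (320 * ρ) (by linarith)).trans'
        (le_mul_of_one_le_left hP (by linarith))
      have h4 := hden S hs
      constructor
      · calc jden u v x ≤ S * (v x * S ^ 2) := hj.trans (by gcongr)
          _ = v x * S ^ 3 := by ring
          _ ≤ C * P := h2
          _ ≤ _ := by
            gcongr
            · have : 0 < C * K := by positivity
              linarith
            · linarith
      · have : C * P ≤ C * K := by gcongr
        linarith
    · have hsM := hs.trans hMS
      constructor
      · calc jden u v x ≤ (M ^ 3) * den u v x := hj.trans (by gcongr; linarith)
          _ ≤ _ := by
            gcongr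
            · have : 0 < C * K := by positivity
              linarith
            · linarith
      · have h4 := hden M hsM
        have : v x * M ^ 2 ≤ M * M ^ 2 := by gcongr; linarith
        have : 0 < C * K := by positivity
        nlinarith
  refine ⟨M ^ 3 + C + C * K, by positivity, fun u v x h hT => ?_⟩
  rcases le_total (Av η v x ρ) (Av η u x ρ) with hvu | hvu
  · exact main u v x h hT hvu
  · have := main v u x h.symm (by rwa [den_comm]) hvu
    rwa [den_comm, jden_comm] at this

end UnitScale

section Asymptotics

variable {n : ℕ} {u v : EuclideanSpace ℝ (Fin n) → ℝ}

local notation "𝔼" => EuclideanSpace ℝ (Fin n)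
local notation "η" => eta n
local notation "ψ" => psi n

theorem exists_tendsto_of_abs_sub_le {F : ℝ → ℝ} {C μ : ℝ} (hμ : 0 < μ)
    (hF : ∀ r R, 0 < r → r ≤ R → |F R - F r| ≤ C * r ^ (-μ)) :
    ∃ e, Filter.Tendsto F Filter.atTop (𝓝 e) := by
  refine cauchySeq_tendsto_of_complete (Metric.cauchySeq_iff'.2 fun ε hε => ?_)
  have hlim : Filter.Tendsto (fun r : ℝ => C * r ^ (-μ)) Filter.atTop (𝓝 0) := by
    simpa using (tendsto_rpow_neg_atTop hμ).const_mul C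
  obtain ⟨N, hN, hN0⟩ := ((hlim.eventually_lt_const hε).and (Filter.eventually_gt_atTop 0)).exists
  exact ⟨N, fun R hR => (hF N R hN0 hR).trans_lt hN⟩

/-- The mean gradients at two centres have the same limit at infinity. -/
theorem tendsto_av_pd_sub {f : 𝔼 → ℝ} (hf : ContDiff ℝ ∞ f) {C₀ : ℝ} (hC₀ : 0 < C₀)
    (hg : ∀ x, |f x| ≤ C₀ * (1 + ‖x‖)) (y : 𝔼) (i : Fin n) :
    Filter.Tendsto (fun R => Av η (pd i f) y R - Av η (pd i f) 0 R) Filter.atTop (𝓝 0) := by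
  have hη : ContDiff ℝ ∞ η := contDiff_eta
  have hk : ∀ j, IsKer (pd j η) := fun j => isKer_eta.pd (hη.of_le (by simp)) j
  have hk1 : ∀ j, ContDiff ℝ ∞ (pd j η) := fun j => contDiff_pd hη j
  choose C hC H using fun j => exists_av_bound ((hk j).pd ((hk1 j).of_le (by simp)) i)
  set S := ∑ j, C j with hS
  have hS0 : 0 ≤ S := Finset.sum_nonneg fun j _ => (hC j).le
  have hlim : Filter.Tendsto (fun R : ℝ => n * (2 * S * C₀ / R) * dist y 0) Filter.atTop (𝓝 0) := by
    have := (tendsto_inv_atTop_zero (𝕜 := ℝ)).const_mul (n * (2 * S * C₀) * dist y 0)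
    rw [mul_zero] at this
    refine this.congr fun R => ?_
    rw [div_eq_mul_inv]
    ring
  refine squeeze_zero_norm' ?_ hlim
  filter_upwards [Filter.eventually_ge_atTop (1 + ‖y‖)] with R hR
  have hR0 : 0 < R := by linarith [norm_nonneg y]
  refine abs_sub_le_of_pd_le (f := fun y => Av η (pd i f) y R)
    (contDiff_av isKer_eta (contDiff_pd hf i) R) (r := dist y 0) (by positivity)
    (fun z hz j => ?_) le_rfl
  rw [pd_av isKer_eta (contDiff_pd hf i)]
  have a := av_pd isKer_eta (hη.of_le (by simp)) (contDiff_pd hf i) j z R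
  have b := av_pd (hk j) ((hk1 j).of_le (by simp)) hf i z R
  have c := H j f z R (C₀ * (2 * R)) hR0.le fun x hx => (hg x).trans (by
    gcongr
    rw [dist_zero_right, dist_zero_right] at hz
    rw [dist_eq_norm] at hx
    linarith [norm_le_norm_add_norm_sub' x z])
  have d : C j ≤ S := Finset.single_le_sum (fun j _ => (hC j).le) (Finset.mem_univ j)
  have e : R ^ 2 * Av η (pd j (pd i f)) z R = Av (pd i (pd j η)) f z R := by
    rw [sq, mul_assoc, a, mul_neg, b, neg_neg]
  rw [← e, abs_mul, abs_of_pos (by positivity)] at c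
  have g : R ^ 2 * |Av η (pd j (pd i f)) z R| ≤ R ^ 2 * (2 * S * C₀ / R) := by
    calc _ ≤ _ := c
      _ ≤ S * (C₀ * (2 * R)) := by gcongr
      _ = _ := by field_simp
  exact le_of_mul_le_mul_left g (by positivity)

/-- The interaction is bounded at every scale and its mean decays. -/
theorem exists_jden_le_inv (h : IsSolution u v) (hmin : IsLocalMinimizer u v) {C₀ : ℝ}
    (hC₀ : 0 < C₀) (hg : ∀ x, u x + v x ≤ C₀ * (1 + ‖x‖)) : ∃ C > 0, ∀ (y : 𝔼) (r : ℝ), 0 < r →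
      r * Av ψ (den u v) y r ≤ C ∧ r * Av η (jden u v) y r ≤ C := by
  obtain ⟨K, hK, R₀, hR₀, hT⟩ := exists_den_bound h hmin hC₀ hg
  obtain ⟨C₁, hC₁, h₁⟩ := exists_pointwise_le n hR₀ hK
  obtain ⟨C₂, hC₂, h₂⟩ := exists_av_bound (isKer_psi (n := n))
  obtain ⟨C₃, hC₃, h₃⟩ := exists_le_av_eta n
  set K' := K + R₀ * (C₂ * C₁) with hK'
  have hR₀0 : 0 < R₀ := by linarith
  have hK'0 : 0 < K' := by positivity
  have hT' : ∀ (y : 𝔼) (r : ℝ), 0 < r → r * Av ψ (den u v) y r ≤ K' := fun y r hr => by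
    rcases le_total R₀ r with hrR | hrR
    · have := hT y r hrR
      have : 0 < R₀ * (C₂ * C₁) := by positivity
      linarith
    · have a := (le_abs_self _).trans (h₂ (den u v) y r C₁ hr.le fun z _ => by
        rw [abs_of_nonneg (h.den_nonneg z)]
        exact (h₁ u v z h (hT z)).2)
      have : r * Av ψ (den u v) y r ≤ R₀ * (C₂ * C₁) := by
        gcongr
        exact h.av_den_nonneg y r
      linarith
  have hden : ∀ (y : 𝔼) (r : ℝ), 0 < r → Av η (den u v) y r ≤ C₃ * 2 ^ n * K' / r :=
    fun y r hr => by
      have a := (h₃ (den u v) y y (2 * r) r h.smooth_den h.den_nonneg hr (by simp)).2.1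
      rw [mul_div_cancel_right₀ _ hr.ne'] at a
      refine a.trans ?_
      rw [mul_div_assoc]
      gcongr
      rw [le_div_iff₀ hr]
      have := hT' y (2 * r) (by positivity)
      have := h.av_den_nonneg y (2 * r)
      nlinarith
  refine ⟨K' + C₁ * (C₃ * 2 ^ n * K' + C₂ * (C₃ * 2 ^ n * K')), by positivity,
    fun y r hr => ⟨?_, ?_⟩⟩
  · have : 0 < C₁ * (C₃ * 2 ^ n * K' + C₂ * (C₃ * 2 ^ n * K')) := by positivity
    linarith [hT' y r hr]
  have hcP : Continuous fun z => Av ψ (den u v) z (320 * R₀) :=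
    (contDiff_av isKer_psi h.smooth_den _).continuous
  have a : Av η (jden u v) y r ≤
      Av η (fun z => C₁ * (den u v z + Av ψ (den u v) z (320 * R₀))) y r :=
    av_mono isKer_eta eta_nonneg h.smooth_jden.continuous
      (continuous_const.mul (h.smooth_den.continuous.add hcP)) hr.le fun z _ =>
        (h₁ u v z h (hT z)).1
  rw [av_const_mul, av_add isKer_eta (f := den u v) (g := fun z => Av ψ (den u v) z (320 * R₀))
    h.smooth_den.continuous hcP, av_swap isKer_eta isKer_psi h.smooth_den.continuous] at a
  have b := (le_abs_self _).trans (h₂ (fun z => Av η (den u v) z r) y (320 * R₀) _ (by positivity)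
    fun z _ => by
      rw [abs_of_nonneg (av_nonneg eta_nonneg h.den_nonneg z r)]
      exact hden z r hr)
  have c := hden y r hr
  calc r * Av η (jden u v) y r
      ≤ r * (C₁ * (C₃ * 2 ^ n * K' / r + C₂ * (C₃ * 2 ^ n * K' / r))) := by
        gcongr
        exact a.trans (by gcongr)
    _ = C₁ * (C₃ * 2 ^ n * K' + C₂ * (C₃ * 2 ^ n * K')) := by field_simp
    _ ≤ _ := by linarith

theorem exists_asymptotics (h : IsSolution u v) (hmin : IsLocalMinimizer u v) {C₀ : ℝ}
    (hC₀ : 0 < C₀) (hg : ∀ x, u x + v x ≤ C₀ * (1 + ‖x‖)) : ∃ C > 0, ∃ e : Fin n → ℝ,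
      ∀ (y : 𝔼) (r : ℝ), 1 ≤ r → r * Av ψ (den u v) y r ≤ C ∧
        (∀ i, |Av η (pd i fun x => u x - v x) y r - e i| ≤ C * r ^ (-(1 / 2) : ℝ)) ∧
        |Av η (fun x => u x - v x) y r - (u y - v y)| ≤ C * r ^ (1 / 2 : ℝ) := by
  obtain ⟨K, hK, hj⟩ := exists_jden_le_inv h hmin hC₀ hg
  obtain ⟨C₁, hC₁, h₁⟩ := exists_grad_diff_le n
  obtain ⟨C₂, hC₂, h₂⟩ := exists_derivative_bound n
  set B := K + 1 with hB
  have hB0 : 0 < B := by positivity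
  have hjB : ∀ (y : 𝔼) (t : ℝ), 0 < t →
      Av η (jden u v) y (2 * t) ≤ (B * t ^ (-(1 / 2) : ℝ)) ^ 2 := fun y t ht => by
    have a := (hj y (2 * t) (by positivity)).2
    rw [mul_pow, ← Real.rpow_mul_natCast ht.le]
    norm_num
    rw [Real.rpow_neg_one, ← div_eq_mul_inv, le_div_iff₀ ht]
    nlinarith
  set C₃ := C₁ * B / (1 / 2) with hC₃
  have hC₃0 : 0 < C₃ := by positivity
  have hgr : ∀ (y : 𝔼) i r R, 0 < r → r ≤ R → |Av η (pd i fun x => u x - v x) y R -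
      Av η (pd i fun x => u x - v x) y r| ≤ C₃ * r ^ (-(1 / 2) : ℝ) := fun y i r R hr hrR =>
    h₁ u v y r R B (1 / 2) i h hmin hr hrR hB0 (by norm_num) fun t ht => hjB y t (by linarith)
  choose e he using fun i => exists_tendsto_of_abs_sub_le (by norm_num) (hgr 0 i)
  have he' : ∀ (y : 𝔼) i,
      Filter.Tendsto (Av η (pd i fun x => u x - v x) y) Filter.atTop (𝓝 (e i)) := fun y i => by
    have := (tendsto_av_pd_sub h.smooth_diff hC₀ (fun x => (h.abs_diff_le x).trans (hg x)) y i).add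
      (he i)
    simpa using this
  refine ⟨K + C₃ + 2 * C₂ * B, by positivity, e, fun y r hr => ⟨?_, fun i => ?_, ?_⟩⟩
  · have := (hj y r (by linarith)).1
    have : 0 < 2 * C₂ * B := by positivity
    linarith
  · have : |e i - Av η (pd i fun x => u x - v x) y r| ≤ C₃ * r ^ (-(1 / 2) : ℝ) :=
      le_of_tendsto ((he' y i).sub_const _).abs
        ((Filter.eventually_ge_atTop r).mono fun R hR => hgr y i r R (by linarith) hR)
    rw [abs_sub_comm]
    refine this.trans ?_
    gcongr
    have : 0 < 2 * C₂ * B := by positivity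
    linarith
  · have a := h.abs_av_diff_sub_le y (r := 0) le_rfl zero_le_one
    have b := h.av_sum_le_of_den (y := y) (r := 0) (K := K) (fun t ht => by
      rcases ht.eq_or_lt with rfl | ht
      · simpa using hK.le
      · exact (hj y t ht).1) zero_le_one
    rw [av_eta_zero] at a
    have hb : ∀ t : ℝ, 1 ≤ t → |t * Av ψ (lap fun x => u x - v x) y t| ≤
        C₂ * (B * t ^ (-(1 / 2) : ℝ)) := fun t ht =>
      (h₂ u v y t _ h hmin (by linarith)
        (mul_pos hB0 (Real.rpow_pos_of_pos (by linarith) _)) (hjB y t (by linarith))).1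
    have hd : ∀ c : ℝ, ∀ t ∈ Set.Icc 1 r, HasDerivAt (fun t => c * t ^ (1 / 2 : ℝ))
        (c * (1 / 2 * t ^ (-(1 / 2) : ℝ))) t := fun c t ht => by
      have := (Real.hasDerivAt_rpow_const (p := 1 / 2)
        (Or.inl (by linarith [ht.1] : t ≠ 0))).const_mul c
      norm_num at this ⊢
      exact this
    have hw : ∀ t ∈ Set.Icc 1 r, HasDerivAt (Av η (fun x => u x - v x) y)
        (t * Av ψ (lap fun x => u x - v x) y t) t := fun t _ => hasDerivAt_av_eta h.smooth_diff y t
    have h1 := sub_le_sub_of_hasDerivAt_le hr hw (hd (2 * C₂ * B)) fun t ht => by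
      linarith [(le_abs_self _).trans (hb t ht.1.le)]
    have h2 := sub_le_sub_of_hasDerivAt_le hr (hd (-(2 * C₂ * B))) hw fun t ht => by
      linarith [neg_le_of_abs_le (hb t ht.1.le)]
    have hr1 : 1 ≤ r ^ (1 / 2 : ℝ) := Real.one_le_rpow hr (by norm_num)
    rw [Real.one_rpow] at h1 h2
    have h3 : 0 < C₂ * B := by positivity
    have h4 : K * 1 ≤ K * r ^ (1 / 2 : ℝ) := by gcongr
    have h5 : 0 < C₃ * r ^ (1 / 2 : ℝ) := by positivity
    rw [abs_le] at a ⊢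
    constructor <;> linarith

end Asymptotics

section Caccioppoli

variable {n : ℕ} {u v : EuclideanSpace ℝ (Fin n) → ℝ}

local notation "𝔼" => EuclideanSpace ℝ (Fin n)
local notation "η" => eta n
local notation "ψ" => psi n

theorem lap_sq {f : 𝔼 → ℝ} (hf : ContDiff ℝ ∞ f) (x : 𝔼) :
    lap (fun y => f y ^ 2) x = 2 * ∑ i, pd i f x ^ 2 + 2 * (f x * lap f x) := by
  have e : ∀ i, pd i (fun y => f y ^ 2) = fun y => 2 * f y * pd i f y := fun i => by
    funext y
    simp_rw [sq]
    rw [pd_mul hf hf]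
    ring
  rw [lap_eq (hf.pow 2), lap_eq hf, Finset.mul_sum, Finset.mul_sum, Finset.mul_sum,
    ← Finset.sum_add_distrib]
  refine Finset.sum_congr rfl fun i _ => ?_
  rw [e, pd_mul (contDiff_const.mul hf) (contDiff_pd hf i), pd_mul contDiff_const hf]
  have : pd i (fun _ : 𝔼 => (2 : ℝ)) x = 0 := by simp [pd]
  rw [this]
  ring

variable (n) in
/-- Caccioppoli's inequality. -/
theorem exists_caccioppoli : ∃ C > 0, ∀ (f : 𝔼 → ℝ) (x : 𝔼) (r M : ℝ), ContDiff ℝ ∞ f →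
    0 < r → (∀ y, dist y x ≤ r → |f y| ≤ M) →
    Av ψ (fun y => ∑ i, pd i f y ^ 2) x r ≤ C * M ^ 2 / r ^ 2 + M * Av ψ (fun y => |lap f y|) x r := by
  obtain ⟨C, hC, H⟩ := exists_av_bound ((isKer_psi (n := n)).lap contDiff_psi)
  refine ⟨C, hC, fun f x r M hf hr hM => ?_⟩
  have hc1 : Continuous fun y => ∑ i, pd i f y ^ 2 :=
    continuous_finsetSum _ fun i _ => (contDiff_pd hf i).continuous.pow 2
  have hc2 : Continuous (lap f) := (contDiff_lap hf).continuous
  have hc3 : Continuous (lap fun y => f y ^ 2) := (contDiff_lap (hf.pow 2)).continuous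
  have h1 := (le_abs_self _).trans (H (fun y => f y ^ 2) x r (M ^ 2) hr.le fun y hy => by
    rw [abs_pow]
    gcongr
    exact hM y hy)
  rw [← av_lap isKer_psi contDiff_psi (hf.pow 2)] at h1
  have hM0 : 0 ≤ M := (abs_nonneg _).trans (hM x (by simpa using hr.le))
  have h2 : Av ψ (fun y => ∑ i, pd i f y ^ 2) x r ≤
      Av ψ (fun y => 1 / 2 * lap (fun y => f y ^ 2) y + M * |lap f y|) x r :=
    av_mono isKer_psi psi_nonneg hc1 ((continuous_const.mul hc3).add
      (continuous_const.mul hc2.abs)) hr.le fun y hy => by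
        change _ ≤ 1 / 2 * lap (fun y => f y ^ 2) y + M * |lap f y|
        rw [lap_sq hf]
        have : |f y * lap f y| ≤ M * |lap f y| := by
          rw [abs_mul]
          gcongr
          exact hM y hy
        linarith [neg_abs_le (f y * lap f y)]
  rw [av_add isKer_psi (f := fun y => 1 / 2 * lap (fun y => f y ^ 2) y)
    (g := fun y => M * |lap f y|) (continuous_const.mul hc3) (continuous_const.mul hc2.abs),
    av_const_mul, av_const_mul] at h2
  have h3 : Av ψ (lap fun y => f y ^ 2) x r ≤ C * M ^ 2 / r ^ 2 := by
    rw [le_div_iff₀ (by positivity)]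
    linarith
  have h4 : 0 ≤ C * M ^ 2 / r ^ 2 := by positivity
  change _ ≤ 1 / 2 * Av ψ (lap fun y => f y ^ 2) x r + _ at h2
  linarith

variable (n) in
theorem exists_setIntegral_ball_le : ∃ C > 0, ∀ (f : 𝔼 → ℝ) (x : 𝔼) (r : ℝ), Continuous f →
    (∀ y, 0 ≤ f y) → 0 < r → ∫ y in ball x r, f y ≤ C * r ^ n * Av ψ f x (2 * r) := by
  obtain ⟨c, hc, H⟩ := exists_lower_bound (n := n)
  refine ⟨2 ^ n / c, by positivity, fun f x r hf hf0 hr => ?_⟩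
  have hr2 : 0 < 2 * r := by positivity
  set g : 𝔼 → ℝ := fun y => ψ ((2 * r)⁻¹ • (y - x)) * f y with hg
  have hg0 : ∀ y, 0 ≤ g y := fun y => mul_nonneg (psi_nonneg _) (hf0 y)
  have hgc : Continuous g := by
    have := (isKer_psi (n := n)).cont
    fun_prop
  have hgs : HasCompactSupport g := by
    refine HasCompactSupport.intro (isCompact_closedBall x (2 * r)) fun y hy => ?_
    rw [mem_closedBall, not_le, dist_eq_norm] at hy
    have : ψ ((2 * r)⁻¹ • (y - x)) = 0 := isKer_psi.supp _ (by
      rw [norm_smul, norm_inv, Real.norm_of_nonneg hr2.le, inv_mul_eq_div, le_div_iff₀ hr2]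
      linarith)
    simp only [hg, this, zero_mul]
  have hgi : Integrable g := hgc.integrable_of_hasCompactSupport hgs
  have h1 : ∫ y in ball x r, c * f y ≤ ∫ y in ball x r, g y := by
    refine setIntegral_mono_on ?_ hgi.integrableOn measurableSet_ball fun y hy => ?_
    · exact ((continuous_const.mul hf).continuousOn.integrableOn_compact
        (isCompact_closedBall x r)).mono_set ball_subset_closedBall
    · refine mul_le_mul_of_nonneg_right (H _ ?_).2 (hf0 y)
      rw [mem_ball, dist_eq_norm] at hy
      rw [norm_smul, norm_inv, Real.norm_of_nonneg hr2.le, inv_mul_eq_div, div_le_iff₀ hr2]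
      linarith
  have h2 : ∫ y in ball x r, g y ≤ ∫ y, g y :=
    setIntegral_le_integral hgi (Filter.Eventually.of_forall hg0)
  rw [integral_const_mul] at h1
  have h3 := h1.trans (h2.trans_eq (integral_rescale ψ f x hr2))
  rw [mul_pow] at h3
  calc _ ≤ (2 ^ n * r ^ n * Av ψ f x (2 * r)) / c := by
        rw [le_div_iff₀ hc]
        linarith
    _ = _ := by ring

theorem IsSolution.abs_lap_diff_le (h : IsSolution u v) (x : 𝔼) :
    |lap (fun y => u y - v y) x| ≤ den u v x := by
  rw [lap_sub h.smooth h.symm.smooth, ← h.lap_sum, lap_add h.smooth h.symm.smooth]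
  have := h.lap_nonneg x
  have := h.symm.lap_nonneg x
  rw [abs_le]
  constructor <;> linarith

end Caccioppoli

/-- Uniqueness of the asymptotic cone at infinity: for a locally minimizing entire solution
with linear growth, there are a fixed vector e₀ and a constant C > 0 such that
∫_{B_R(x₀)} |∇(u - v) - e₀|² ≤ C R^{n - 1/2} for all x₀ and all R ≥ 1. -/
theorem unique_asymptotic_cone {n : ℕ} (hn : 2 ≤ n)
    (u v : EuclideanSpace ℝ (Fin n) → ℝ)
    (hsol : IsSolution u v) (hmin : IsLocalMinimizer u v)
    (C₀ : ℝ) (hC₀ : 0 < C₀) (hgrowth : ∀ x, u x + v x ≤ C₀ * (1 + ‖x‖)) :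
    ∃ (e₀ : EuclideanSpace ℝ (Fin n)) (C : ℝ), 0 < C ∧
      ∀ (x₀ : EuclideanSpace ℝ (Fin n)) (R : ℝ), 1 ≤ R →
        (∫ y in ball x₀ R, ‖gradient (fun z => u z - v z) y - e₀‖ ^ 2) ≤
          C * R ^ ((n : ℝ) - 1 / 2) := by
  obtain ⟨C₁, hC₁, e, h₁⟩ := exists_asymptotics hsol hmin hC₀ hgrowth
  obtain ⟨C₂, hC₂, h₂⟩ := exists_caccioppoli n
  obtain ⟨C₃, hC₃, h₃⟩ := exists_setIntegral_ball_le n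
  set c := C₁ * 2 + n * C₁ * 2 with hc
  refine ⟨WithLp.toLp 2 e, C₃ * (C₂ * c ^ 2 + c * C₁), by positivity, fun x₀ R hR => ?_⟩
  have hR0 : 0 < R := by linarith
  set w : EuclideanSpace ℝ (Fin n) → ℝ := fun z => u z - v z with hw
  have hws : ContDiff ℝ ∞ w := hsol.smooth_diff
  set q := R ^ (1 / 2 : ℝ) with hq
  have hq0 : 0 < q := Real.rpow_pos_of_pos hR0 _
  have hqR : q ^ 2 = R := by
    rw [hq, ← Real.rpow_mul_natCast hR0.le]
    norm_num
  have hqi : R ^ (-(1 / 2) : ℝ) = q⁻¹ := Real.rpow_neg hR0.le _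
  have hq1 : 1 ≤ q := Real.one_le_rpow hR (by norm_num)
  set l : EuclideanSpace ℝ (Fin n) → ℝ := fun y => ∑ i, e i * y i with hl
  have hls : ContDiff ℝ ∞ l := by
    refine ContDiff.sum fun i _ => contDiff_const.mul ?_
    exact (EuclideanSpace.proj (𝕜 := ℝ) i).contDiff
  have hpl : ∀ i y, pd i l y = e i := fun i y => by
    have : l = (∑ j, e j • (EuclideanSpace.proj j : EuclideanSpace ℝ (Fin n) →L[ℝ] ℝ) :
        EuclideanSpace ℝ (Fin n) →L[ℝ] ℝ) := by
      funext y
      simp [hl]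
    rw [pd, this, ContinuousLinearMap.fderiv]
    simp
  have hll : ∀ y, lap l y = 0 := fun y => by
    rw [lap_eq hls]
    refine Finset.sum_eq_zero fun i _ => ?_
    rw [funext (hpl i)]
    simp [pd]
  have hWs : ContDiff ℝ ∞ fun y => Av (eta n) w y R := contDiff_av isKer_eta hws R
  set a := Av (eta n) w x₀ R - l x₀ with ha
  set f : EuclideanSpace ℝ (Fin n) → ℝ := fun y => w y - (l y + a) with hf
  have hla : ContDiff ℝ ∞ fun y => l y + a := hls.add contDiff_const
  have hfs : ContDiff ℝ ∞ f := hws.sub hla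
  have hpd : ∀ i y, pd i f y = pd i w y - e i := fun i y => by
    have : pd i (fun _ : EuclideanSpace ℝ (Fin n) => a) y = 0 := by simp [pd]
    rw [hf, pd_sub hws hla, pd_add hls contDiff_const, hpl, this, add_zero]
  have hlap : ∀ y, lap f y = lap w y := fun y => by
    rw [lap_eq hfs, lap_eq hws]
    refine Finset.sum_congr rfl fun i _ => ?_
    have : pd i (fun _ : EuclideanSpace ℝ (Fin n) => e i) y = 0 := by simp [pd]
    rw [funext (hpd i), pd_sub (contDiff_pd hws i) contDiff_const, this, sub_zero]
  have hbound : ∀ y, dist y x₀ ≤ 2 * R → |f y| ≤ c * q := fun y hy => by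
    have b1 := (h₁ y R hR).2.2
    have b2 := abs_sub_le_of_pd_le (hWs.sub hls) (L := C₁ * q⁻¹) (by positivity)
      (fun z _ i => by
        change |pd i (fun z => Av (eta n) w z R - l z) z| ≤ _
        rw [pd_sub hWs hls, pd_av isKer_eta hws, hpl, ← hqi]
        exact (h₁ z R hR).2.1 i) hy
    have b3 : n * (C₁ * q⁻¹) * dist y x₀ ≤ n * C₁ * 2 * q := by
      calc _ ≤ n * (C₁ * q⁻¹) * (2 * R) := by gcongr
        _ = n * (C₁ * q⁻¹) * (2 * q ^ 2) := by rw [hqR]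
        _ = _ := by field_simp
    have b4 : f y = -(Av (eta n) w y R - w y) + ((Av (eta n) w y R - l y) -
        (Av (eta n) w x₀ R - l x₀)) := by
      simp only [hf, ha]
      ring
    rw [b4]
    refine (abs_add_le _ _).trans ?_
    rw [abs_neg, hc, add_mul]
    have : 0 < C₁ * q := by positivity
    refine add_le_add ?_ (b2.trans b3)
    change _ ≤ C₁ * q at b1
    linarith
  have key := h₂ f x₀ (2 * R) (c * q) hfs (by positivity) hbound
  have hden : Av (psi n) (fun y => |lap f y|) x₀ (2 * R) ≤ C₁ / (2 * R) := by
    have b1 : Av (psi n) (fun y => |lap f y|) x₀ (2 * R) ≤ Av (psi n) (den u v) x₀ (2 * R) :=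
      av_mono isKer_psi psi_nonneg (contDiff_lap hfs).continuous.abs hsol.smooth_den.continuous
        (by positivity) fun y _ => by
          rw [hlap]
          exact hsol.abs_lap_diff_le y
    refine b1.trans ?_
    rw [le_div_iff₀ (by positivity), mul_comm]
    exact (h₁ x₀ (2 * R) (by linarith)).1
  have hgrad : ∀ y, ‖gradient w y - WithLp.toLp 2 e‖ ^ 2 = ∑ i, pd i f y ^ 2 := fun y => by
    rw [EuclideanSpace.norm_sq_eq]
    simp [gradient_apply, hpd]
  have hint := h₃ (fun y => ∑ i, pd i f y ^ 2) x₀ R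
    (continuous_finsetSum _ fun i _ => (contDiff_pd hfs i).continuous.pow 2)
    (fun y => Finset.sum_nonneg fun i _ => sq_nonneg _) hR0
  have hpow : R ^ ((n : ℝ) - 1 / 2) = R ^ n * q⁻¹ := by
    rw [sub_eq_add_neg, Real.rpow_add hR0, Real.rpow_natCast, hqi]
  simp_rw [hgrad]
  have hfin : C₂ * (c * q) ^ 2 / (2 * R) ^ 2 + c * q * (C₁ / (2 * R)) ≤
      (C₂ * c ^ 2 + c * C₁) * q⁻¹ := by
    have b1 : C₂ * (c * q) ^ 2 / (2 * R) ^ 2 ≤ C₂ * c ^ 2 * q⁻¹ := by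
      rw [← hqR, ← div_eq_mul_inv, div_le_div_iff₀ (by positivity) hq0]
      have : q ^ 3 ≤ q ^ 4 := pow_le_pow_right₀ hq1 (by norm_num)
      calc C₂ * (c * q) ^ 2 * q = C₂ * c ^ 2 * q ^ 3 := by ring
        _ ≤ C₂ * c ^ 2 * (4 * q ^ 4) := by gcongr; linarith [pow_pos hq0 4]
        _ = _ := by ring
    have b2 : c * q * (C₁ / (2 * R)) ≤ c * C₁ * q⁻¹ := by
      rw [← hqR]
      calc _ = c * C₁ * q⁻¹ * (1 / 2) := by field_simp
        _ ≤ _ := mul_le_of_le_one_right (by positivity) (by norm_num)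
    linarith
  calc _ ≤ _ := hint
    _ ≤ C₃ * R ^ n * ((C₂ * c ^ 2 + c * C₁) * q⁻¹) := by
      gcongr
      refine key.trans (le_trans ?_ hfin)
      gcongr
    _ = _ := by rw [hpow]; ring
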